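/- If the primes have level of distribution θ for every θ < 1 (the Elliott–Halberstam conjecture), then liminf_{n → ∞} (p_{n+1} − p_n) ≤ 12. -/

import Mathlib

open Filter
open scoped ArithmeticFunction

/-- The primes have level of distribution `θ`: for every `A > 0` there is a constant `C` with
`∑_{q ≤ x^θ} sup_{(a,q)=1} |∑_{n ≤ x, n ≡ a [MOD q]} Λ(n) − x/φ(q)| ≤ C · x · (log x)^(−A)`
for all `x ≥ 2`. -/
def HasLevelOfDistribution (θ : ℝ) : Prop :=
  ∀ A : ℝ, 0 < A → ∃ C : ℝ, ∀ x : ℝ, 2 ≤ x →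
    ∑ q ∈ Finset.Icc 1 ⌊x ^ θ⌋₊,
      ⨆ a : {a : ℕ // a.Coprime q},
        |(∑ n ∈ Finset.Icc 1 ⌊x⌋₊,
            if n % q = (a : ℕ) % q then Λ n else 0) - x / (Nat.totient q)|
    ≤ C * x * Real.log x ^ (-A)

/-! ### Tensor products of local quadratic forms -/

section TensorForms

open Finset

/-- Splitting off one factor of a sum over functions on `Option ι`. -/
lemma sum_option_pi {ι L : Type*} [Fintype ι] [DecidableEq ι] [DecidableEq (Option ι)] [Fintype L]
    {M : Type*} [AddCommMonoid M] (f : (Option ι → L) → M) :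
    ∑ a, f a = ∑ a₀ : L, ∑ a : ι → L, f (fun o => o.elim a₀ a) := by
  rw [← Fintype.sum_prod_type']
  refine (Fintype.sum_equiv (Equiv.piOptionEquivProd (β := fun _ => L)) _ _ ?_)
  intro a
  congr 1
  funext o
  cases o <;> rfl

/-- A local upper bound for quadratic forms tensorizes. -/
theorem tensor_form_le {Ω L : Type} [Fintype Ω] [Fintype L]
    (ι : Type*) [Fintype ι] [DecidableEq ι]
    (w : ι → Ω → ℝ) (u : ι → Ω → L → ℝ) (D : ι → L → ℝ)
    (hw : ∀ i ω, 0 ≤ w i ω) (hD : ∀ i a, 0 ≤ D i a)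
    (hloc : ∀ i (x : L → ℝ), ∑ ω, w i ω * (∑ a, x a * u i ω a) ^ 2 ≤ ∑ a, D i a * x a ^ 2)
    (x : (ι → L) → ℝ) :
    ∑ ω : ι → Ω, (∏ i, w i (ω i)) * (∑ a : ι → L, x a * ∏ i, u i (ω i) (a i)) ^ 2 ≤
      ∑ a : ι → L, (∏ i, D i (a i)) * x a ^ 2 := by
  revert w u D x
  rename_i _ dec
  revert dec
  refine Fintype.induction_empty_option
    (P := fun ι _ => ∀ [DecidableEq ι] (w : ι → Ω → ℝ) (u : ι → Ω → L → ℝ) (D : ι → L → ℝ)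
      (_ : ∀ i ω, 0 ≤ w i ω) (_ : ∀ i a, 0 ≤ D i a)
      (_ : ∀ i (x : L → ℝ), ∑ ω, w i ω * (∑ a, x a * u i ω a) ^ 2 ≤ ∑ a, D i a * x a ^ 2)
      (x : (ι → L) → ℝ),
      ∑ ω : ι → Ω, (∏ i, w i (ω i)) * (∑ a : ι → L, x a * ∏ i, u i (ω i) (a i)) ^ 2 ≤
      ∑ a : ι → L, (∏ i, D i (a i)) * x a ^ 2) ?_ ?_ ?_ ι
  · intro α β _ e ih dec w u D hw hD hloc x
    let _ := Fintype.ofEquiv β e.symm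
    classical
    have h := ih (fun i => w (e i)) (fun i => u (e i)) (fun i => D (e i))
      (fun i => hw _) (fun i => hD _) (fun i => hloc _) (fun a => x (fun b => a (e.symm b)))
    have key : ∀ (T : Type) [Fintype T] (f : (α → T) → ℝ) (g : (β → T) → ℝ),
        (∀ a : β → T, g a = f (fun i => a (e i))) → ∑ a, g a = ∑ a, f a := by
      intro T _ f g hfg
      exact Fintype.sum_equiv (Equiv.arrowCongr e.symm (Equiv.refl T)) _ _ (fun a => hfg a)
    rw [key Ω (fun ω => (∏ i, w (e i) (ω i)) *
      (∑ a : α → L, x (fun b => a (e.symm b)) * ∏ i, u (e i) (ω i) (a i)) ^ 2), key L (fun a =>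
      (∏ i, D (e i) (a i)) * x (fun b => a (e.symm b)) ^ 2)]
    · convert h
    · intro a
      simp [← e.prod_comp (fun i => D i (a i))]
    · intro ω
      rw [← e.prod_comp (fun i => w i (ω i))]
      congr 2
      apply key
      intro a
      simp [← e.prod_comp (fun i => u i (ω i) (a i))]
  · intro _ w u D _ _ _ x
    simp
  · intro ι _ ih dec w u D hw hD hloc x
    classical
    rw [sum_option_pi, sum_option_pi]
    simp only [Fintype.prod_option, Option.elim_none, Option.elim_some]
    have h1 : ∀ ω₀ : Ω, ∑ ω : ι → Ω, (∏ i, w (some i) (ω i)) *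
        (∑ a : ι → L, (∑ a₀, x (fun o => o.elim a₀ a) * u none ω₀ a₀) *
          ∏ i, u (some i) (ω i) (a i)) ^ 2
        ≤ ∑ a : ι → L, (∏ i, D (some i) (a i)) *
          (∑ a₀, x (fun o => o.elim a₀ a) * u none ω₀ a₀) ^ 2 := fun ω₀ =>
      ih (fun i => w (some i)) (fun i => u (some i)) (fun i => D (some i))
        (fun i => hw _) (fun i => hD _) (fun i => hloc _)
        (fun a => ∑ a₀, x (fun o => o.elim a₀ a) * u none ω₀ a₀)
    calc _ = ∑ ω₀ : Ω, w none ω₀ * ∑ ω : ι → Ω, (∏ i, w (some i) (ω i)) *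
        (∑ a : ι → L, (∑ a₀, x (fun o => o.elim a₀ a) * u none ω₀ a₀) *
          ∏ i, u (some i) (ω i) (a i)) ^ 2 := by
          refine sum_congr rfl fun ω₀ _ => ?_
          rw [mul_sum]
          refine sum_congr rfl fun ω _ => ?_
          rw [sum_option_pi, sum_comm, mul_assoc]
          simp only [Option.elim_none, Option.elim_some, sum_mul, mul_assoc]
      _ ≤ ∑ ω₀ : Ω, w none ω₀ * ∑ a : ι → L, (∏ i, D (some i) (a i)) *
          (∑ a₀, x (fun o => o.elim a₀ a) * u none ω₀ a₀) ^ 2 :=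
          sum_le_sum fun ω₀ _ => mul_le_mul_of_nonneg_left (h1 ω₀) (hw _ _)
      _ = ∑ a : ι → L, (∏ i, D (some i) (a i)) *
          ∑ ω₀ : Ω, w none ω₀ * (∑ a₀, x (fun o => o.elim a₀ a) * u none ω₀ a₀) ^ 2 := by
          simp only [mul_sum]
          rw [sum_comm]
          refine sum_congr rfl fun a _ => sum_congr rfl fun ω₀ _ => by ring
      _ ≤ ∑ a : ι → L, (∏ i, D (some i) (a i)) *
          ∑ a₀, D none a₀ * x (fun o => o.elim a₀ a) ^ 2 :=
          sum_le_sum fun a _ => mul_le_mul_of_nonneg_left (hloc none _)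
            (prod_nonneg fun i _ => hD _ _)
      _ = _ := by
          simp only [mul_sum]
          rw [sum_comm]
          refine sum_congr rfl fun a _ => sum_congr rfl fun ω₀ _ => by ring

/-- A local lower bound for quadratic forms tensorizes. -/
theorem le_tensor_form {Ω L : Type} [Fintype Ω] [Fintype L]
    (ι : Type*) [Fintype ι] [DecidableEq ι]
    (w : ι → Ω → ℝ) (u : ι → Ω → L → ℝ) (D : ι → L → ℝ)
    (hw : ∀ i ω, 0 ≤ w i ω) (hD : ∀ i a, 0 ≤ D i a)
    (hloc : ∀ i (x : L → ℝ), ∑ a, D i a * x a ^ 2 ≤ ∑ ω, w i ω * (∑ a, x a * u i ω a) ^ 2)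
    (x : (ι → L) → ℝ) :
    ∑ a : ι → L, (∏ i, D i (a i)) * x a ^ 2 ≤
    ∑ ω : ι → Ω, (∏ i, w i (ω i)) * (∑ a : ι → L, x a * ∏ i, u i (ω i) (a i)) ^ 2 := by
  revert w u D x
  rename_i _ dec
  revert dec
  refine Fintype.induction_empty_option
    (P := fun ι _ => ∀ [DecidableEq ι] (w : ι → Ω → ℝ) (u : ι → Ω → L → ℝ) (D : ι → L → ℝ)
      (_ : ∀ i ω, 0 ≤ w i ω) (_ : ∀ i a, 0 ≤ D i a)
      (_ : ∀ i (x : L → ℝ), ∑ a, D i a * x a ^ 2 ≤ ∑ ω, w i ω * (∑ a, x a * u i ω a) ^ 2)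
      (x : (ι → L) → ℝ),
      ∑ a : ι → L, (∏ i, D i (a i)) * x a ^ 2 ≤
      ∑ ω : ι → Ω, (∏ i, w i (ω i)) * (∑ a : ι → L, x a * ∏ i, u i (ω i) (a i)) ^ 2) ?_ ?_ ?_ ι
  · intro α β _ e ih dec w u D hw hD hloc x
    let _ := Fintype.ofEquiv β e.symm
    classical
    have h := ih (fun i => w (e i)) (fun i => u (e i)) (fun i => D (e i))
      (fun i => hw _) (fun i => hD _) (fun i => hloc _) (fun a => x (fun b => a (e.symm b)))
    have key : ∀ (T : Type) [Fintype T] (f : (α → T) → ℝ) (g : (β → T) → ℝ),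
        (∀ a : β → T, g a = f (fun i => a (e i))) → ∑ a, g a = ∑ a, f a := by
      intro T _ f g hfg
      exact Fintype.sum_equiv (Equiv.arrowCongr e.symm (Equiv.refl T)) _ _ (fun a => hfg a)
    rw [key Ω (fun ω => (∏ i, w (e i) (ω i)) *
      (∑ a : α → L, x (fun b => a (e.symm b)) * ∏ i, u (e i) (ω i) (a i)) ^ 2), key L (fun a =>
      (∏ i, D (e i) (a i)) * x (fun b => a (e.symm b)) ^ 2)]
    · convert h
    · intro a
      simp [← e.prod_comp (fun i => D i (a i))]
    · intro ω
      rw [← e.prod_comp (fun i => w i (ω i))]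
      congr 2
      apply key
      intro a
      simp [← e.prod_comp (fun i => u i (ω i) (a i))]
  · intro _ w u D _ _ _ x
    simp
  · intro ι _ ih dec w u D hw hD hloc x
    classical
    rw [sum_option_pi, sum_option_pi]
    simp only [Fintype.prod_option, Option.elim_none, Option.elim_some]
    have h1 : ∀ ω₀ : Ω, ∑ a : ι → L, (∏ i, D (some i) (a i)) *
          (∑ a₀, x (fun o => o.elim a₀ a) * u none ω₀ a₀) ^ 2 ≤
        ∑ ω : ι → Ω, (∏ i, w (some i) (ω i)) *
        (∑ a : ι → L, (∑ a₀, x (fun o => o.elim a₀ a) * u none ω₀ a₀) *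
          ∏ i, u (some i) (ω i) (a i)) ^ 2 := fun ω₀ =>
      ih (fun i => w (some i)) (fun i => u (some i)) (fun i => D (some i))
        (fun i => hw _) (fun i => hD _) (fun i => hloc _)
        (fun a => ∑ a₀, x (fun o => o.elim a₀ a) * u none ω₀ a₀)
    change _ ≥ _
    calc _ = ∑ ω₀ : Ω, w none ω₀ * ∑ ω : ι → Ω, (∏ i, w (some i) (ω i)) *
        (∑ a : ι → L, (∑ a₀, x (fun o => o.elim a₀ a) * u none ω₀ a₀) *
          ∏ i, u (some i) (ω i) (a i)) ^ 2 := by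
          refine sum_congr rfl fun ω₀ _ => ?_
          rw [mul_sum]
          refine sum_congr rfl fun ω _ => ?_
          rw [sum_option_pi, sum_comm, mul_assoc]
          simp only [Option.elim_none, Option.elim_some, sum_mul, mul_assoc]
      _ ≥ ∑ ω₀ : Ω, w none ω₀ * ∑ a : ι → L, (∏ i, D (some i) (a i)) *
          (∑ a₀, x (fun o => o.elim a₀ a) * u none ω₀ a₀) ^ 2 :=
          sum_le_sum fun ω₀ _ => mul_le_mul_of_nonneg_left (h1 ω₀) (hw _ _)
      _ = ∑ a : ι → L, (∏ i, D (some i) (a i)) *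
          ∑ ω₀ : Ω, w none ω₀ * (∑ a₀, x (fun o => o.elim a₀ a) * u none ω₀ a₀) ^ 2 := by
          simp only [mul_sum]
          rw [sum_comm]
          refine sum_congr rfl fun a _ => sum_congr rfl fun ω₀ _ => by ring
      _ ≥ ∑ a : ι → L, (∏ i, D (some i) (a i)) *
          ∑ a₀, D none a₀ * x (fun o => o.elim a₀ a) ^ 2 :=
          sum_le_sum fun a _ => mul_le_mul_of_nonneg_left (hloc none _)
            (prod_nonneg fun i _ => hD _ _)
      _ = _ := by
          simp only [mul_sum]
          rw [sum_comm]
          refine sum_congr rfl fun a _ => sum_congr rfl fun ω₀ _ => by ring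

end TensorForms

/-! ### The local sieve forms -/

section LocalForms

open Finset

/-- Expanding a tensor-product square into pairs. -/
lemma tensor_square_expand {ι Ω L : Type*} [Fintype ι] [DecidableEq ι] [Fintype Ω] [Fintype L]
    (w : ι → Ω → ℝ) (v : ι → Ω → L → ℝ) (x : (ι → L) → ℝ) :
    ∑ ω : ι → Ω, (∏ i, w i (ω i)) * (∑ a : ι → L, x a * ∏ i, v i (ω i) (a i)) ^ 2 =
      ∑ a : ι → L, ∑ b : ι → L, x a * x b * ∏ i, ∑ ω, w i ω * (v i ω (a i) * v i ω (b i)) := by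
  simp_rw [Fintype.prod_sum, pow_two, sum_mul_sum, mul_sum]
  rw [sum_comm]
  refine sum_congr rfl fun a _ => ?_
  rw [sum_comm]
  refine sum_congr rfl fun b _ => sum_congr rfl fun ω _ => ?_
  simp only [prod_mul_distrib]
  ring

/-- A tensor-product change of variables. -/
lemma tensor_change_basis {ι L L' : Type*} [Fintype ι] [DecidableEq ι] [Fintype L] [Fintype L']
    (B : ι → L → L' → ℝ) (v : ι → L → ℝ) (z : (ι → L') → ℝ) :
    ∑ a : ι → L, (∑ r : ι → L', z r * ∏ i, B i (a i) (r i)) * ∏ i, v i (a i) =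
      ∑ r : ι → L', z r * ∏ i, ∑ a, B i a (r i) * v i a := by
  simp_rw [Fintype.prod_sum, sum_mul, mul_sum]
  rw [sum_comm]
  refine sum_congr rfl fun r _ => sum_congr rfl fun a _ => ?_
  rw [prod_mul_distrib]
  ring

variable {k : ℕ}

/-- The indicator that the condition labelled `a` holds in the state `ω`. -/
def incidence (ω a : Option (Fin k)) : ℝ := if a = none ∨ a = ω then 1 else 0

/-- The change of basis from indicators to centred indicators. -/
noncomputable def centering (p : ℝ) (a r : Option (Fin k)) : ℝ :=
  if a = r then 1 else if a = none then -(1 / p) else 0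

/-- Each of `k` disjoint events has probability `t`. -/
def stateWeight (t : ℝ) (ω : Option (Fin k)) : ℝ := if ω = none then 1 - k * t else t

/-- The probability that the conditions labelled `a` and `b` both hold. -/
def jointWeight (t : ℝ) (a b : Option (Fin k)) : ℝ :=
  if a = none ∧ b = none then 1 else if a = none ∨ b = none ∨ a = b then t else 0

lemma sum_stateWeight_incidence (t : ℝ) (a b : Option (Fin k)) :
    ∑ ω, stateWeight t ω * (incidence ω a * incidence ω b) = jointWeight t a b := by
  rw [Fintype.sum_option]
  rcases a with _ | i <;> rcases b with _ | j <;>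
    simp [stateWeight, incidence, jointWeight, eq_comm]

lemma sum_centering_incidence_none (p : ℝ) (ω : Option (Fin k)) :
    ∑ a, centering p a none * incidence ω a = 1 := by
  rw [Fintype.sum_option]
  simp [centering, incidence]

lemma sum_centering_incidence_some (p : ℝ) (ω : Option (Fin k)) (i : Fin k) :
    ∑ a, centering p a (some i) * incidence ω a = (if ω = some i then 1 else 0) - 1 / p := by
  rw [Fintype.sum_option]
  rcases ω with _ | j <;> simp [centering, incidence]
  ring

/-- The diagonal weights bounding the sieve form from above. -/
noncomputable def upperDiag (p : ℝ) (a : Option (Fin k)) : ℝ := if a = none then 1 else 1 / p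

/-- The diagonal weights bounding the sieve form over primes from below. -/
noncomputable def lowerDiag (p : ℝ) (a : Option (Fin k)) : ℝ :=
  if a = none then 1 - 2 / p ^ 2 else 1 / p * (1 - 24 / p)

lemma local_form_eq (t p : ℝ) (x : Option (Fin k) → ℝ) :
    ∑ ω : Option (Fin k), stateWeight t ω *
      (∑ r, x r * ∑ a, centering p a r * incidence ω a) ^ 2 =
    (x none - (∑ i, x (some i)) / p) ^ 2 +
      t * (2 * (x none - (∑ i, x (some i)) / p) * (∑ i, x (some i)) + ∑ i, x (some i) ^ 2) := by
  simp only [Fintype.sum_option (f := fun r => x r * _), sum_centering_incidence_none,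
    sum_centering_incidence_some]
  rw [Fintype.sum_option]
  simp only [stateWeight, reduceCtorEq, if_false, if_true, Option.some.injEq, mul_sub, mul_one,
    mul_ite, mul_zero, sum_sub_distrib, sum_ite_eq, mem_univ, ← sum_mul]
  set s := ∑ i, x (some i) with hs
  have : ∀ i : Fin k, t * (x none + (x (some i) - s * (1 / p))) ^ 2 =
      t * (x none - s / p) ^ 2 + (t * (2 * (x none - s / p))) * x (some i)
        + t * x (some i) ^ 2 := by
    intro i; ring
  simp only [this, sum_add_distrib, ← mul_sum, ← hs, sum_const, card_univ, Fintype.card_fin,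
    nsmul_eq_mul]
  ring

lemma local_form_le (p : ℝ) (hp : 0 < p) (x : Option (Fin k) → ℝ) :
    ∑ ω : Option (Fin k), stateWeight (1 / p) ω *
      (∑ r, x r * ∑ a, centering p a r * incidence ω a) ^ 2 ≤ ∑ r, upperDiag p r * x r ^ 2 := by
  rw [local_form_eq, Fintype.sum_option]
  simp only [upperDiag, if_true, reduceCtorEq, if_false, ← mul_sum]
  set s := ∑ i, x (some i)
  have : 0 ≤ (s / p) ^ 2 := sq_nonneg _
  have e : (x none - s / p) ^ 2 + 1 / p * (2 * (x none - s / p) * s + ∑ i, x (some i) ^ 2)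
    = x none ^ 2 - (s / p) ^ 2 + 1 / p * ∑ i, x (some i) ^ 2 := by
    field_simp; ring
  rw [e]; linarith

lemma le_local_form (p : ℝ) (hp : 2 ≤ p) (x : Option (Fin 4) → ℝ) :
    ∑ r, lowerDiag p r * x r ^ 2 ≤ ∑ ω : Option (Fin 4), stateWeight (1 / (p - 1)) ω *
      (∑ r, x r * ∑ a, centering p a r * incidence ω a) ^ 2 := by
  rw [local_form_eq, Fintype.sum_option]
  simp only [lowerDiag, if_true, reduceCtorEq, if_false, ← mul_sum]
  have hs : (∑ i, x (some i)) ^ 2 ≤ 4 * ∑ i, x (some i) ^ 2 := by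
    have := sq_sum_le_card_mul_sum_sq (s := univ) (f := fun i : Fin 4 => x (some i))
    simpa using this
  have hq : 0 ≤ ∑ i, x (some i) ^ 2 := sum_nonneg fun i _ => sq_nonneg _
  set s := ∑ i, x (some i)
  set q := ∑ i, x (some i) ^ 2
  set y := x none
  have hp1 : 0 < p - 1 := by linarith
  have hp0 : 0 < p := by linarith
  have e : (y - s / p) ^ 2 + 1 / (p - 1) * (2 * (y - s / p) * s + q) -
      ((1 - 2 / p ^ 2) * y ^ 2 + 1 / p * (1 - 24 / p) * q) =
      (2 * (p - 1) * y ^ 2 + 2 * y * s * p - s ^ 2 * (p + 1) + q * (p + 24 * (p - 1)))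
        / (p ^ 2 * (p - 1)) := by
    field_simp; ring
  have : 0 ≤ (2 * (p - 1) * y ^ 2 + 2 * y * s * p - s ^ 2 * (p + 1) + q * (p + 24 * (p - 1)))
        / (p ^ 2 * (p - 1)) := by
    apply div_nonneg _ (by positivity)
    have h1 : 0 ≤ p * (y + s) ^ 2 := by positivity
    have h2 : 0 ≤ (p - 2) * y ^ 2 := mul_nonneg (by linarith) (sq_nonneg y)
    have h3 : 0 ≤ (2 * p + 1) * (4 * q - s ^ 2) := mul_nonneg (by linarith) (by linarith)
    have h4 : 0 ≤ (17 * p - 28) * q := by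
      apply mul_nonneg _ hq
      linarith
    nlinarith
  linarith

variable (ι : Type) [Fintype ι] [DecidableEq ι]

lemma sieve_form_eq (t p : ι → ℝ) (z : (ι → Option (Fin k)) → ℝ) :
    ∑ a : ι → Option (Fin k), ∑ b : ι → Option (Fin k),
      (∑ r, z r * ∏ i, centering (p i) (a i) (r i)) *
      (∑ r, z r * ∏ i, centering (p i) (b i) (r i)) * ∏ i, jointWeight (t i) (a i) (b i) =
    ∑ ω : ι → Option (Fin k), (∏ i, stateWeight (t i) (ω i)) *
      (∑ r, z r * ∏ i, ∑ a, centering (p i) a (r i) * incidence (ω i) a) ^ 2 := by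
  simp_rw [← sum_stateWeight_incidence]
  rw [← tensor_square_expand]
  simp_rw [tensor_change_basis (fun i => centering (p i))]

/-- Upper bound for the sieve main term by its diagonalization. -/
theorem sieve_form_le (p : ι → ℝ) (hp : ∀ i, (k : ℝ) ≤ p i) (hp0 : ∀ i, 0 < p i)
    (z : (ι → Option (Fin k)) → ℝ) :
    ∑ a : ι → Option (Fin k), ∑ b : ι → Option (Fin k),
      (∑ r, z r * ∏ i, centering (p i) (a i) (r i)) *
      (∑ r, z r * ∏ i, centering (p i) (b i) (r i)) * ∏ i, jointWeight (1 / p i) (a i) (b i) ≤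
    ∑ r, (∏ i, upperDiag (p i) (r i)) * z r ^ 2 := by
  rw [sieve_form_eq ι (fun i => 1 / p i)]
  refine tensor_form_le ι _ _ _ ?_ ?_ (fun i => local_form_le (p i) (hp0 i)) z
  · intro i ω
    unfold stateWeight
    have := hp0 i
    split_ifs
    · rw [sub_nonneg, mul_one_div]
      exact div_le_one_of_le₀ (hp i) this.le
    · positivity
  · intro i a
    unfold upperDiag
    have := hp0 i
    split_ifs <;> positivity

lemma lowerDiag_nonneg {p : ℝ} (hp : 24 ≤ p) (a : Option (Fin k)) : 0 ≤ lowerDiag p a := by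
  unfold lowerDiag
  have h0 : 0 < p := by linarith
  split_ifs
  · rw [sub_nonneg]
    apply div_le_one_of_le₀ _ (by positivity)
    nlinarith
  · apply mul_nonneg (by positivity)
    rw [sub_nonneg]
    exact div_le_one_of_le₀ hp h0.le

/-- Lower bound for the sieve main term over primes by its diagonalization. -/
theorem le_sieve_form (p : ι → ℝ) (hp : ∀ i, 24 ≤ p i) (z : (ι → Option (Fin 4)) → ℝ) :
    ∑ r, (∏ i, lowerDiag (p i) (r i)) * z r ^ 2 ≤
    ∑ a : ι → Option (Fin 4), ∑ b : ι → Option (Fin 4),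
      (∑ r, z r * ∏ i, centering (p i) (a i) (r i)) *
      (∑ r, z r * ∏ i, centering (p i) (b i) (r i)) *
        ∏ i, jointWeight (1 / (p i - 1)) (a i) (b i) := by
  rw [sieve_form_eq ι (fun i => 1 / (p i - 1))]
  refine le_tensor_form ι _ _ _ ?_ ?_
    (fun i => le_local_form (p i) (by linarith [hp i])) z
  · intro i ω
    unfold stateWeight
    have h1 : 0 < p i - 1 := by linarith [hp i]
    split_ifs
    · rw [sub_nonneg, mul_one_div]
      apply div_le_one_of_le₀ _ h1.le
      push_cast
      linarith [hp i]
    · positivity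
  · intro i a
    exact lowerDiag_nonneg (hp i) a

end LocalForms

/-! ### Sums over integers without small prime factors -/

section RoughSums

open Finset

/-- The integers `1 ≤ s ≤ x` coprime to `W`. -/
noncomputable def roughs (W : ℕ) (x : ℝ) : Finset ℕ := {s ∈ Icc 1 ⌊x⌋₊ | s.Coprime W}

/-- The density `φ(W) / W`. -/
noncomputable def density (W : ℕ) : ℝ := (Nat.totient W : ℝ) / W

lemma density_pos {W : ℕ} (hW : 0 < W) : 0 < density W := by
  have := Nat.totient_pos.2 hW
  unfold density
  positivity

lemma density_le_one (W : ℕ) : density W ≤ 1 := by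
  unfold density
  exact div_le_one_of_le₀ (by exact_mod_cast Nat.totient_le W) (by positivity)

lemma mem_roughs {W s : ℕ} {x : ℝ} : s ∈ roughs W x ↔ (1 ≤ s ∧ (s : ℝ) ≤ x) ∧ s.Coprime W := by
  simp only [roughs, mem_filter, mem_Icc]
  constructor
  · rintro ⟨⟨h1, h2⟩, h3⟩
    exact ⟨⟨h1, (Nat.le_floor_iff' (by omega)).1 h2⟩, h3⟩
  · rintro ⟨⟨h1, h2⟩, h3⟩
    exact ⟨⟨h1, (Nat.le_floor_iff' (by omega)).2 h2⟩, h3⟩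

/-- The sum of reciprocals of the integers in `roughs W x`. -/
noncomputable def roughSum (W : ℕ) (x : ℝ) : ℝ := ∑ s ∈ roughs W x, (1 : ℝ) / s

lemma roughSum_nonneg (W : ℕ) (x : ℝ) : 0 ≤ roughSum W x :=
  sum_nonneg fun _ _ => by positivity

lemma roughs_mono {W : ℕ} {x y : ℝ} (h : x ≤ y) : roughs W x ⊆ roughs W y := by
  intro s hs
  rw [mem_roughs] at *
  exact ⟨⟨hs.1.1, hs.1.2.trans h⟩, hs.2⟩

lemma roughSum_mono {W : ℕ} {x y : ℝ} (h : x ≤ y) : roughSum W x ≤ roughSum W y :=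
  sum_le_sum_of_subset_of_nonneg (roughs_mono h) fun _ _ _ => by positivity

lemma roughs_eq_empty {W : ℕ} {x : ℝ} (h : x < 1) : roughs W x = ∅ := by
  ext s
  simp only [mem_roughs, notMem_empty, iff_false]
  rintro ⟨⟨h1, h2⟩, -⟩
  have : (1 : ℝ) ≤ s := by exact_mod_cast h1
  linarith

/-- The multiples of `p` in `roughs W x` are the multiples `p s` with `s ∈ roughs W (x / p)`. -/
lemma sum_roughs_multiples {W p : ℕ} (hp : 0 < p) (hc : p.Coprime W) (x : ℝ) :
    ∑ s ∈ roughs W x with p ∣ s, (1 : ℝ) / s = 1 / p * roughSum W (x / p) := by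
  rw [roughSum, mul_sum]
  symm
  have hp' : (0 : ℝ) < p := by exact_mod_cast hp
  refine sum_nbij' (fun s => p * s) (fun s => s / p) ?_ ?_ ?_ ?_ ?_
  · intro s hs
    rw [mem_roughs] at hs
    simp only [mem_filter, mem_roughs]
    refine ⟨⟨⟨Nat.mul_pos hp hs.1.1, ?_⟩, Nat.Coprime.mul_left hc hs.2⟩, dvd_mul_right _ _⟩
    have := hs.1.2
    rw [le_div_iff₀ hp'] at this
    push_cast
    linarith
  · intro s hs
    simp only [mem_filter, mem_roughs] at hs
    obtain ⟨⟨⟨h1, h2⟩, h3⟩, t, rfl⟩ := hs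
    rw [Nat.mul_div_cancel_left _ hp, mem_roughs]
    refine ⟨⟨Nat.pos_of_mul_pos_left h1, ?_⟩, h3.coprime_mul_left⟩
    rw [le_div_iff₀ hp']
    push_cast at h2
    linarith
  · intro s _
    exact Nat.mul_div_cancel_left _ hp
  · intro s hs
    exact Nat.mul_div_cancel' (mem_filter.1 hs).2
  · intro s _
    push_cast
    rw [one_div_mul_one_div]

lemma sum_roughs_multiples_le {W p : ℕ} (hp : 0 < p) (hc : p.Coprime W) (x : ℝ) :
    ∑ s ∈ roughs W x with p ∣ s, (1 : ℝ) / s ≤ 1 / p * roughSum W x := by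
  rcases lt_or_ge x 0 with hx | hx
  · simp [roughs_eq_empty (W := W) (show x < 1 by linarith), roughSum]
  rw [sum_roughs_multiples hp hc]
  gcongr
  apply roughSum_mono
  apply div_le_self hx
  exact_mod_cast hp

lemma roughSum_one_bounds {x : ℝ} (hx : 1 ≤ x) : |roughSum 1 x - Real.log x| ≤ 1 := by
  have e : roughSum 1 x = harmonic ⌊x⌋₊ := by
    rw [harmonic_eq_sum_Icc]
    simp [roughSum, roughs]
  rw [e, abs_le]
  constructor
  · linarith [log_le_harmonic_floor x (by linarith)]
  · linarith [harmonic_floor_le_one_add_log x hx]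

lemma roughSum_mul_prime {W p : ℕ} (hp : p.Prime) (hc : p.Coprime W) (x : ℝ) :
    roughSum (W * p) x = roughSum W x - 1 / p * roughSum W (x / p) := by
  rw [← sum_roughs_multiples hp.pos hc, roughSum, roughSum, eq_sub_iff_add_eq,
    ← sum_filter_add_sum_filter_not (roughs W x) (fun s => p ∣ s), add_comm]
  congr 2
  ext s
  have : s.Coprime p ↔ ¬ p ∣ s := by rw [Nat.coprime_comm, hp.coprime_iff_not_dvd]
  simp only [mem_filter, mem_roughs, Nat.coprime_mul_iff_right, this]
  tauto

lemma density_mul_prime {W p : ℕ} (hp : p.Prime) (hc : p.Coprime W) :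
    density (W * p) = density W * (1 - 1 / p) := by
  have h0 : (p : ℝ) ≠ 0 := by exact_mod_cast hp.ne_zero
  rw [density, density, Nat.totient_mul hc.symm, Nat.totient_prime hp]
  push_cast [hp.one_le]
  rcases eq_or_ne (W : ℝ) 0 with h | h
  · simp [h]
  field_simp

/-- `∑_{s ≤ x, (s, W) = 1} 1/s = (φ(W)/W) log x + O_W(1)`, for `W` a product of primes. -/
theorem roughSum_asymp (T : Finset ℕ) (hT : ∀ p ∈ T, p.Prime) :
    ∃ C : ℝ, 0 ≤ C ∧ ∀ x : ℝ, 1 ≤ x →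
      |roughSum (∏ p ∈ T, p) x - density (∏ p ∈ T, p) * Real.log x| ≤ C := by
  induction T using Finset.induction_on with
  | empty =>
    refine ⟨1, zero_le_one, fun x hx => ?_⟩
    simpa [density] using roughSum_one_bounds hx
  | insert p T hp ih =>
    obtain ⟨C, hC, h⟩ := ih fun q hq => hT q (mem_insert_of_mem hq)
    have hpp := hT p (mem_insert_self _ _)
    have hc : p.Coprime (∏ q ∈ T, q) := by
      rw [Nat.coprime_prod_right_iff]
      intro q hq
      rw [Nat.coprime_primes hpp (hT q (mem_insert_of_mem hq))]
      rintro rfl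
      exact hp hq
    have hp1 : (1 : ℝ) ≤ p := by exact_mod_cast hpp.one_le
    have hlp : 0 ≤ Real.log p := Real.log_nonneg hp1
    rw [prod_insert hp, mul_comm]
    set W := ∏ q ∈ T, q with hW
    have hd0 : 0 ≤ density W := by unfold density; positivity
    refine ⟨C + (C + Real.log p), by positivity, fun x hx => ?_⟩
    rw [roughSum_mul_prime hpp hc, density_mul_prime hpp hc]
    have h2 : |roughSum W (x / p) - density W * Real.log x| ≤ C + Real.log p := by
      rcases lt_or_ge (x / p) 1 with h1 | h1
      · rw [roughSum, roughs_eq_empty h1, sum_empty, zero_sub, abs_neg,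
          abs_of_nonneg (mul_nonneg hd0 (Real.log_nonneg hx))]
        have : Real.log x ≤ Real.log p := by
          apply Real.log_le_log (by linarith)
          rw [div_lt_one (by linarith)] at h1
          exact h1.le
        nlinarith [density_le_one W, Real.log_nonneg hx]
      · have := h _ h1
        rw [Real.log_div (by linarith) (by linarith)] at this
        have e : roughSum W (x / p) - density W * Real.log x =
          (roughSum W (x / p) - density W * (Real.log x - Real.log p)) -
            density W * Real.log p := by ring
        rw [e]
        refine (abs_sub _ _).trans (add_le_add this ?_)
        rw [abs_of_nonneg (by positivity)]
        nlinarith [density_le_one W]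
    have e : roughSum W x - 1 / p * roughSum W (x / p) - density W * (1 - 1 / p) * Real.log x =
      (roughSum W x - density W * Real.log x) -
        1 / p * (roughSum W (x / p) - density W * Real.log x) := by ring
    rw [e]
    refine (abs_sub _ _).trans (add_le_add (h x hx) ?_)
    rw [abs_mul, abs_of_nonneg (by positivity)]
    have : 1 / (p : ℝ) ≤ 1 := by
      rw [div_le_one (by linarith)]; exact hp1
    calc _ ≤ 1 * |roughSum W (x / p) - density W * Real.log x| := by gcongr
      _ ≤ _ := by rw [one_mul]; exact h2

open MeasureTheory intervalIntegral in
/-- Partial summation against `roughSum` on the logarithmic scale. -/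
theorem rough_log_sum {W : ℕ} {C : ℝ} (hC : 0 ≤ C)
    (hW : ∀ x : ℝ, 1 ≤ x → |roughSum W x - density W * Real.log x| ≤ C)
    {R : ℝ} (hR : 1 < R) {u : ℝ} (hu : 0 ≤ u) (g g' : ℝ → ℝ)
    (hg : ∀ t, HasDerivAt g (g' t) t) (hg' : Continuous g') {B : ℝ}
    (hB : |g u| ≤ B) (hB' : ∀ t ∈ Set.Icc 0 u, |g' t| ≤ B) :
    |∑ s ∈ roughs W (R ^ u), g (Real.log s / Real.log R) / s -
      density W * Real.log R * ∫ t in (0 : ℝ)..u, g t| ≤ C * (B + B * u) := by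
  set l := Real.log R with hl
  have hl0 : 0 < l := Real.log_pos hR
  set y := R ^ u with hy
  have hy1 : 1 ≤ y := Real.one_le_rpow hR.le hu
  have hly : Real.log y = u * l := by rw [hy, Real.log_rpow (by linarith)]
  have hlyu : Real.log y / l = u := by rw [hly]; field_simp
  have hgc : Continuous g := continuous_iff_continuousAt.2 fun t => (hg t).continuousAt
  set f : ℝ → ℝ := fun x => g (Real.log x / l) with hf
  have hfd : ∀ x, 0 < x → HasDerivAt f (g' (Real.log x / l) * (x⁻¹ / l)) x := by
    intro x hx
    exact HasDerivAt.comp x (hg _) ((Real.hasDerivAt_log hx.ne').div_const l)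
  have hpos : ∀ x ∈ Set.Icc 1 y, 0 < x := fun x hx => by linarith [hx.1]
  have hcont : ContinuousOn (fun x => g' (Real.log x / l) * (x⁻¹ / l)) (Set.Icc 1 y) := by
    have h1 : ContinuousOn (fun x => Real.log x / l) (Set.Icc 1 y) :=
      ContinuousOn.div_const (Real.continuousOn_log.mono fun x hx => (hpos x hx).ne') _
    exact (hg'.comp_continuousOn h1).mul
      ((continuousOn_inv₀.mono fun x hx => (hpos x hx).ne').div_const _)
  have hder : Set.EqOn (deriv f) (fun x => g' (Real.log x / l) * (x⁻¹ / l)) (Set.Icc 1 y) :=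
    fun x hx => (hfd x (hpos x hx)).deriv
  set c : ℕ → ℝ := fun n => if 1 ≤ n ∧ n.Coprime W then 1 / (n : ℝ) else 0 with hc
  have hA : ∀ x : ℝ, ∑ k ∈ Icc 0 ⌊x⌋₊, c k = roughSum W x := by
    intro x
    rw [roughSum, roughs, hc, ← sum_filter]
    apply sum_congr _ fun _ _ => rfl
    ext n; simp; tauto
  have hAbel := sum_mul_eq_sub_integral_mul₀ (f := f) (c := c) (by simp [hc]) y
    (fun t ht => (hfd t (hpos t ht)).differentiableAt)
    ((hcont.congr hder).integrableOn_Icc)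
  have hsum : ∑ s ∈ roughs W y, g (Real.log s / l) / s = ∑ k ∈ Icc 0 ⌊y⌋₊, f k * c k := by
    rw [roughs, hc]
    simp only [mul_ite, mul_zero]
    rw [← sum_filter]
    apply sum_congr
    · ext n; simp; tauto
    · intro n _
      simp [hf, div_eq_mul_inv]
  rw [hsum, hAbel]
  simp_rw [hA]
  rw [← integral_of_le hy1]
  have hparts : ∫ t in (1 : ℝ)..y, deriv f t * roughSum W t =
      ∫ t in (1 : ℝ)..y, (g' (Real.log t / l) * (t⁻¹ / l)) * roughSum W t := by
    apply integral_congr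
    intro t ht
    rw [Set.uIcc_of_le hy1] at ht
    simp only [hder ht]
  have hparts1 : IntervalIntegrable
      (fun t => (g' (Real.log t / l) * (t⁻¹ / l)) * roughSum W t) volume 1 y := by
    rw [intervalIntegrable_iff_integrableOn_Icc_of_le hy1]
    have := integrableOn_mul_sum_Icc c (m := 0) (a := 1) (b := y) zero_le_one
      hcont.integrableOn_Icc
    simpa only [hA] using this
  have hcl : ContinuousOn (fun t => (g' (Real.log t / l) * (t⁻¹ / l)) * (density W * Real.log t))
      (Set.Icc 1 y) :=
    hcont.mul (continuousOn_const.mul (Real.continuousOn_log.mono fun x hx => (hpos x hx).ne'))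
  have hparts2 : IntervalIntegrable
      (fun t => (g' (Real.log t / l) * (t⁻¹ / l)) * (density W * Real.log t)) volume 1 y := by
    rw [intervalIntegrable_iff_integrableOn_Icc_of_le hy1]
    exact hcl.integrableOn_Icc
  have hFTC : ∫ t in (1 : ℝ)..y, (g' (Real.log t / l) * (t⁻¹ / l)) * (density W * Real.log t) =
      f y * (density W * Real.log y) - density W * l * ∫ t in (0 : ℝ)..u, g t := by
    have hd : ∀ t ∈ Set.uIcc 1 y, HasDerivAt (fun x => f x * (density W * Real.log x) -
        density W * l * ∫ t in (0 : ℝ)..(Real.log x / l), g t)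
        ((g' (Real.log t / l) * (t⁻¹ / l)) * (density W * Real.log t)) t := by
      intro t ht
      rw [Set.uIcc_of_le hy1] at ht
      have h0 := hpos t ht
      have h1 := (hfd t h0).mul ((Real.hasDerivAt_log h0.ne').const_mul (density W))
      have h2 : HasDerivAt (fun v => ∫ t in (0 : ℝ)..v, g t) (g (Real.log t / l))
          (Real.log t / l) := integral_hasDerivAt_right (hgc.intervalIntegrable _ _)
            (hgc.stronglyMeasurableAtFilter _ _) hgc.continuousAt
      have h3 := (HasDerivAt.comp t h2 ((Real.hasDerivAt_log h0.ne').div_const l)).const_mul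
        (density W * l)
      refine (h1.sub h3).congr_deriv ?_
      simp only [hf]
      field_simp
      ring
    rw [integral_eq_sub_of_hasDerivAt hd hparts2]
    simp [hlyu]
  have e : f y * roughSum W y - (∫ t in (1 : ℝ)..y, deriv f t * roughSum W t) -
      density W * l * ∫ t in (0 : ℝ)..u, g t =
      f y * (roughSum W y - density W * Real.log y) -
      ∫ t in (1 : ℝ)..y, (g' (Real.log t / l) * (t⁻¹ / l)) *
        (roughSum W t - density W * Real.log t) := by
    have : ∫ t in (1 : ℝ)..y, (g' (Real.log t / l) * (t⁻¹ / l)) *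
        (roughSum W t - density W * Real.log t) =
        (∫ t in (1 : ℝ)..y, (g' (Real.log t / l) * (t⁻¹ / l)) * roughSum W t) -
        ∫ t in (1 : ℝ)..y, (g' (Real.log t / l) * (t⁻¹ / l)) * (density W * Real.log t) := by
      rw [← integral_sub hparts1 hparts2]
      simp only [mul_sub]
    rw [this, hFTC, hparts]
    ring
  rw [e]
  have hfy : |f y| ≤ B := by simpa [hf, hlyu] using hB
  have hB0 : 0 ≤ B := (abs_nonneg _).trans hB
  have hbint : |∫ t in (1 : ℝ)..y, (g' (Real.log t / l) * (t⁻¹ / l)) *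
        (roughSum W t - density W * Real.log t)| ≤ ∫ t in (1 : ℝ)..y, C * B / l * t⁻¹ := by
    rw [← Real.norm_eq_abs]
    apply norm_integral_le_of_norm_le hy1
    · refine Eventually.of_forall fun t ht => ?_
      have ht1 : 1 ≤ t := ht.1.le
      have ht0 : 0 < t := by linarith
      have hm : Real.log t / l ∈ Set.Icc 0 u := by
        refine ⟨div_nonneg (Real.log_nonneg ht1) hl0.le, ?_⟩
        rw [← hlyu]
        gcongr
        exact ht.2
      rw [norm_mul, norm_mul, Real.norm_eq_abs, Real.norm_eq_abs, Real.norm_eq_abs,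
        abs_of_nonneg (show 0 ≤ t⁻¹ / l by positivity)]
      calc _ ≤ B * (t⁻¹ / l) * C := by
            gcongr
            · exact hB' _ hm
            · exact hW t ht1
        _ = _ := by ring
    · apply ContinuousOn.intervalIntegrable
      rw [Set.uIcc_of_le hy1]
      exact continuousOn_const.mul (continuousOn_inv₀.mono fun x hx => (hpos x hx).ne')
  have hval : ∫ t in (1 : ℝ)..y, C * B / l * t⁻¹ = C * (B * u) := by
    rw [intervalIntegral.integral_const_mul, integral_inv_of_pos one_pos (by linarith), div_one, hly]
    field_simp
  rw [hval] at hbint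
  refine (abs_sub _ _).trans ?_
  rw [mul_add]
  refine add_le_add ?_ hbint
  rw [abs_mul, mul_comm]
  exact mul_le_mul (hW y hy1) hfy (abs_nonneg _) hC

end RoughSums

/-! ### Polynomials and the integration operator -/

section Polynomials

open Finset Nat

/-- The monomial `u ^ a / a! * q ^ b`. -/
noncomputable def dividedMonomial (a b : ℕ) (u q : ℝ) : ℝ := u ^ a / a ! * q ^ b

/-- Evaluation of a list of terms `(c, a, b)`, standing for `c * u ^ a / a! * q ^ b`. -/
noncomputable def polyEval (l : List (ℤ × ℕ × ℕ)) (u q : ℝ) : ℝ :=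
  (l.map fun m => (m.1 : ℝ) * dividedMonomial m.2.1 m.2.2 u q).sum

/-- The terms of `∫ t in 0..u, f (u - t) (q + t ^ 2)` for a single term `f`. -/
def termIntegral (m : ℤ × ℕ × ℕ) : List (ℤ × ℕ × ℕ) :=
  (List.range (m.2.2 + 1)).map fun j =>
    (m.1 * (m.2.2.choose j * (2 * j)!), m.2.1 + 2 * j + 1, m.2.2 - j)

/-- The terms of `∫ t in 0..u, f (u - t) (q + t ^ 2)`. -/
def polyIntegral (l : List (ℤ × ℕ × ℕ)) : List (ℤ × ℕ × ℕ) := l.flatMap termIntegral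

/-- The terms of a product. -/
def polyMul (l l' : List (ℤ × ℕ × ℕ)) : List (ℤ × ℕ × ℕ) :=
  l.flatMap fun m => l'.map fun m' =>
    (m.1 * m'.1 * (m.2.1 + m'.2.1).choose m.2.1, m.2.1 + m'.2.1, m.2.2 + m'.2.2)

lemma polyEval_nil (u q : ℝ) : polyEval [] u q = 0 := rfl

lemma polyEval_cons (m : ℤ × ℕ × ℕ) (l : List (ℤ × ℕ × ℕ)) (u q : ℝ) :
    polyEval (m :: l) u q = m.1 * dividedMonomial m.2.1 m.2.2 u q + polyEval l u q := by
  simp [polyEval]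

lemma polyEval_append (l l' : List (ℤ × ℕ × ℕ)) (u q : ℝ) :
    polyEval (l ++ l') u q = polyEval l u q + polyEval l' u q := by
  simp [polyEval]

lemma dividedMonomial_mul (a b a' b' : ℕ) (u q : ℝ) :
    dividedMonomial a b u q * dividedMonomial a' b' u q =
      (a + a').choose a * dividedMonomial (a + a') (b + b') u q := by
  have h : ((a + a').choose a : ℝ) * a ! * a' ! = (a + a')! := by
    have := Nat.add_choose_mul_factorial_mul_factorial a a'
    rw [← Nat.choose_symm_add] at this
    exact_mod_cast this
  have h1 : (a ! : ℝ) ≠ 0 := by positivity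
  have h2 : (a' ! : ℝ) ≠ 0 := by positivity
  have h3 : ((a + a').choose a : ℝ) ≠ 0 := by
    intro h0; rw [h0] at h; simp at h; exact absurd h.symm (by positivity)
  rw [dividedMonomial, dividedMonomial, dividedMonomial, ← h, pow_add, pow_add]
  field_simp

lemma polyEval_mul (l l' : List (ℤ × ℕ × ℕ)) (u q : ℝ) :
    polyEval (polyMul l l') u q = polyEval l u q * polyEval l' u q := by
  induction l with
  | nil => simp [polyMul, polyEval]
  | cons m l ih =>
    have e : polyMul (m :: l) l' = (l'.map fun m' =>
      (m.1 * m'.1 * (m.2.1 + m'.2.1).choose m.2.1, m.2.1 + m'.2.1, m.2.2 + m'.2.2)) ++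
        polyMul l l' := by simp [polyMul]
    rw [e, polyEval_append, ih, polyEval_cons, add_mul]
    congr 1
    clear e ih
    induction l' with
    | nil => simp [polyEval]
    | cons m' l' ih =>
      rw [List.map_cons, polyEval_cons, ih, polyEval_cons, mul_add]
      congr 1
      push_cast
      linear_combination (-(m.1 : ℝ) * m'.1) * dividedMonomial_mul m.2.1 m.2.2 m'.2.1 m'.2.2 u q

lemma integral_sub_pow_mul_pow (n a : ℕ) (u : ℝ) :
    ∫ t in (0 : ℝ)..u, (u - t) ^ a / a ! * t ^ n = n ! * (u ^ (a + n + 1) / (a + n + 1)!) := by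
  have hd : ∀ (a : ℕ) (t : ℝ),
      HasDerivAt (fun t => (u - t) ^ (a + 1) / (a + 1)!) (-((u - t) ^ a / a !)) t := by
    intro a t
    have h := (((hasDerivAt_id t).const_sub u).fun_pow (a + 1)).div_const ((a + 1)! : ℝ)
    refine h.congr_deriv ?_
    have : (a ! : ℝ) ≠ 0 := by positivity
    simp only [Nat.factorial_succ, id, Nat.add_sub_cancel]
    push_cast
    field_simp
  induction n generalizing a with
  | zero =>
    have := intervalIntegral.integral_eq_sub_of_hasDerivAt (a := 0) (b := u)
      (fun t _ => (hd a t).neg) (by apply Continuous.intervalIntegrable; fun_prop)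
    simp only [neg_neg] at this
    simp [this]
  | succ n ih =>
    have hd' : ∀ t : ℝ, HasDerivAt (fun t => -((u - t) ^ (a + 1) / (a + 1)! * t ^ (n + 1)))
        ((u - t) ^ a / a ! * t ^ (n + 1) -
          (n + 1) * ((u - t) ^ (a + 1) / (a + 1)! * t ^ n)) t := by
      intro t
      have h := ((hd a t).fun_mul (hasDerivAt_pow (n + 1) t)).neg
      refine h.congr_deriv ?_
      push_cast
      ring
    have := intervalIntegral.integral_eq_sub_of_hasDerivAt (a := 0) (b := u)
      (fun t _ => hd' t) (by apply Continuous.intervalIntegrable; fun_prop)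
    rw [intervalIntegral.integral_sub (by apply Continuous.intervalIntegrable; fun_prop)
      (by apply Continuous.intervalIntegrable; fun_prop), intervalIntegral.integral_const_mul,
      ih] at this
    simp only [sub_self, ne_eq, Nat.add_eq_zero_iff, one_ne_zero, and_false, not_false_eq_true,
      zero_pow, zero_div, zero_mul, neg_zero, mul_zero] at this
    rw [sub_eq_zero.1 this, Nat.factorial_succ n, show a + 1 + n + 1 = a + (n + 1) + 1 by ring]
    push_cast
    ring

lemma integral_dividedMonomial (c : ℤ) (a b : ℕ) (u q : ℝ) :
    ∫ t in (0 : ℝ)..u, (c : ℝ) * dividedMonomial a b (u - t) (q + t ^ 2) =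
      polyEval (termIntegral (c, a, b)) u q := by
  have e : ∀ t : ℝ, (c : ℝ) * dividedMonomial a b (u - t) (q + t ^ 2) =
      ∑ j ∈ range (b + 1), (c * b.choose j * q ^ (b - j)) *
        ((u - t) ^ a / a ! * t ^ (2 * j)) := by
    intro t
    rw [dividedMonomial, add_comm, add_pow, mul_sum, mul_sum]
    refine sum_congr rfl fun j _ => ?_
    rw [pow_mul]; ring
  simp_rw [e]
  rw [intervalIntegral.integral_finsetSum
    (fun _ _ => by apply Continuous.intervalIntegrable; fun_prop)]
  simp_rw [intervalIntegral.integral_const_mul, integral_sub_pow_mul_pow]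
  rw [polyEval, termIntegral, List.map_map, Finset.sum_eq_multiset_sum]
  simp only [range_val, Multiset.range, Multiset.map_coe, Multiset.sum_coe]
  congr 2
  funext j
  simp only [Function.comp, dividedMonomial]
  push_cast
  ring

lemma polyEval_integral_cons (m : ℤ × ℕ × ℕ) (l : List (ℤ × ℕ × ℕ)) (u q : ℝ) :
    polyEval (polyIntegral (m :: l)) u q =
      polyEval (termIntegral m) u q + polyEval (polyIntegral l) u q := by
  rw [← polyEval_append]; simp [polyIntegral]

lemma polyEval_bound (l : List (ℤ × ℕ × ℕ)) :
    ∃ B : ℝ, 0 ≤ B ∧ ∀ u q : ℝ, 0 ≤ u → 0 ≤ q → u + q ≤ 1 → |polyEval l u q| ≤ B := by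
  induction l with
  | nil => exact ⟨0, le_rfl, fun u q _ _ _ => by simp [polyEval_nil]⟩
  | cons m l ih =>
    obtain ⟨B, hB, h⟩ := ih
    refine ⟨|(m.1 : ℝ)| + B, by positivity, fun u q hu hq hs => ?_⟩
    rw [polyEval_cons]
    refine (abs_add_le _ _).trans (add_le_add ?_ (h u q hu hq hs))
    rw [abs_mul]
    refine mul_le_of_le_one_right (abs_nonneg _) ?_
    rw [dividedMonomial, abs_of_nonneg (by positivity)]
    refine mul_le_one₀ ?_ (by positivity) (pow_le_one₀ hq (by linarith))
    exact div_le_one_of_le₀ ((pow_le_one₀ hu (by linarith)).trans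
      (by exact_mod_cast Nat.one_le_iff_ne_zero.2 (Nat.factorial_ne_zero _))) (by positivity)

end Polynomials

/-! ### Iterated logarithmic sums -/

section IteratedSums

open Finset Nat

/-- The logarithm of `s` to base `R`. -/
noncomputable def relLog (R : ℝ) (s : ℕ) : ℝ := Real.log s / Real.log R

/-- The discrete analogue of `∫ t in 0..u, f (u - t) (q + t ^ 2)`. -/
noncomputable def roughStep (W : ℕ) (R : ℝ) (f : ℝ → ℝ → ℝ) (u q : ℝ) : ℝ :=
  ∑ s ∈ roughs W (R ^ u), 1 / (s : ℝ) * f (u - relLog R s) (q + relLog R s ^ 2)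

lemma relLog_nonneg {R : ℝ} (hR : 1 < R) {s : ℕ} (hs : 1 ≤ s) : 0 ≤ relLog R s :=
  div_nonneg (Real.log_nonneg (by exact_mod_cast hs)) (Real.log_pos hR).le

lemma relLog_le_iff {R : ℝ} (hR : 1 < R) {s : ℕ} (hs : 1 ≤ s) (u : ℝ) :
    relLog R s ≤ u ↔ (s : ℝ) ≤ R ^ u := by
  rw [relLog, div_le_iff₀ (Real.log_pos hR), ← Real.log_rpow (by linarith),
    Real.log_le_log_iff (by exact_mod_cast hs) (by positivity)]

lemma roughStep_domain {W : ℕ} {R : ℝ} (hR : 1 < R) {u q : ℝ} (hq : 0 ≤ q) (hs : u + q ≤ 1)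
    {s : ℕ} (h : s ∈ roughs W (R ^ u)) :
    0 ≤ u - relLog R s ∧ 0 ≤ q + relLog R s ^ 2 ∧ u - relLog R s + (q + relLog R s ^ 2) ≤ 1 := by
  rw [mem_roughs] at h
  have h0 := relLog_nonneg hR h.1.1
  have h1 := (relLog_le_iff hR h.1.1 u).2 h.1.2
  refine ⟨by linarith, by positivity, ?_⟩
  nlinarith

lemma roughStep_sub_le {W : ℕ} {R : ℝ} (hR : 1 < R) (f g : ℝ → ℝ → ℝ) {K : ℝ} (hK : 0 ≤ K)
    (h : ∀ u q : ℝ, 0 ≤ u → 0 ≤ q → u + q ≤ 1 → |f u q - g u q| ≤ K)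
    {u q : ℝ} (hq : 0 ≤ q) (hs : u + q ≤ 1) :
    |roughStep W R f u q - roughStep W R g u q| ≤ roughSum W R * K := by
  rw [roughStep, roughStep, ← sum_sub_distrib]
  refine (abs_sum_le_sum_abs _ _).trans ?_
  have : roughSum W (R ^ u) ≤ roughSum W R := by
    apply roughSum_mono
    calc R ^ u ≤ R ^ (1 : ℝ) := Real.rpow_le_rpow_of_exponent_le hR.le (by linarith)
      _ = R := Real.rpow_one R
  refine le_trans ?_ (mul_le_mul_of_nonneg_right this hK)
  rw [roughSum, sum_mul]
  refine sum_le_sum fun s hsm => ?_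
  rw [← mul_sub, abs_mul, abs_of_nonneg (by positivity : (0 : ℝ) ≤ 1 / s)]
  obtain ⟨h1, h2, h3⟩ := roughStep_domain hR hq hs hsm
  exact mul_le_mul_of_nonneg_left (h _ _ h1 h2 h3) (by positivity)

lemma roughStep_const_mul (W : ℕ) (R c : ℝ) (f : ℝ → ℝ → ℝ) (u q : ℝ) :
    roughStep W R (fun u q => c * f u q) u q = c * roughStep W R f u q := by
  rw [roughStep, roughStep, mul_sum]
  exact sum_congr rfl fun s _ => by ring

lemma roughStep_monomial {W : ℕ} {C : ℝ} (hC : 0 ≤ C)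
    (hW : ∀ x : ℝ, 1 ≤ x → |roughSum W x - density W * Real.log x| ≤ C)
    {R : ℝ} (hR : 1 < R) (c : ℤ) (a b : ℕ) {u q : ℝ} (hu : 0 ≤ u) (hq : 0 ≤ q)
    (hs : u + q ≤ 1) :
    |roughStep W R (fun u q => c * dividedMonomial a b u q) u q -
      density W * Real.log R * polyEval (termIntegral (c, a, b)) u q| ≤
      C * (|(c : ℝ)| * (1 + a + 2 * b) * 2) := by
  rw [← integral_dividedMonomial]
  set B := |(c : ℝ)| * (1 + a + 2 * b)
  set g : ℝ → ℝ := fun t => c * dividedMonomial a b (u - t) (q + t ^ 2) with hg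
  set g' : ℝ → ℝ := fun t => c * ((a * (u - t) ^ (a - 1) * (-1)) / a ! * (q + t ^ 2) ^ b +
    (u - t) ^ a / a ! * (b * (q + t ^ 2) ^ (b - 1) * (2 * t))) with hg'
  have hder : ∀ t, HasDerivAt g (g' t) t := by
    intro t
    have h1 := (((hasDerivAt_id t).const_sub u).fun_pow a).div_const (a ! : ℝ)
    have h2 := ((((hasDerivAt_id t).fun_pow 2).const_add q).fun_pow b)
    refine ((h1.fun_mul h2).const_mul (c : ℝ)).congr_deriv ?_
    simp [hg']
  have hf1 : (1 : ℝ) ≤ a ! := by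
    exact_mod_cast Nat.one_le_iff_ne_zero.2 (Nat.factorial_ne_zero _)
  have hpow : ∀ (x : ℝ) (n : ℕ), 0 ≤ x → x ≤ 1 → |x ^ n| ≤ 1 := by
    intro x n h0 h1
    rw [abs_of_nonneg (by positivity)]; exact pow_le_one₀ h0 h1
  have hfac : ∀ x : ℝ, |x / a !| ≤ |x| := by
    intro x
    rw [abs_div, abs_of_nonneg (by positivity : (0 : ℝ) ≤ a !)]
    exact div_le_self (abs_nonneg _) hf1
  have hdom : ∀ t ∈ Set.Icc 0 u, 0 ≤ u - t ∧ u - t ≤ 1 ∧ 0 ≤ q + t ^ 2 ∧ q + t ^ 2 ≤ 1 ∧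
      0 ≤ t ∧ t ≤ 1 := by
    rintro t ⟨h1, h2⟩
    refine ⟨by linarith, by linarith, by positivity, by nlinarith, h1, by linarith⟩
  have hb0 : (0 : ℝ) ≤ b := by positivity
  have ha0 : (0 : ℝ) ≤ a := by positivity
  have hB : |g u| ≤ B := by
    obtain ⟨h1, h2, h3, h4, h5, h6⟩ := hdom u ⟨hu, le_rfl⟩
    rw [hg]
    simp only [dividedMonomial, abs_mul]
    refine mul_le_mul_of_nonneg_left ?_ (abs_nonneg _)
    calc _ ≤ 1 * 1 := mul_le_mul ((hfac _).trans (hpow _ _ h1 h2)) (hpow _ _ h3 h4)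
            (abs_nonneg _) zero_le_one
      _ ≤ _ := by linarith
  have hB' : ∀ t ∈ Set.Icc 0 u, |g' t| ≤ B := by
    intro t ht
    obtain ⟨h1, h2, h3, h4, h5, h6⟩ := hdom t ht
    rw [hg']
    simp only [abs_mul]
    refine mul_le_mul_of_nonneg_left ?_ (abs_nonneg _)
    refine (abs_add_le _ _).trans ?_
    have e1 : |(a : ℝ) * (u - t) ^ (a - 1) * (-1) / (a ! : ℝ) * (q + t ^ 2) ^ b| ≤ (a : ℝ) * 1 := by
      rw [abs_mul]
      refine mul_le_mul ((hfac _).trans ?_) (hpow _ _ h3 h4) (abs_nonneg _) ha0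
      rw [abs_mul, abs_neg, abs_one, mul_one, abs_mul, abs_of_nonneg ha0]
      exact mul_le_of_le_one_right ha0 (hpow _ _ h1 h2)
    have e2 : |(u - t) ^ a / (a ! : ℝ) * ((b : ℝ) * (q + t ^ 2) ^ (b - 1) * (2 * t))| ≤ 1 * ((b : ℝ) * 1 * 2) := by
      rw [abs_mul]
      refine mul_le_mul ((hfac _).trans (hpow _ _ h1 h2)) ?_ (abs_nonneg _) zero_le_one
      rw [abs_mul, abs_mul, abs_of_nonneg hb0, abs_of_nonneg (by linarith : 0 ≤ 2 * t)]
      refine mul_le_mul (mul_le_mul_of_nonneg_left (hpow _ _ h3 h4) hb0) (by linarith)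
        (by linarith) (by positivity)
    linarith
  have hB0 : 0 ≤ B := (abs_nonneg _).trans hB
  have key := rough_log_sum hC hW hR hu g g' hder (by rw [hg']; fun_prop) hB hB'
  have e : roughStep W R (fun u q => c * dividedMonomial a b u q) u q =
      ∑ s ∈ roughs W (R ^ u), g (Real.log s / Real.log R) / s := by
    refine sum_congr rfl fun s _ => ?_
    simp only [hg, relLog]; ring
  rw [e]
  refine key.trans (mul_le_mul_of_nonneg_left ?_ hC)
  nlinarith

theorem roughStep_polyEval (l : List (ℤ × ℕ × ℕ)) :
    ∃ B : ℝ, 0 ≤ B ∧ ∀ (W : ℕ) (C : ℝ), 0 ≤ C →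
      (∀ x : ℝ, 1 ≤ x → |roughSum W x - density W * Real.log x| ≤ C) →
      ∀ R : ℝ, 1 < R → ∀ u q : ℝ, 0 ≤ u → 0 ≤ q → u + q ≤ 1 →
        |roughStep W R (polyEval l) u q -
          density W * Real.log R * polyEval (polyIntegral l) u q| ≤ C * B := by
  induction l with
  | nil =>
    refine ⟨0, le_rfl, fun W C _ _ R _ u q _ _ _ => ?_⟩
    simp [roughStep, polyIntegral, polyEval_nil]
  | cons m l ih =>
    obtain ⟨B, hB, h⟩ := ih
    refine ⟨|(m.1 : ℝ)| * (1 + m.2.1 + 2 * m.2.2) * 2 + B, by positivity,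
      fun W C hC hW R hR u q hu hq hs => ?_⟩
    have e : roughStep W R (polyEval (m :: l)) u q =
        roughStep W R (fun u q => m.1 * dividedMonomial m.2.1 m.2.2 u q) u q +
          roughStep W R (polyEval l) u q := by
      simp only [roughStep, polyEval_cons, mul_add, sum_add_distrib]
    rw [e, polyEval_integral_cons, mul_add, add_sub_add_comm, mul_add]
    exact (abs_add_le _ _).trans (add_le_add
      (roughStep_monomial hC hW hR m.1 m.2.1 m.2.2 hu hq hs) (h W C hC hW R hR u q hu hq hs))

lemma roughSum_le_mul_log {W : ℕ} {C : ℝ}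
    (hW : ∀ x : ℝ, 1 ≤ x → |roughSum W x - density W * Real.log x| ≤ C)
    {R : ℝ} (hR : 1 < R) (hl : 1 ≤ Real.log R) (hC : 0 ≤ C) :
    roughSum W R ≤ (1 + C) * Real.log R := by
  have h1 := (abs_le.1 (hW R hR.le)).2
  have h2 := density_le_one W
  nlinarith

/-- Asymptotics of iterated sums over integers coprime to `W`. -/
theorem iterate_roughStep_polyEval (l : List (ℤ × ℕ × ℕ)) (k : ℕ) {W : ℕ} {C : ℝ} (hC : 0 ≤ C)
    (hW : ∀ x : ℝ, 1 ≤ x → |roughSum W x - density W * Real.log x| ≤ C) :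
    ∃ K : ℝ, 0 ≤ K ∧ ∀ R : ℝ, 1 < R → 1 ≤ Real.log R →
      ∀ u q : ℝ, 0 ≤ u → 0 ≤ q → u + q ≤ 1 →
        |((roughStep W R)^[k] (polyEval l)) u q -
          (density W * Real.log R) ^ k * polyEval (polyIntegral^[k] l) u q| ≤
          K * (Real.log R ^ k / Real.log R) := by
  induction k with
  | zero => exact ⟨0, le_rfl, fun R _ _ u q _ _ _ => by simp⟩
  | succ k ih =>
    obtain ⟨K, hK, h⟩ := ih
    obtain ⟨B, hB, hB'⟩ := roughStep_polyEval (polyIntegral^[k] l)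
    refine ⟨(1 + C) * K + C * B, by positivity, fun R hR hl u q hu hq hs => ?_⟩
    rw [Function.iterate_succ_apply', Function.iterate_succ_apply']
    have hd0 : 0 ≤ density W := by unfold density; positivity
    have h1 := roughStep_sub_le (W := W) hR ((roughStep W R)^[k] (polyEval l))
      (fun u q => (density W * Real.log R) ^ k * polyEval (polyIntegral^[k] l) u q)
      (by positivity) (h R hR hl) hq hs
    rw [roughStep_const_mul] at h1
    have h2 := hB' W C hC hW R hR u q hu hq hs
    set Q := (density W * Real.log R) ^ k
    have hQ0 : 0 ≤ Q := by positivity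
    have hQ : Q ≤ Real.log R ^ k := by
      apply pow_le_pow_left₀ (by positivity)
      exact mul_le_of_le_one_left (by positivity) (density_le_one W)
    have h3 : roughSum W R * (K * (Real.log R ^ k / Real.log R)) ≤
        (1 + C) * K * Real.log R ^ k := by
      calc _ ≤ ((1 + C) * Real.log R) * (K * (Real.log R ^ k / Real.log R)) :=
            mul_le_mul_of_nonneg_right (roughSum_le_mul_log hW hR hl hC) (by positivity)
        _ = _ := by field_simp
    have h4 := mul_le_mul_of_nonneg_left h2 hQ0
    rw [← abs_of_nonneg hQ0, ← abs_mul, abs_of_nonneg hQ0] at h4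
    have h5 : Q * (C * B) ≤ Real.log R ^ k * (C * B) :=
      mul_le_mul_of_nonneg_right hQ (by positivity)
    have e : Real.log R ^ (k + 1) / Real.log R = Real.log R ^ k := by
      rw [pow_succ]; field_simp
    rw [e, pow_succ]
    calc _ = |(roughStep W R ((roughStep W R)^[k] (polyEval l)) u q -
          Q * roughStep W R (polyEval (polyIntegral^[k] l)) u q) +
          Q * (roughStep W R (polyEval (polyIntegral^[k] l)) u q - density W * Real.log R *
            polyEval (polyIntegral (polyIntegral^[k] l)) u q)| := by
            congr 1; ring
      _ ≤ _ := abs_add_le _ _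
      _ ≤ _ := by linarith

end IteratedSums

/-! ### Sums over tuples -/

section Tuples

open Finset

/-- Truncation of `f` to `0 ≤ u`. -/
noncomputable def trunc (f : ℝ → ℝ → ℝ) (u q : ℝ) : ℝ := if 0 ≤ u then f u q else 0

/-- `f` truncated to `0 ≤ u`, with `u` and `q` shifted by the tuple `g`. -/
noncomputable def tupleEval {k : ℕ} (R : ℝ) (f : ℝ → ℝ → ℝ) (g : Fin k → ℕ) (u q : ℝ) : ℝ :=
  trunc f (u - ∑ i, relLog R (g i)) (q + ∑ i, relLog R (g i) ^ 2)

lemma sum_piFinset_succ {k : ℕ} (A : Finset ℕ) (φ : (Fin (k + 1) → ℕ) → ℝ) :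
    ∑ g ∈ Fintype.piFinset (fun _ : Fin (k + 1) => A), φ g =
      ∑ s ∈ A, ∑ g ∈ Fintype.piFinset (fun _ : Fin k => A), φ (Fin.cons s g) := by
  rw [← sum_product']
  refine sum_nbij' (fun g => (g 0, Fin.tail g)) (fun x => Fin.cons x.1 x.2) ?_ ?_ ?_ ?_ ?_
  · intro g hg
    simp only [Fintype.mem_piFinset, mem_product] at hg ⊢
    exact ⟨hg 0, fun i => hg i.succ⟩
  · rintro ⟨s, g⟩ hg
    simp only [Fintype.mem_piFinset, mem_product] at hg ⊢
    intro i
    refine Fin.cases ?_ (fun j => ?_) i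
    · simpa using hg.1
    · simpa using hg.2 j
  · intro g _; simp
  · rintro ⟨s, g⟩ _; simp
  · intro g _; simp

lemma tuple_sum_eq (W : ℕ) {R : ℝ} (hR : 1 < R) (f : ℝ → ℝ → ℝ) (k : ℕ) (u q : ℝ) (hu : u ≤ 1) :
    ∑ g ∈ Fintype.piFinset (fun _ : Fin k => roughs W R),
      (∏ i, 1 / (g i : ℝ)) * tupleEval R f g u q = trunc ((roughStep W R)^[k] f) u q := by
  induction k generalizing u q with
  | zero => simp [tupleEval]
  | succ k ih =>
    rw [sum_piFinset_succ, Function.iterate_succ_apply']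
    have e : ∀ s : ℕ, ∀ g : Fin k → ℕ,
        (∏ i, 1 / ((Fin.cons s g : Fin (k + 1) → ℕ) i : ℝ)) *
          tupleEval R f (Fin.cons s g : Fin (k + 1) → ℕ) u q =
        1 / (s : ℝ) * ((∏ i, 1 / (g i : ℝ)) *
          tupleEval R f g (u - relLog R s) (q + relLog R s ^ 2)) := by
      intro s g
      simp only [tupleEval, Fin.prod_univ_succ, Fin.sum_univ_succ, Fin.cons_zero, Fin.cons_succ]
      rw [sub_sub, add_assoc, mul_assoc]
    simp_rw [e, ← mul_sum]
    have h1 : ∀ s ∈ roughs W R, 1 / (s : ℝ) * ∑ g ∈ Fintype.piFinset (fun _ : Fin k => roughs W R),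
        (∏ i, 1 / (g i : ℝ)) * tupleEval R f g (u - relLog R s) (q + relLog R s ^ 2) =
        if (s : ℝ) ≤ R ^ u then 1 / (s : ℝ) *
          ((roughStep W R)^[k] f) (u - relLog R s) (q + relLog R s ^ 2) else 0 := by
      intro s hs
      have hs1 := (mem_roughs.1 hs).1.1
      rw [ih _ _ (by linarith [relLog_nonneg hR hs1]), trunc]
      simp only [sub_nonneg, relLog_le_iff hR hs1]
      split_ifs <;> simp
    rw [sum_congr rfl h1, ← sum_filter]
    have h2 : (roughs W R).filter (fun s : ℕ => (s : ℝ) ≤ R ^ u) = roughs W (R ^ u) := by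
      ext s
      simp only [mem_filter, mem_roughs]
      have : R ^ u ≤ R := by
        calc R ^ u ≤ R ^ (1 : ℝ) := Real.rpow_le_rpow_of_exponent_le hR.le hu
          _ = R := Real.rpow_one R
      constructor
      · rintro ⟨⟨⟨h1, h2⟩, h3⟩, h4⟩; exact ⟨⟨h1, h4⟩, h3⟩
      · rintro ⟨⟨h1, h2⟩, h3⟩; exact ⟨⟨⟨h1, h2.trans this⟩, h3⟩, h2⟩
    rw [h2, trunc]
    split_ifs with h
    · rfl
    · rw [roughs_eq_empty (Real.rpow_lt_one_of_one_lt_of_neg hR (not_le.1 h)), sum_empty]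

lemma sum_biUnion_le_sum {α β : Type*} [DecidableEq β] (s : Finset α) (t : α → Finset β)
    (f : β → ℝ) (hf : ∀ b, 0 ≤ f b) : ∑ b ∈ s.biUnion t, f b ≤ ∑ a ∈ s, ∑ b ∈ t a, f b := by
  classical
  induction s using Finset.induction_on with
  | empty => simp
  | insert a s ha ih =>
    rw [biUnion_insert, sum_insert ha]
    have := sum_union_inter (s₁ := t a) (s₂ := s.biUnion t) (f := f)
    have h2 : 0 ≤ ∑ b ∈ t a ∩ s.biUnion t, f b := sum_nonneg fun b _ => hf b
    linarith

lemma sum_tuples (k : ℕ) (A : Finset ℕ) :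
    ∑ g ∈ Fintype.piFinset (fun _ : Fin k => A), ∏ i, 1 / (g i : ℝ) =
      (∑ s ∈ A, 1 / (s : ℝ)) ^ k := by
  rw [← prod_univ_sum (t := fun _ => A) (f := fun _ s => 1 / ((s : ℕ) : ℝ))]; simp

/-- Reciprocal sums over tuples whose `i`-th entry is divisible by `d i`. -/
lemma sum_tuples_multiples_le {k W : ℕ} (x : ℝ) (d : Fin k → ℕ) (hd : ∀ i, 0 < d i)
    (hc : ∀ i, (d i).Coprime W) :
    ∑ g ∈ Fintype.piFinset (fun _ : Fin k => roughs W x) with ∀ i, d i ∣ g i,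
      ∏ i, 1 / (g i : ℝ) ≤ (∏ i, 1 / (d i : ℝ)) * roughSum W x ^ k := by
  have e : (Fintype.piFinset (fun _ : Fin k => roughs W x)).filter (fun g => ∀ i, d i ∣ g i) =
      Fintype.piFinset (fun i => (roughs W x).filter (fun s => d i ∣ s)) := by
    ext g; simp only [mem_filter, Fintype.mem_piFinset, forall_and]
  rw [e, ← prod_univ_sum (f := fun _ s => 1 / ((s : ℕ) : ℝ))]
  calc _ ≤ ∏ i, (1 / (d i : ℝ) * roughSum W x) :=
        prod_le_prod (fun i _ => sum_nonneg fun s _ => by positivity)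
          fun i _ => sum_roughs_multiples_le (hd i) (hc i) x
    _ = _ := by rw [prod_mul_distrib]; simp

end Tuples

/-! ### Labellings of a set of primes -/

section Labels

open Finset

variable {P : Finset ℕ} {k : ℕ}

/-- The product of the labelled primes. -/
def labelSize (r : P → Option (Fin k)) : ℕ := ∏ p : P, if r p = none then 1 else (p : ℕ)

/-- The product of the primes with label `i`. -/
def labelCoord (r : P → Option (Fin k)) (i : Fin k) : ℕ :=
  ∏ p : P, if r p = some i then (p : ℕ) else 1

lemma prod_labelCoord (r : P → Option (Fin k)) : ∏ i, labelCoord r i = labelSize r := by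
  simp only [labelCoord, labelSize]
  rw [Finset.prod_comm]
  refine prod_congr rfl fun p _ => ?_
  rcases h : r p with _ | j <;> simp

lemma labelCoord_pos (hP : ∀ p ∈ P, p.Prime) (r : P → Option (Fin k)) (i : Fin k) :
    0 < labelCoord r i :=
  prod_pos fun p _ => by split_ifs <;> [exact (hP p p.2).pos; exact one_pos]

lemma labelSize_pos (hP : ∀ p ∈ P, p.Prime) (r : P → Option (Fin k)) : 0 < labelSize r :=
  prod_pos fun p _ => by split_ifs <;> [exact one_pos; exact (hP p p.2).pos]

lemma labelCoord_le_labelSize (hP : ∀ p ∈ P, p.Prime) (r : P → Option (Fin k)) (i : Fin k) :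
    labelCoord r i ≤ labelSize r := by
  rw [← prod_labelCoord]
  exact Nat.le_of_dvd (prod_pos fun j _ => labelCoord_pos hP r j)
    (dvd_prod_of_mem _ (mem_univ i))

lemma dvd_labelCoord_iff (hP : ∀ p ∈ P, p.Prime) (r : P → Option (Fin k)) (i : Fin k) (p : P) :
    (p : ℕ) ∣ labelCoord r i ↔ r p = some i := by
  constructor
  · intro h
    obtain ⟨q, -, hq⟩ := ((hP p p.2).prime.dvd_finsetProd_iff _).1 h
    split_ifs at hq with h1
    · have : p = q := Subtype.ext ((Nat.prime_dvd_prime_iff_eq (hP p p.2) (hP q q.2)).1 hq)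
      rw [this]; exact h1
    · exact absurd (Nat.dvd_one.1 hq) (hP p p.2).ne_one
  · intro h
    have := dvd_prod_of_mem (fun p : P => if r p = some i then (p : ℕ) else 1) (mem_univ p)
    rwa [if_pos h] at this

lemma labelCoord_injective (hP : ∀ p ∈ P, p.Prime) :
    Function.Injective (labelCoord : (P → Option (Fin k)) → Fin k → ℕ) := by
  intro r r' h
  funext p
  have h1 : ∀ i, r p = some i ↔ r' p = some i := fun i => by
    rw [← dvd_labelCoord_iff hP, ← dvd_labelCoord_iff hP, h]
  exact Option.ext h1

lemma labelCoord_coprime {W : ℕ} (hW : ∀ p ∈ P, p.Coprime W) (r : P → Option (Fin k))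
    (i : Fin k) : (labelCoord r i).Coprime W := by
  refine Nat.Coprime.prod_left fun p _ => ?_
  split_ifs
  · exact hW p p.2
  · exact Nat.coprime_one_left W

/-- A product of primes of `P`, squarefree at the primes of `P`, is determined by divisibility. -/
lemma eq_prod_of_squarefree (hP : ∀ p ∈ P, p.Prime) {s : ℕ} (hs : s ≠ 0)
    (hf : ∀ p : ℕ, p.Prime → p ∣ s → p ∈ P) (hsq : ∀ p ∈ P, ¬ p ^ 2 ∣ s) :
    s = ∏ p : P, if (p : ℕ) ∣ s then (p : ℕ) else 1 := by
  have hsf : Squarefree s := by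
    rw [Nat.squarefree_iff_prime_squarefree]
    intro p hp hd
    exact hsq p (hf p hp ((Dvd.intro _ rfl).trans hd)) (by rwa [pow_two])
  have e : s.primeFactors = P.filter (· ∣ s) := by
    ext p
    simp only [Nat.mem_primeFactors, mem_filter]
    exact ⟨fun h => ⟨hf p h.1 h.2.1, h.2.1⟩, fun h => ⟨hP p h.1, h.2, hs⟩⟩
  conv_lhs => rw [← Nat.prod_primeFactors_of_squarefree hsf, e, prod_filter]
  rw [← prod_attach, univ_eq_attach]

lemma labelCoord_mem_roughs (hP : ∀ p ∈ P, p.Prime) {W : ℕ} (hW : ∀ p ∈ P, p.Coprime W) {x : ℝ}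
    (r : P → Option (Fin k)) (h : ∀ i, (labelCoord r i : ℝ) ≤ x) :
    labelCoord r ∈ Fintype.piFinset (fun _ : Fin k => roughs W x) := by
  rw [Fintype.mem_piFinset]
  intro i
  rw [mem_roughs]
  exact ⟨⟨labelCoord_pos hP r i, h i⟩, labelCoord_coprime hW r i⟩

lemma prod_inv_labelCoord (r : P → Option (Fin k)) :
    ∏ i, 1 / (labelCoord r i : ℝ) = 1 / (labelSize r : ℝ) := by
  rw [← prod_labelCoord]; push_cast; simp

/-- Sums over labellings are bounded by sums over tuples. -/
lemma sum_labels_le (hP : ∀ p ∈ P, p.Prime) {W : ℕ} (hW : ∀ p ∈ P, p.Coprime W) {x : ℝ}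
    (H : (Fin k → ℕ) → ℝ) (hH : ∀ g, 0 ≤ H g)
    (h0 : ∀ r : P → Option (Fin k), H (labelCoord r) ≠ 0 → ∀ i, (labelCoord r i : ℝ) ≤ x) :
    ∑ r : P → Option (Fin k), 1 / (labelSize r : ℝ) * H (labelCoord r) ≤
      ∑ g ∈ Fintype.piFinset (fun _ : Fin k => roughs W x), (∏ i, 1 / (g i : ℝ)) * H g := by
  classical
  have e : ∑ r : P → Option (Fin k), 1 / (labelSize r : ℝ) * H (labelCoord r) =
      ∑ r : P → Option (Fin k) with H (labelCoord r) ≠ 0,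
        (∏ i, 1 / (labelCoord r i : ℝ)) * H (labelCoord r) := by
    rw [sum_filter_of_ne]
    · simp_rw [prod_inv_labelCoord]
    · intro r _ h1 h2
      exact h1 (by rw [h2, mul_zero])
  rw [e, ← sum_image (f := fun g => (∏ i, 1 / ((g i : ℕ) : ℝ)) * H g)
    (fun r _ r' _ h => labelCoord_injective hP h)]
  refine sum_le_sum_of_subset_of_nonneg ?_ fun g _ _ =>
    mul_nonneg (prod_nonneg fun i _ => by positivity) (hH g)
  intro g hg
  obtain ⟨r, hr, rfl⟩ := mem_image.1 hg
  exact labelCoord_mem_roughs hP hW r (h0 r (mem_filter.1 hr).2)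

/-- Reciprocal sums over labellings of bounded size. -/
lemma sum_inv_labelSize_le (hP : ∀ p ∈ P, p.Prime) {W : ℕ} (hW : ∀ p ∈ P, p.Coprime W) (x : ℝ) :
    ∑ r : P → Option (Fin k) with (labelSize r : ℝ) ≤ x, 1 / (labelSize r : ℝ) ≤
      roughSum W x ^ k := by
  classical
  have h := sum_labels_le (k := k) hP hW (x := x)
    (fun g => if ((∏ i, g i : ℕ) : ℝ) ≤ x then 1 else 0)
    (fun g => by positivity) (fun r hr i => by
      simp only [prod_labelCoord, ne_eq, ite_eq_right_iff, one_ne_zero, imp_false, not_not] at hr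
      exact le_trans (by exact_mod_cast labelCoord_le_labelSize hP r i) hr)
  simp only [prod_labelCoord, mul_ite, mul_one, mul_zero] at h
  rw [← sum_filter] at h
  refine h.trans ?_
  rw [roughSum, ← sum_tuples]
  refine sum_le_sum fun g _ => ?_
  split_ifs
  · exact le_rfl
  · exact prod_nonneg fun i _ => by positivity

lemma card_labels_le (hP : ∀ p ∈ P, p.Prime) {W : ℕ} (hW : ∀ p ∈ P, p.Coprime W) {x : ℝ}
    (hx : 0 ≤ x) :
    (#{r : P → Option (Fin k) | (labelSize r : ℝ) ≤ x} : ℝ) ≤ x * roughSum W x ^ k := by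
  refine le_trans ?_ (mul_le_mul_of_nonneg_left (sum_inv_labelSize_le (k := k) hP hW x) hx)
  rw [card_eq_sum_ones, Nat.cast_sum, mul_sum]
  refine sum_le_sum fun r hr => ?_
  have h1 := (mem_filter.1 hr).2
  have h2 : (0 : ℝ) < labelSize r := by exact_mod_cast labelSize_pos hP r
  rw [mul_one_div, le_div_iff₀ h2]
  simpa using h1

/-- Tuples which do not come from labellings contribute little. -/
lemma sum_tuples_le_sum_labels (hP : ∀ p ∈ P, p.Prime) {W : ℕ} (hW : ∀ p ∈ P, p.Coprime W) {x : ℝ}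
    (hf : ∀ p : ℕ, p.Prime → p.Coprime W → (p : ℝ) ≤ x → p ∈ P)
    (H : (Fin k → ℕ) → ℝ) (hH : ∀ g, 0 ≤ H g) {M : ℝ}
    (hM : ∀ g ∈ Fintype.piFinset (fun _ : Fin k => roughs W x), H g ≤ M) :
    ∑ g ∈ Fintype.piFinset (fun _ : Fin k => roughs W x), (∏ i, 1 / (g i : ℝ)) * H g ≤
      ∑ r : P → Option (Fin k), 1 / (labelSize r : ℝ) * H (labelCoord r) +
        M * ((k + k ^ 2) * (∑ p ∈ P, 1 / (p : ℝ) ^ 2) * roughSum W x ^ k) := by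
  classical
  set T := Fintype.piFinset (fun _ : Fin k => roughs W x) with hT
  have hpos : ∀ g : Fin k → ℕ, (0 : ℝ) ≤ ∏ i, 1 / (g i : ℝ) := fun g =>
    prod_nonneg fun i _ => by positivity
  rcases T.eq_empty_or_nonempty with hTe | ⟨g0, hg0⟩
  · rw [hTe, sum_empty]
    have : roughSum W x ^ k = 0 := by rw [roughSum, ← sum_tuples, ← hT, hTe, sum_empty]
    rw [this, mul_zero, mul_zero, add_zero]
    exact sum_nonneg fun r _ => mul_nonneg (by positivity) (hH _)
  have hM0 : 0 ≤ M := (hH g0).trans (hM g0 hg0)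
  set bad1 : P → Fin k → Finset (Fin k → ℕ) := fun p i => T.filter (fun g => (p : ℕ) ^ 2 ∣ g i)
  set bad2 : P → Fin k × Fin k → Finset (Fin k → ℕ) := fun p ij =>
    T.filter (fun g => ij.1 ≠ ij.2 ∧ (p : ℕ) ∣ g ij.1 ∧ (p : ℕ) ∣ g ij.2)
  set good := (univ : Finset (P → Option (Fin k))).image labelCoord
  have hcover : T ⊆ good ∪ (univ.biUnion fun p => univ.biUnion (bad1 p)) ∪
      (univ.biUnion fun p => univ.biUnion (bad2 p)) := by
    intro g hg
    by_contra hcon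
    simp only [mem_union, mem_biUnion, mem_univ, true_and, not_or, not_exists] at hcon
    obtain ⟨⟨hn, h1⟩, h2⟩ := hcon
    have h1' : ∀ (p : P) (i : Fin k), ¬ (p : ℕ) ^ 2 ∣ g i := fun p i h =>
      h1 p i (mem_filter.2 ⟨hg, h⟩)
    have h2' : ∀ (p : P) (i j : Fin k), (p : ℕ) ∣ g i → (p : ℕ) ∣ g j → i = j :=
      fun p i j hi hj => by
        by_contra hij
        exact h2 p (i, j) (mem_filter.2 ⟨hg, hij, hi, hj⟩)
    have hgr : ∀ i, (1 ≤ g i ∧ (g i : ℝ) ≤ x) ∧ (g i).Coprime W := fun i =>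
      mem_roughs.1 (Fintype.mem_piFinset.1 hg i)
    apply hn
    refine mem_image.2 ⟨fun p => if h : ∃ i, (p : ℕ) ∣ g i then some h.choose else none,
      mem_univ _, ?_⟩
    funext i
    rw [labelCoord, eq_prod_of_squarefree hP (s := g i) (by have := (hgr i).1.1; omega)
      (fun p hp hd => hf p hp ((hgr i).2.coprime_dvd_left hd)
        (le_trans (by exact_mod_cast Nat.le_of_dvd (hgr i).1.1 hd) (hgr i).1.2))
      (fun p hp => h1' ⟨p, hp⟩ i)]
    refine prod_congr rfl fun p _ => ?_
    have : ((if h : ∃ i, (p : ℕ) ∣ g i then some h.choose else none) = some i) ↔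
        (p : ℕ) ∣ g i := by
      constructor
      · intro h
        split_ifs at h with h'
        rw [← Option.some.inj h]; exact h'.choose_spec
      · intro h
        have h' : ∃ i, (p : ℕ) ∣ g i := ⟨i, h⟩
        rw [dif_pos h', h2' p _ i h'.choose_spec h]
    simp only [this]
  have hA := roughSum_nonneg W x
  have hb1 : ∀ (p : P) (i : Fin k), ∑ g ∈ bad1 p i, (∏ i, 1 / (g i : ℝ)) ≤
      1 / (p : ℝ) ^ 2 * roughSum W x ^ k := by
    intro p i
    have hp := (hP p p.2).pos
    have := sum_tuples_multiples_le x (fun j => if j = i then (p : ℕ) ^ 2 else 1)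
      (fun j => by split_ifs <;> positivity)
      (fun j => by
        split_ifs
        · exact (hW p p.2).pow_left 2
        · exact Nat.coprime_one_left W) (W := W)
    have e : ∏ j : Fin k, 1 / ((if j = i then (p : ℕ) ^ 2 else 1 : ℕ) : ℝ) = 1 / (p : ℝ) ^ 2 := by
      rw [prod_eq_single i] <;> simp +contextual
    rw [e] at this
    refine le_trans (le_of_eq ?_) this
    congr 1
    ext g
    simp only [bad1, mem_filter, hT]
    refine and_congr_right fun _ => ?_
    exact ⟨fun h j => by split_ifs with hj <;> simp [hj, h], fun h => by simpa using h i⟩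
  have hb2 : ∀ (p : P) (ij : Fin k × Fin k), ∑ g ∈ bad2 p ij, (∏ i, 1 / (g i : ℝ)) ≤
      1 / (p : ℝ) ^ 2 * roughSum W x ^ k := by
    rintro p ⟨i, j⟩
    have hp := (hP p p.2).pos
    rcases eq_or_ne i j with rfl | hij
    · simp only [bad2, ne_eq, not_true_eq_false, false_and, filter_false, sum_empty]
      positivity
    have := sum_tuples_multiples_le x (fun l => if l = i ∨ l = j then (p : ℕ) else 1)
      (fun j => by split_ifs <;> positivity)
      (fun j => by
        split_ifs
        · exact hW p p.2
        · exact Nat.coprime_one_left W) (W := W)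
    have e : ∏ l : Fin k, 1 / ((if l = i ∨ l = j then (p : ℕ) else 1 : ℕ) : ℝ) =
        1 / (p : ℝ) ^ 2 := by
      have : ∀ l : Fin k, 1 / ((if l = i ∨ l = j then (p : ℕ) else 1 : ℕ) : ℝ) =
          (if l = i then 1 / (p : ℝ) else 1) * (if l = j then 1 / (p : ℝ) else 1) := by
        intro l
        by_cases h1 : l = i
        · have h2 : ¬ l = j := fun h => hij (h1.symm.trans h)
          simp [h1, hij]
        · by_cases h2 : l = j <;> simp [h1, h2, hij.symm]
      simp_rw [this, prod_mul_distrib]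
      simp only [prod_ite_eq', mem_univ, if_true]
      ring
    rw [e] at this
    refine le_trans (le_of_eq ?_) this
    congr 1
    ext g
    simp only [bad2, mem_filter, hT]
    refine and_congr_right fun _ => ?_
    refine ⟨fun h l => ?_, fun h => ⟨hij, by simpa using h i, by simpa using h j⟩⟩
    split_ifs with hl
    · rcases hl with rfl | rfl <;> [exact h.2.1; exact h.2.2]
    · exact one_dvd _
  set φ : (Fin k → ℕ) → ℝ := fun g => ∏ i, 1 / (g i : ℝ) with hφ
  have hbi : ∀ {β : Type} [Fintype β] (b : P → β → Finset (Fin k → ℕ)),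
      (∀ p i, ∑ g ∈ b p i, φ g ≤ 1 / (p : ℝ) ^ 2 * roughSum W x ^ k) →
      ∑ g ∈ univ.biUnion (fun p => univ.biUnion (b p)), φ g ≤
        Fintype.card β * (∑ p ∈ P, 1 / (p : ℝ) ^ 2) * roughSum W x ^ k := by
    intro β _ b hb
    calc _ ≤ ∑ p : P, ∑ i : β, ∑ g ∈ b p i, φ g :=
          (sum_biUnion_le_sum _ _ _ hpos).trans (sum_le_sum fun p _ => sum_biUnion_le_sum _ _ _ hpos)
      _ ≤ ∑ p : P, ∑ i : β, 1 / (p : ℝ) ^ 2 * roughSum W x ^ k :=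
          sum_le_sum fun p _ => sum_le_sum fun i _ => hb p i
      _ = _ := by
          rw [← sum_attach P, univ_eq_attach]
          simp only [sum_const, card_univ, nsmul_eq_mul, mul_sum, sum_mul]
          exact sum_congr rfl fun _ _ => by ring
  have hs1 := hbi bad1 hb1
  have hs2 := hbi bad2 hb2
  simp only [Fintype.card_fin, Fintype.card_prod, Nat.cast_mul] at hs1 hs2
  set B1 := (univ : Finset P).biUnion fun p => univ.biUnion (bad1 p)
  set B2 := (univ : Finset P).biUnion fun p => univ.biUnion (bad2 p)
  have hBM : ∀ B : Finset (Fin k → ℕ), B ⊆ T → ∑ g ∈ B, φ g * H g ≤ M * ∑ g ∈ B, φ g := by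
    intro B hB
    rw [mul_sum]
    refine sum_le_sum fun g hg => ?_
    rw [mul_comm]
    exact mul_le_mul_of_nonneg_right (hM g (hB hg)) (hpos g)
  have hB1T : B1 ⊆ T := biUnion_subset.2 fun p _ => biUnion_subset.2 fun i _ => filter_subset _ _
  have hB2T : B2 ⊆ T := biUnion_subset.2 fun p _ => biUnion_subset.2 fun i _ => filter_subset _ _
  have hφH : ∀ g, 0 ≤ φ g * H g := fun g => mul_nonneg (hpos g) (hH g)
  have hgood : ∑ g ∈ good, φ g * H g =
      ∑ r : P → Option (Fin k), 1 / (labelSize r : ℝ) * H (labelCoord r) := by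
    rw [sum_image (fun r _ r' _ h => labelCoord_injective hP h)]
    simp_rw [hφ, prod_inv_labelCoord]
  have hun : ∀ A B : Finset (Fin k → ℕ), ∑ g ∈ A ∪ B, φ g * H g ≤
      ∑ g ∈ A, φ g * H g + ∑ g ∈ B, φ g * H g := by
    intro A B
    have := sum_union_inter (s₁ := A) (s₂ := B) (f := fun g => φ g * H g)
    have h2 : 0 ≤ ∑ g ∈ A ∩ B, φ g * H g := sum_nonneg fun g _ => hφH g
    linarith
  calc ∑ g ∈ T, φ g * H g ≤ ∑ g ∈ good ∪ B1 ∪ B2, φ g * H g :=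
        sum_le_sum_of_subset_of_nonneg hcover fun g _ _ => hφH g
    _ ≤ ∑ g ∈ good, φ g * H g + ∑ g ∈ B1, φ g * H g + ∑ g ∈ B2, φ g * H g :=
        (hun _ _).trans (add_le_add_left (hun _ _) _)
    _ ≤ _ := by
        rw [hgood]
        have h1 := (hBM B1 hB1T).trans (mul_le_mul_of_nonneg_left hs1 hM0)
        have h2 := (hBM B2 hB2T).trans (mul_le_mul_of_nonneg_left hs2 hM0)
        linarith

end Labels

/-! ### Sieve weights -/

section SieveWeights

open Finset

variable {P : Finset ℕ} {k : ℕ}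

/-- The Möbius sign of a labelling. -/
def labelSign (r : P → Option (Fin k)) : ℝ := ∏ p : P, if r p = none then 1 else -1

/-- The diagonalized sieve coefficients. -/
noncomputable def sieveCoeff (R : ℝ) (f : ℝ → ℝ → ℝ) (r : P → Option (Fin k)) : ℝ :=
  labelSign r * tupleEval R f (labelCoord r) 1 0

/-- The sieve weights. -/
noncomputable def sieveWeight (R : ℝ) (f : ℝ → ℝ → ℝ) (a : P → Option (Fin k)) : ℝ :=
  ∑ r : P → Option (Fin k), sieveCoeff R f r * ∏ p : P, centering (p : ℝ) (a p) (r p)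

/-- The sum of the reciprocals of the labelled primes. -/
noncomputable def labelInvSum (r : P → Option (Fin k)) : ℝ :=
  ∑ p : P, if r p = none then 0 else 1 / ((p : ℕ) : ℝ)

/-- `f` is bounded by `M` on the triangle `0 ≤ u`, `0 ≤ q`, `u + q ≤ 1`. -/
def TriangleBound (f : ℝ → ℝ → ℝ) (M : ℝ) : Prop :=
  ∀ u q : ℝ, 0 ≤ u → 0 ≤ q → u + q ≤ 1 → |f u q| ≤ M

lemma TriangleBound.nonneg {f : ℝ → ℝ → ℝ} {M : ℝ} (h : TriangleBound f M) : 0 ≤ M :=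
  (abs_nonneg _).trans (h 0 0 le_rfl le_rfl (by norm_num))

lemma labelSign_sq (r : P → Option (Fin k)) : labelSign r ^ 2 = 1 := by
  rw [labelSign, ← prod_pow]
  exact prod_eq_one fun p _ => by split_ifs <;> norm_num

lemma abs_labelSign (r : P → Option (Fin k)) : |labelSign r| = 1 := by
  rw [← sq_eq_sq₀ (abs_nonneg _) zero_le_one, sq_abs, labelSign_sq, one_pow]

lemma tuple_domain {R : ℝ} (hR : 1 < R) {g : Fin k → ℕ} (hg : ∀ i, 1 ≤ g i)
    (h : 0 ≤ 1 - ∑ i, relLog R (g i)) :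
    0 ≤ ∑ i, relLog R (g i) ^ 2 ∧
      (1 - ∑ i, relLog R (g i)) + ∑ i, relLog R (g i) ^ 2 ≤ 1 := by
  refine ⟨sum_nonneg fun i _ => sq_nonneg _, ?_⟩
  have : ∑ i, relLog R (g i) ^ 2 ≤ ∑ i, relLog R (g i) := by
    refine sum_le_sum fun i _ => ?_
    have h0 := relLog_nonneg hR (hg i)
    have h1 : relLog R (g i) ≤ ∑ i, relLog R (g i) :=
      single_le_sum (f := fun i => relLog R (g i)) (fun j _ => relLog_nonneg hR (hg j)) (mem_univ i)
    nlinarith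
  linarith

lemma abs_tupleEval_le {R : ℝ} (hR : 1 < R) {f : ℝ → ℝ → ℝ} {M : ℝ} (hf : TriangleBound f M)
    {g : Fin k → ℕ} (hg : ∀ i, 1 ≤ g i) : |tupleEval R f g 1 0| ≤ M := by
  rw [tupleEval, trunc, zero_add]
  split_ifs with h
  · obtain ⟨h1, h2⟩ := tuple_domain hR hg h
    exact hf _ _ h h1 h2
  · simpa using hf.nonneg

lemma sum_relLog_labelCoord (hP : ∀ p ∈ P, p.Prime) (R : ℝ) (r : P → Option (Fin k)) :
    ∑ i, relLog R (labelCoord r i) = relLog R (labelSize r) := by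
  simp only [relLog]
  rw [← sum_div, ← prod_labelCoord]
  push_cast
  rw [Real.log_prod]
  intro i _
  exact_mod_cast (labelCoord_pos hP r i).ne'

lemma labelSize_le_iff (hP : ∀ p ∈ P, p.Prime) {R : ℝ} (hR : 1 < R) (r : P → Option (Fin k)) :
    0 ≤ 1 - ∑ i, relLog R (labelCoord r i) ↔ (labelSize r : ℝ) ≤ R := by
  rw [sum_relLog_labelCoord hP, sub_nonneg, relLog_le_iff hR (labelSize_pos hP r), Real.rpow_one]

lemma labelSize_le_of_tupleEval_ne_zero (hP : ∀ p ∈ P, p.Prime) {R : ℝ} (hR : 1 < R)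
    {f : ℝ → ℝ → ℝ} {r : P → Option (Fin k)} (h : tupleEval R f (labelCoord r) 1 0 ≠ 0) :
    (labelSize r : ℝ) ≤ R := by
  rw [← labelSize_le_iff hP hR]
  by_contra hn
  exact h (if_neg hn)

lemma abs_sieveCoeff_le (hP : ∀ p ∈ P, p.Prime) {R : ℝ} (hR : 1 < R) {f : ℝ → ℝ → ℝ} {M : ℝ}
    (hf : TriangleBound f M) (r : P → Option (Fin k)) :
    |sieveCoeff R f r| ≤ if (labelSize r : ℝ) ≤ R then M else 0 := by
  rw [sieveCoeff, abs_mul, abs_labelSign, one_mul]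
  split_ifs with h
  · exact abs_tupleEval_le hR hf fun i => labelCoord_pos hP r i
  · rw [abs_nonpos_iff]
    by_contra h0
    exact h (labelSize_le_of_tupleEval_ne_zero hP hR h0)

/-- `a` is obtained from `r` by removing labels. -/
def IsSublabel (a r : P → Option (Fin k)) : Prop := ∀ p, a p = r p ∨ a p = none

lemma prod_centering_eq_zero {a r : P → Option (Fin k)} (h : ¬ IsSublabel a r) :
    ∏ p : P, centering (p : ℝ) (a p) (r p) = 0 := by
  simp only [IsSublabel, not_forall, not_or] at h
  obtain ⟨p, h1, h2⟩ := h
  exact prod_eq_zero (mem_univ p) (by simp [centering, h1, h2])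

lemma labelSize_le_of_isSublabel (hP : ∀ p ∈ P, p.Prime) {a r : P → Option (Fin k)}
    (h : ∀ p, a p = none ∨ r p ≠ none) : labelSize a ≤ labelSize r := by
  refine prod_le_prod' fun p _ => ?_
  have := (hP p p.2).one_lt.le
  rcases h p with h1 | h1 <;> split_ifs <;> simp_all

lemma labelSize_le_of_sieveWeight_ne_zero (hP : ∀ p ∈ P, p.Prime) {R : ℝ} (hR : 1 < R)
    {f : ℝ → ℝ → ℝ} {a : P → Option (Fin k)} (h : sieveWeight R f a ≠ 0) :
    (labelSize a : ℝ) ≤ R := by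
  obtain ⟨r, -, hr⟩ := exists_ne_zero_of_sum_ne_zero h
  have h1 : IsSublabel a r := by
    by_contra hn
    exact hr (by rw [prod_centering_eq_zero hn, mul_zero])
  have h2 : (labelSize r : ℝ) ≤ R :=
    labelSize_le_of_tupleEval_ne_zero (f := f) hP hR
      fun h0 => hr (by rw [sieveCoeff, h0, mul_zero, zero_mul])
  refine le_trans ?_ h2
  exact_mod_cast labelSize_le_of_isSublabel hP fun p => by
    rcases h1 p with h | h
    · by_cases h3 : a p = none
      · exact Or.inl h3
      · exact Or.inr (h ▸ h3)
    · exact Or.inl h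

lemma abs_sieveWeight_le (hP : ∀ p ∈ P, p.Prime) {W : ℕ} (hW : ∀ p ∈ P, p.Coprime W)
    {R : ℝ} (hR : 1 < R) {f : ℝ → ℝ → ℝ} {M : ℝ} (hf : TriangleBound f M)
    (a : P → Option (Fin k)) : |sieveWeight R f a| ≤ M * roughSum W R ^ k := by
  classical
  set b : (P → Option (Fin k)) → (P → Option (Fin k)) := fun r p =>
    if a p = none then r p else none with hb
  have hM := hf.nonneg
  set S : Finset (P → Option (Fin k)) := {r | IsSublabel a r ∧ (labelSize r : ℝ) ≤ R}
  have h1 : |sieveWeight R f a| ≤ ∑ r ∈ S, M * (1 / (labelSize (b r) : ℝ)) := by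
    rw [sum_filter]
    refine (abs_sum_le_sum_abs _ _).trans (sum_le_sum fun r _ => ?_)
    rw [abs_mul]
    by_cases hs : IsSublabel a r
    · have e : |∏ p : P, centering (p : ℝ) (a p) (r p)| = 1 / (labelSize (b r) : ℝ) := by
        rw [abs_prod, labelSize, Nat.cast_prod, one_div, ← prod_inv_distrib]
        refine prod_congr rfl fun p _ => ?_
        by_cases ha : a p = none
        · by_cases hr : r p = none
          · simp [centering, hb, ha, hr]
          · simp [centering, hb, ha, hr, Ne.symm hr]
        · have : a p = r p := (hs p).resolve_right ha
          simp [centering, hb, ha, ← this]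
      have h2 := abs_sieveCoeff_le hP hR hf r
      rw [e]
      by_cases h3 : (labelSize r : ℝ) ≤ R
      · rw [if_pos ⟨hs, h3⟩]
        rw [if_pos h3] at h2
        exact mul_le_mul_of_nonneg_right h2 (by positivity)
      · rw [if_neg (fun h => h3 h.2)]
        rw [if_neg h3] at h2
        rw [le_antisymm h2 (abs_nonneg _), zero_mul]
    · rw [prod_centering_eq_zero hs, abs_zero, mul_zero]
      split_ifs <;> positivity
  refine h1.trans ?_
  rw [← mul_sum]
  refine mul_le_mul_of_nonneg_left ?_ hM
  have hinj : Set.InjOn b S := by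
    intro r hr r' hr' h
    funext p
    have hr := (mem_filter.1 hr).2.1 p
    have hr' := (mem_filter.1 hr').2.1 p
    have := congrFun h p
    simp only [hb] at this
    by_cases ha : a p = none
    · simpa [ha] using this
    · rw [← hr.resolve_right ha, ← hr'.resolve_right ha]
  rw [← sum_image (f := fun r => 1 / (labelSize r : ℝ)) hinj]
  refine le_trans (sum_le_sum_of_subset_of_nonneg ?_ fun _ _ _ => by positivity)
    (sum_inv_labelSize_le (k := k) hP hW R)
  intro r hr
  obtain ⟨r', hr', rfl⟩ := mem_image.1 hr
  refine mem_filter.2 ⟨mem_univ _, le_trans ?_ (mem_filter.1 hr').2.2⟩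
  exact_mod_cast labelSize_le_of_isSublabel hP fun p => by
    by_cases ha : r' p = none
    · left; simp [hb, ha]
    · exact Or.inr ha

lemma sieveCoeff_sq (R : ℝ) (f : ℝ → ℝ → ℝ) (r : P → Option (Fin k)) :
    sieveCoeff R f r ^ 2 = tupleEval R (fun u q => f u q ^ 2) (labelCoord r) 1 0 := by
  rw [sieveCoeff, mul_pow, labelSign_sq, one_mul, tupleEval, tupleEval, trunc, trunc]
  split_ifs <;> simp

lemma trunc_sq_nonneg (f : ℝ → ℝ → ℝ) (u q : ℝ) : 0 ≤ trunc (fun u q => f u q ^ 2) u q := by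
  rw [trunc]; split_ifs <;> positivity

lemma prod_upperDiag (r : P → Option (Fin k)) :
    ∏ p : P, upperDiag (p : ℝ) (r p) = 1 / (labelSize r : ℝ) := by
  rw [labelSize, Nat.cast_prod, one_div, ← prod_inv_distrib]
  refine prod_congr rfl fun p _ => ?_
  rw [upperDiag]; split_ifs <;> simp

/-- The upper bound for the diagonalized sieve form. -/
theorem sum_upperDiag_sieveCoeff_le (hP : ∀ p ∈ P, p.Prime) {W : ℕ} (hW : ∀ p ∈ P, p.Coprime W)
    {R : ℝ} (hR : 1 < R) (f : ℝ → ℝ → ℝ) :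
    ∑ r : P → Option (Fin k), (∏ p : P, upperDiag (p : ℝ) (r p)) * sieveCoeff R f r ^ 2 ≤
      ((roughStep W R)^[k] (fun u q => f u q ^ 2)) 1 0 := by
  have h := tuple_sum_eq W hR (fun u q => f u q ^ 2) k 1 0 le_rfl
  rw [trunc, if_pos zero_le_one] at h
  rw [← h]
  simp_rw [prod_upperDiag, sieveCoeff_sq]
  refine sum_labels_le hP hW (fun g => tupleEval R (fun u q => f u q ^ 2) g 1 0)
    (fun g => trunc_sq_nonneg f _ _) fun r hr i => ?_
  exact le_trans (by exact_mod_cast labelCoord_le_labelSize hP r i)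
    (labelSize_le_of_tupleEval_ne_zero hP hR hr)

end SieveWeights

/-! ### Restricted sieve weights -/

section Restriction

open Finset

variable {P : Finset ℕ} {k : ℕ}

/-- The labelling with label `m` omitted, seen among all labels. -/
def embedLabel (m : Fin (k + 1)) (a : P → Option (Fin k)) : P → Option (Fin (k + 1)) :=
  fun p => (a p).map m.succAbove

/-- The matrix of the restriction to labels different from `m`. -/
noncomputable def restrictKernel (m : Fin (k + 1)) (p : ℝ) (r' : Option (Fin k))
    (r : Option (Fin (k + 1))) : ℝ :=
  if r = r'.map m.succAbove then 1 else if r' = none ∧ r = some m then -(1 / p) else 0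

lemma centering_restrict (m : Fin (k + 1)) (p : ℝ) (a : Option (Fin k))
    (r : Option (Fin (k + 1))) :
    centering p (a.map m.succAbove) r = ∑ r', restrictKernel m p r' r * centering p a r' := by
  rw [Fintype.sum_option]
  rcases r with _ | i
  · rcases a with _ | j <;> simp [centering, restrictKernel]
  · rcases eq_or_ne i m with rfl | hi
    · have : ∀ j, ¬ i = i.succAbove j := fun j => (Fin.succAbove_ne i j).symm
      rcases a with _ | j <;> simp [centering, restrictKernel, this, Ne.symm (this _)]
    · obtain ⟨l, rfl⟩ := Fin.exists_succAbove_eq hi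
      rcases a with _ | j
      · simp [centering, restrictKernel, Fin.succAbove_ne]
      · simp [centering, restrictKernel, eq_comm]

/-- The diagonalized coefficients of the restricted weights. -/
noncomputable def restrictCoeff (m : Fin (k + 1)) (R : ℝ) (f : ℝ → ℝ → ℝ)
    (r' : P → Option (Fin k)) : ℝ :=
  ∑ r : P → Option (Fin (k + 1)), sieveCoeff R f r *
    ∏ p : P, restrictKernel m (p : ℝ) (r' p) (r p)

lemma sieveWeight_embedLabel (m : Fin (k + 1)) (R : ℝ) (f : ℝ → ℝ → ℝ)
    (a : P → Option (Fin k)) :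
    sieveWeight R f (embedLabel m a) =
      ∑ r', restrictCoeff m R f r' * ∏ p : P, centering (p : ℝ) (a p) (r' p) := by
  simp only [sieveWeight, embedLabel, centering_restrict, restrictCoeff]
  exact (tensor_change_basis (fun p : P => restrictKernel m ((p : ℕ) : ℝ))
    (fun p r => centering ((p : ℕ) : ℝ) (a p) r) (sieveCoeff R f)).symm

/-- `r` extends `r'` by primes labelled `m`. -/
def Extends (m : Fin (k + 1)) (r' : P → Option (Fin k)) (r : P → Option (Fin (k + 1))) : Prop :=
  ∀ p, r p = (r' p).map m.succAbove ∨ (r' p = none ∧ r p = some m)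

lemma map_succAbove_ne (m : Fin (k + 1)) (a : Option (Fin k)) :
    a.map m.succAbove ≠ some m := by
  rcases a with _ | j <;> simp [Fin.succAbove_ne]

lemma Extends.labelCoord_succAbove {m : Fin (k + 1)} {r' : P → Option (Fin k)}
    {r : P → Option (Fin (k + 1))} (h : Extends m r' r) (j : Fin k) :
    labelCoord r (m.succAbove j) = labelCoord r' j := by
  refine prod_congr rfl fun p _ => ?_
  have : r p = some (m.succAbove j) ↔ r' p = some j := by
    rcases h p with h | ⟨h1, h2⟩
    · rw [h]
      rcases r' p with _ | l <;> simp
    · simp [h1, h2, (Fin.succAbove_ne m j).symm]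
  simp only [this]

lemma Extends.labelSign_mul {m : Fin (k + 1)} {r' : P → Option (Fin k)}
    {r : P → Option (Fin (k + 1))} (h : Extends m r' r) :
    labelSign r * ∏ p : P, restrictKernel m (p : ℝ) (r' p) (r p) =
      labelSign r' * (1 / (labelCoord r m : ℝ)) := by
  rw [labelSign, labelSign, labelCoord, Nat.cast_prod, one_div, ← prod_inv_distrib,
    ← prod_mul_distrib, ← prod_mul_distrib]
  refine prod_congr rfl fun p _ => ?_
  rcases h p with h | ⟨h1, h2⟩
  · have := map_succAbove_ne m (r' p)
    rw [h, restrictKernel, if_pos rfl, if_neg this]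
    simp
  · simp [h1, h2, restrictKernel]

lemma tupleEval_of_extends {m : Fin (k + 1)} {r' : P → Option (Fin k)}
    {r : P → Option (Fin (k + 1))} (h : Extends m r' r) (R : ℝ) (f : ℝ → ℝ → ℝ) :
    tupleEval R f (labelCoord r) 1 0 =
      trunc f (1 - ∑ j, relLog R (labelCoord r' j) - relLog R (labelCoord r m))
        (∑ j, relLog R (labelCoord r' j) ^ 2 + relLog R (labelCoord r m) ^ 2) := by
  rw [tupleEval, Fin.sum_univ_succAbove _ m, Fin.sum_univ_succAbove _ m]
  simp only [h.labelCoord_succAbove]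
  congr 1 <;> ring

lemma trunc_roughStep (W : ℕ) {R : ℝ} (hR : 1 < R) (f : ℝ → ℝ → ℝ) {u : ℝ} (hu : u ≤ 1) (q : ℝ) :
    ∑ s ∈ roughs W R, 1 / (s : ℝ) * trunc f (u - relLog R s) (q + relLog R s ^ 2) =
      trunc (roughStep W R f) u q := by
  have h := tuple_sum_eq W hR f 1 u q hu
  rw [sum_piFinset_succ] at h
  simpa [tupleEval] using h

/-- The restricted coefficients are approximated by the partial sums of the original ones. -/
theorem abs_restrictCoeff_sub_le (hP : ∀ p ∈ P, p.Prime) {W : ℕ} (hW : ∀ p ∈ P, p.Coprime W)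
    {R : ℝ} (hR : 1 < R) (hfull : ∀ p : ℕ, p.Prime → p.Coprime W → (p : ℝ) ≤ R → p ∈ P)
    {f : ℝ → ℝ → ℝ} {M : ℝ} (hf : TriangleBound f M) (m : Fin (k + 1))
    (r' : P → Option (Fin k)) (hu : 0 ≤ 1 - ∑ j, relLog R (labelCoord r' j)) :
    |labelSign r' * restrictCoeff m R f r' -
      roughStep W R f (1 - ∑ j, relLog R (labelCoord r' j))
        (∑ j, relLog R (labelCoord r' j) ^ 2)| ≤
      M * roughSum W R * (∑ p ∈ P, 1 / (p : ℝ) ^ 2 + labelInvSum r') := by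
  classical
  set u := 1 - ∑ j, relLog R (labelCoord r' j) with hu'
  set q := ∑ j, relLog R (labelCoord r' j) ^ 2 with hq
  obtain ⟨hq0, huq⟩ := tuple_domain hR (fun i => labelCoord_pos hP r' i) hu
  rw [← hu', ← hq] at huq
  have hu1 : u ≤ 1 := by linarith
  set φ : ℕ → ℝ := fun s => 1 / (s : ℝ) * trunc f (u - relLog R s) (q + relLog R s ^ 2) with hφ
  set E : Finset (P → Option (Fin (k + 1))) := {r | Extends m r' r} with hE
  have h1 : labelSign r' * restrictCoeff m R f r' = ∑ r ∈ E, φ (labelCoord r m) := by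
    rw [restrictCoeff, mul_sum, hE, sum_filter]
    refine sum_congr rfl fun r _ => ?_
    split_ifs with h
    · rw [sieveCoeff, tupleEval_of_extends h, hφ]
      have := h.labelSign_mul
      have h2 := labelSign_sq r'
      linear_combination (labelSign r' * trunc f (u - relLog R (labelCoord r m))
        (q + relLog R (labelCoord r m) ^ 2)) * this + (1 / (labelCoord r m : ℝ) *
        trunc f (u - relLog R (labelCoord r m)) (q + relLog R (labelCoord r m) ^ 2)) * h2
    · simp only [Extends, not_forall, not_or, not_and] at h
      obtain ⟨p, h1, h2⟩ := h
      rw [prod_eq_zero (mem_univ p), mul_zero, mul_zero]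
      rw [restrictKernel, if_neg h1, if_neg (by tauto)]
  have hinj : Set.InjOn (fun r : P → Option (Fin (k + 1)) => labelCoord r m) E := by
    intro r hr r₂ hr₂ h
    have hr := (mem_filter.1 hr).2
    have hr₂ := (mem_filter.1 hr₂).2
    funext p
    have h3 : r p = some m ↔ r₂ p = some m := by
      rw [← dvd_labelCoord_iff hP, ← dvd_labelCoord_iff hP]
      simp only at h
      rw [h]
    rcases hr p with h4 | ⟨h4, h5⟩
    · rcases hr₂ p with h6 | ⟨h6, h7⟩
      · rw [h4, h6]
      · rw [h3.2 h7, h7]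
    · rw [h5, h3.1 h5]
  rw [h1, ← sum_image (f := φ) hinj]
  set I := E.image fun r => labelCoord r m with hI
  have hstep : roughStep W R f u q = ∑ s ∈ roughs W R, φ s := by
    rw [hφ, trunc_roughStep W hR f hu1, trunc, if_pos hu]
  have hI2 : ∑ s ∈ I, φ s = ∑ s ∈ I ∩ roughs W R, φ s := by
    symm
    refine sum_subset inter_subset_left fun s hs hs' => ?_
    obtain ⟨r, hr, rfl⟩ := mem_image.1 hs
    have hpos := labelCoord_pos hP r m
    have hn : ¬ (labelCoord r m : ℝ) ≤ R := fun h => hs' (mem_inter.2 ⟨hs, mem_roughs.2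
      ⟨⟨hpos, h⟩, labelCoord_coprime hW r m⟩⟩)
    have : ¬ 0 ≤ u - relLog R (labelCoord r m) := by
      intro h0
      apply hn
      rw [← Real.rpow_one R, ← relLog_le_iff hR hpos]
      linarith
    rw [hφ]
    simp only [trunc, if_neg this, mul_zero]
  have hI3 : ∑ s ∈ roughs W R, φ s = ∑ s ∈ I ∩ roughs W R, φ s + ∑ s ∈ roughs W R \ I, φ s := by
    rw [inter_comm, sum_inter_add_sum_sdiff]
  rw [hstep, hI2, hI3, sub_add_cancel_left, abs_neg]
  have hφM : ∀ s ∈ roughs W R, |φ s| ≤ M * (1 / (s : ℝ)) := by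
    intro s hs
    rw [hφ]
    simp only
    rw [abs_mul, abs_of_nonneg (by positivity : (0 : ℝ) ≤ 1 / s), mul_comm]
    refine mul_le_mul_of_nonneg_right ?_ (by positivity)
    rw [trunc]
    split_ifs with h0
    · have hs1 := (mem_roughs.1 hs).1.1
      obtain ⟨h1, h2, h3⟩ := roughStep_domain (W := W) hR hq0 huq (s := s) (mem_roughs.2
        ⟨⟨hs1, (relLog_le_iff hR hs1 u).1 (by linarith)⟩, (mem_roughs.1 hs).2⟩)
      exact hf _ _ h1 h2 h3
    · simpa using hf.nonneg
  set b1 : P → Finset ℕ := fun p => (roughs W R).filter (fun s => (p : ℕ) ^ 2 ∣ s)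
  set b2 : P → Finset ℕ := fun p =>
    (roughs W R).filter (fun s => r' p ≠ none ∧ (p : ℕ) ∣ s)
  have hcover : roughs W R \ I ⊆ univ.biUnion b1 ∪ univ.biUnion b2 := by
    intro s hs
    obtain ⟨hs, hsI⟩ := mem_sdiff.1 hs
    by_contra hcon
    simp only [mem_union, mem_biUnion, mem_univ, true_and, not_or, not_exists] at hcon
    have h1' : ∀ p : P, ¬ (p : ℕ) ^ 2 ∣ s := fun p h => hcon.1 p (mem_filter.2 ⟨hs, h⟩)
    have h2' : ∀ p : P, (p : ℕ) ∣ s → r' p = none := fun p h => by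
      by_contra h0
      exact hcon.2 p (mem_filter.2 ⟨hs, h0, h⟩)
    have hsr := mem_roughs.1 hs
    apply hsI
    refine mem_image.2 ⟨fun p => if (p : ℕ) ∣ s then some m else (r' p).map m.succAbove,
      mem_filter.2 ⟨mem_univ _, fun p => ?_⟩, ?_⟩
    · by_cases hp : (p : ℕ) ∣ s
      · right; exact ⟨h2' p hp, if_pos hp⟩
      · left; exact if_neg hp
    · simp only [labelCoord]
      conv_rhs => rw [eq_prod_of_squarefree hP (s := s) (by have := hsr.1.1; omega)
        (fun p hp hd => hfull p hp (hsr.2.coprime_dvd_left hd)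
          (le_trans (by exact_mod_cast Nat.le_of_dvd hsr.1.1 hd) hsr.1.2))
        (fun p hp => h1' ⟨p, hp⟩)]
      refine prod_congr rfl fun p _ => ?_
      by_cases hp : (p : ℕ) ∣ s
      · simp [hp]
      · simp [hp, Fin.succAbove_ne]
  have hM := hf.nonneg
  have hA := roughSum_nonneg W R
  have hb1 : ∑ s ∈ univ.biUnion b1, 1 / (s : ℝ) ≤ (∑ p ∈ P, 1 / (p : ℝ) ^ 2) * roughSum W R := by
    refine (sum_biUnion_le_sum _ _ _ fun s => by positivity).trans ?_
    rw [← sum_attach P, univ_eq_attach, sum_mul]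
    refine sum_le_sum fun p _ => ?_
    have := sum_roughs_multiples_le (p := (p : ℕ) ^ 2) (pow_pos (hP p p.2).pos 2)
      ((hW p p.2).pow_left 2) R
    push_cast at this
    exact this
  have hb2 : ∑ s ∈ univ.biUnion b2, 1 / (s : ℝ) ≤ labelInvSum r' * roughSum W R := by
    refine (sum_biUnion_le_sum _ _ _ fun s => by positivity).trans ?_
    rw [labelInvSum, sum_mul]
    refine sum_le_sum fun p _ => ?_
    by_cases h : r' p = none
    · simp [b2, h]
    · simp only [b2, ne_eq, h, not_false_eq_true, true_and, if_false]
      exact sum_roughs_multiples_le (hP p p.2).pos (hW p p.2) R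
  calc |∑ s ∈ roughs W R \ I, φ s| ≤ ∑ s ∈ roughs W R \ I, M * (1 / (s : ℝ)) :=
        (abs_sum_le_sum_abs _ _).trans (sum_le_sum fun s hs => hφM s (mem_sdiff.1 hs).1)
    _ ≤ ∑ s ∈ univ.biUnion b1 ∪ univ.biUnion b2, M * (1 / (s : ℝ)) :=
        sum_le_sum_of_subset_of_nonneg hcover fun s _ _ => by positivity
    _ = M * ∑ s ∈ univ.biUnion b1 ∪ univ.biUnion b2, 1 / (s : ℝ) := by rw [mul_sum]
    _ ≤ M * (∑ s ∈ univ.biUnion b1, 1 / (s : ℝ) + ∑ s ∈ univ.biUnion b2, 1 / (s : ℝ)) := by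
        refine mul_le_mul_of_nonneg_left ?_ hM
        have := sum_union_inter (s₁ := univ.biUnion b1) (s₂ := univ.biUnion b2)
          (f := fun s : ℕ => 1 / (s : ℝ))
        have h2 : 0 ≤ ∑ s ∈ univ.biUnion b1 ∩ univ.biUnion b2, 1 / (s : ℝ) :=
          sum_nonneg fun s _ => by positivity
        linarith
    _ ≤ M * ((∑ p ∈ P, 1 / (p : ℝ) ^ 2) * roughSum W R + labelInvSum r' * roughSum W R) :=
        mul_le_mul_of_nonneg_left (add_le_add hb1 hb2) hM
    _ = _ := by ring

lemma restrictCoeff_eq_zero (hP : ∀ p ∈ P, p.Prime) {R : ℝ} (hR : 1 < R) (f : ℝ → ℝ → ℝ)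
    (m : Fin (k + 1)) (r' : P → Option (Fin k))
    (hu : ¬ 0 ≤ 1 - ∑ j, relLog R (labelCoord r' j)) : restrictCoeff m R f r' = 0 := by
  refine sum_eq_zero fun r _ => ?_
  by_cases h : Extends m r' r
  · rw [sieveCoeff, tupleEval_of_extends h, trunc, if_neg, mul_zero, zero_mul]
    have := relLog_nonneg hR (labelCoord_pos hP r m)
    intro h0
    exact hu (by linarith)
  · simp only [Extends, not_forall, not_or, not_and] at h
    obtain ⟨p, h1, h2⟩ := h
    rw [prod_eq_zero (mem_univ p), mul_zero]
    rw [restrictKernel, if_neg h1, if_neg (by tauto)]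

end Restriction

/-! ### The lower bound for the restricted form -/

section LowerBound

open Finset

variable {P : Finset ℕ} {k : ℕ}

lemma one_sub_sum_le_prod {ι : Type*} (s : Finset ι) (e : ι → ℝ) (h0 : ∀ i ∈ s, 0 ≤ e i)
    (h1 : ∀ i ∈ s, e i ≤ 1) : 1 - ∑ i ∈ s, e i ≤ ∏ i ∈ s, (1 - e i) := by
  classical
  induction s using Finset.induction_on with
  | empty => simp
  | insert a s ha ih =>
    rw [sum_insert ha, prod_insert ha]
    have ih := ih (fun i hi => h0 i (mem_insert_of_mem hi))
      (fun i hi => h1 i (mem_insert_of_mem hi))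
    have ha0 := h0 a (mem_insert_self _ _)
    have ha1 := h1 a (mem_insert_self _ _)
    have hp : ∏ i ∈ s, (1 - e i) ≤ 1 := prod_le_one
      (fun i hi => by linarith [h1 i (mem_insert_of_mem hi)])
      (fun i hi => by linarith [h0 i (mem_insert_of_mem hi)])
    nlinarith

lemma labelInvSum_nonneg (r : P → Option (Fin k)) : 0 ≤ labelInvSum r :=
  sum_nonneg fun p _ => by split_ifs <;> positivity

lemma prod_lowerDiag_nonneg (hP : ∀ p ∈ P, 24 ≤ p) (r : P → Option (Fin k)) :
    0 ≤ ∏ p : P, lowerDiag (p : ℝ) (r p) :=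
  prod_nonneg fun p _ => lowerDiag_nonneg (by exact_mod_cast hP p p.2) _

lemma prod_lowerDiag_eq (r : P → Option (Fin k)) :
    ∏ p : P, lowerDiag (p : ℝ) (r p) = 1 / (labelSize r : ℝ) *
      ∏ p : P, (1 - if r p = none then 2 / ((p : ℕ) : ℝ) ^ 2 else 24 / ((p : ℕ) : ℝ)) := by
  rw [← prod_upperDiag, ← prod_mul_distrib]
  refine prod_congr rfl fun p _ => ?_
  rw [lowerDiag, upperDiag]
  split_ifs <;> simp

lemma prod_lowerDiag_le (hP : ∀ p ∈ P, 24 ≤ p) (r : P → Option (Fin k)) :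
    ∏ p : P, lowerDiag (p : ℝ) (r p) ≤ 1 / (labelSize r : ℝ) := by
  rw [prod_lowerDiag_eq]
  refine mul_le_of_le_one_right (by positivity) (prod_le_one (fun p _ => ?_) fun p _ => ?_)
  · have : (24 : ℝ) ≤ (p : ℕ) := by exact_mod_cast hP p p.2
    rw [sub_nonneg]
    split_ifs <;> apply div_le_one_of_le₀ _ (by positivity) <;> nlinarith
  · rw [sub_le_self_iff]
    split_ifs <;> positivity

lemma le_prod_lowerDiag (hP : ∀ p ∈ P, 24 ≤ p) (r : P → Option (Fin k)) :
    1 / (labelSize r : ℝ) * (1 - 2 * ∑ p ∈ P, 1 / (p : ℝ) ^ 2 - 24 * labelInvSum r) ≤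
      ∏ p : P, lowerDiag (p : ℝ) (r p) := by
  rw [prod_lowerDiag_eq]
  refine mul_le_mul_of_nonneg_left (le_trans ?_ (one_sub_sum_le_prod _ _ ?_ ?_)) (by positivity)
  · rw [labelInvSum, ← sum_attach P, univ_eq_attach, mul_sum, mul_sum, sub_sub, ← sum_add_distrib]
    refine sub_le_sub_left (sum_le_sum fun p _ => ?_) _
    split_ifs
    · simp [div_eq_mul_inv]
    · rw [mul_one_div, mul_one_div]
      have : 0 ≤ 2 / ((p : ℕ) : ℝ) ^ 2 := by positivity
      linarith
  · intro p _; split_ifs <;> positivity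
  · intro p _
    have : (24 : ℝ) ≤ (p : ℕ) := by exact_mod_cast hP p p.2
    split_ifs <;> apply div_le_one_of_le₀ _ (by positivity) <;> nlinarith

lemma sum_labelInvSum_le (hP : ∀ p ∈ P, p.Prime) {W : ℕ} (hW : ∀ p ∈ P, p.Coprime W) (x : ℝ) :
    ∑ r : P → Option (Fin k) with (labelSize r : ℝ) ≤ x,
      1 / (labelSize r : ℝ) * labelInvSum r ≤
      k * (∑ p ∈ P, 1 / (p : ℝ) ^ 2) * roughSum W x ^ k := by
  classical
  set G : (Fin k → ℕ) → ℝ := fun g =>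
    ∑ p : P, ∑ i, if (p : ℕ) ∣ g i then 1 / ((p : ℕ) : ℝ) else 0 with hG
  have hG0 : ∀ g, 0 ≤ G g := fun g =>
    sum_nonneg fun p _ => sum_nonneg fun i _ => by split_ifs <;> positivity
  have hGr : ∀ r : P → Option (Fin k), G (labelCoord r) = labelInvSum r := by
    intro r
    simp only [hG, dvd_labelCoord_iff hP, labelInvSum]
    refine sum_congr rfl fun p _ => ?_
    rcases r p with _ | i <;> simp
  have h := sum_labels_le (k := k) hP hW (x := x)
    (fun g => if ((∏ i, g i : ℕ) : ℝ) ≤ x then G g else 0)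
    (fun g => by split_ifs <;> [exact hG0 g; exact le_rfl]) (fun r hr i => by
      simp only [prod_labelCoord, ne_eq, ite_eq_right_iff, Classical.not_imp] at hr
      exact le_trans (by exact_mod_cast labelCoord_le_labelSize hP r i) hr.1)
  simp only [prod_labelCoord, hGr, mul_ite, mul_zero, ← sum_filter] at h
  refine h.trans ?_
  calc _ ≤ ∑ g ∈ Fintype.piFinset (fun _ : Fin k => roughs W x), (∏ i, 1 / (g i : ℝ)) * G g := by
        rw [sum_filter]
        refine sum_le_sum fun g _ => ?_
        split_ifs
        · exact le_rfl
        · exact mul_nonneg (prod_nonneg fun i _ => by positivity) (hG0 g)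
    _ = ∑ p : P, ∑ i, 1 / ((p : ℕ) : ℝ) *
        ∑ g ∈ Fintype.piFinset (fun _ : Fin k => roughs W x) with (p : ℕ) ∣ g i,
          ∏ i, 1 / (g i : ℝ) := by
        simp only [hG, mul_sum, sum_filter]
        rw [sum_comm]
        refine sum_congr rfl fun p _ => ?_
        rw [sum_comm]
        refine sum_congr rfl fun i _ => sum_congr rfl fun g _ => ?_
        split_ifs
        · ring
        · simp
    _ ≤ ∑ p : P, ∑ i : Fin k, 1 / ((p : ℕ) : ℝ) * (1 / ((p : ℕ) : ℝ) * roughSum W x ^ k) := by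
        refine sum_le_sum fun p _ => sum_le_sum fun i _ =>
          mul_le_mul_of_nonneg_left ?_ (by positivity)
        have := sum_tuples_multiples_le (W := W) x (fun j => if j = i then (p : ℕ) else 1)
          (fun j => by split_ifs <;> [exact (hP p p.2).pos; exact one_pos])
          (fun j => by split_ifs <;> [exact hW p p.2; exact Nat.coprime_one_left W])
        have e1 : ∀ g : Fin k → ℕ, (∀ j, (if j = i then (p : ℕ) else 1) ∣ g j) ↔ (p : ℕ) ∣ g i :=
          fun g => ⟨fun h => by simpa using h i, fun h j => by
            split_ifs with hj <;> [(rw [hj]; exact h); exact one_dvd _]⟩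
        have e2 : ∏ j : Fin k, 1 / ((if j = i then (p : ℕ) else 1 : ℕ) : ℝ) =
            1 / ((p : ℕ) : ℝ) := by
          rw [prod_eq_single i] <;> simp +contextual
        rw [e2] at this
        simpa only [e1] using this
    _ = _ := by
        rw [← sum_attach P, mul_sum, sum_mul, univ_eq_attach]
        refine sum_congr rfl fun p _ => ?_
        simp
        ring

/-- The lower bound for the diagonalized form of the restricted weights. -/
theorem le_sum_lowerDiag_restrictCoeff (hP : ∀ p ∈ P, p.Prime) (hP24 : ∀ p ∈ P, 24 ≤ p) {W : ℕ}
    (hW : ∀ p ∈ P, p.Coprime W) {R : ℝ} (hR : 1 < R)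
    (hfull : ∀ p : ℕ, p.Prime → p.Coprime W → (p : ℝ) ≤ R → p ∈ P)
    {f h : ℝ → ℝ → ℝ} {M M₁ C₁ L : ℝ} (hL : 0 ≤ L) (hf : TriangleBound f M)
    (hh : TriangleBound h M₁)
    (hfh : ∀ u q : ℝ, 0 ≤ u → 0 ≤ q → u + q ≤ 1 → |roughStep W R f u q - L * h u q| ≤ C₁)
    (m : Fin (k + 1)) {η : ℝ} (hη : ∑ p ∈ P, 1 / (p : ℝ) ^ 2 = η) :
    L ^ 2 * ((roughStep W R)^[k] (fun u q => h u q ^ 2)) 1 0 -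
      roughSum W R ^ k * (L ^ 2 * (M₁ ^ 2 * ((k + k ^ 2) * η)) +
        (2 * η * (L ^ 2 * M₁ ^ 2) + 2 * (L * M₁) * (C₁ + M * roughSum W R * η)) +
        (24 * (L ^ 2 * M₁ ^ 2) + 2 * (L * M₁) * (M * roughSum W R)) * (k * η)) ≤
    ∑ r' : P → Option (Fin k), (∏ p : P, lowerDiag (p : ℝ) (r' p)) *
      restrictCoeff m R f r' ^ 2 := by
  classical
  set A := roughSum W R with hA
  have hA0 : 0 ≤ A := roughSum_nonneg W R
  have hM := hf.nonneg
  have hM₁ := hh.nonneg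
  have hη0 : 0 ≤ η := hη ▸ sum_nonneg fun p _ => by positivity
  set α := 2 * η * (L ^ 2 * M₁ ^ 2) + 2 * (L * M₁) * (C₁ + M * A * η) with hα
  set β := 24 * (L ^ 2 * M₁ ^ 2) + 2 * (L * M₁) * (M * A) with hβ
  have hC₁ : 0 ≤ C₁ := (abs_nonneg _).trans (hfh 0 0 le_rfl le_rfl (by norm_num))
  have hα0 : 0 ≤ α := by positivity
  have hβ0 : 0 ≤ β := by positivity
  have key : ∀ r' : P → Option (Fin k),
      1 / (labelSize r' : ℝ) * (L ^ 2 * tupleEval R h (labelCoord r') 1 0 ^ 2) -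
        (if (labelSize r' : ℝ) ≤ R then 1 / (labelSize r' : ℝ) * (α + β * labelInvSum r') else 0) ≤
      (∏ p : P, lowerDiag (p : ℝ) (r' p)) * restrictCoeff m R f r' ^ 2 := by
    intro r'
    have hu := labelSize_le_iff hP hR r'
    by_cases hs : (labelSize r' : ℝ) ≤ R
    · have hu := hu.2 hs
      rw [if_pos hs]
      have hZ := abs_restrictCoeff_sub_le hP hW hR hfull hf m r' hu
      obtain ⟨hq0, huq⟩ := tuple_domain hR (fun i => labelCoord_pos hP r' i) hu
      have hY := hfh _ _ hu hq0 huq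
      have hT : tupleEval R h (labelCoord r') 1 0 = h (1 - ∑ j, relLog R (labelCoord r' j))
          (∑ j, relLog R (labelCoord r' j) ^ 2) := by
        rw [tupleEval, trunc, if_pos hu, zero_add]
      have hTM : |tupleEval R h (labelCoord r') 1 0| ≤ M₁ := by
        rw [hT]; exact hh _ _ hu hq0 huq
      rw [← hT] at hY
      rw [hη] at hZ
      set T := tupleEval R h (labelCoord r') 1 0
      set X := roughStep W R f (1 - ∑ j, relLog R (labelCoord r' j))
          (∑ j, relLog R (labelCoord r' j) ^ 2)
      have hZsq : restrictCoeff m R f r' ^ 2 = (labelSign r' * restrictCoeff m R f r') ^ 2 := by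
        rw [mul_pow, labelSign_sq, one_mul]
      rw [hZsq]
      set Z := labelSign r' * restrictCoeff m R f r'
      have hσ := labelInvSum_nonneg r'
      have hD0 := prod_lowerDiag_nonneg hP24 r'
      have hD1 := prod_lowerDiag_le hP24 r'
      have hD2 := le_prod_lowerDiag hP24 r'
      rw [hη] at hD2
      set D := ∏ p : P, lowerDiag (p : ℝ) (r' p)
      set σ := labelInvSum r'
      set v := 1 / (labelSize r' : ℝ) with hv
      have hv0 : 0 ≤ v := by positivity
      set e := M * A * (η + σ) + C₁ with he
      have he0 : 0 ≤ e := by positivity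
      have hZY : |Z - L * T| ≤ e := by
        have := abs_sub_le Z X (L * T)
        linarith
      have hYM : |L * T| ≤ L * M₁ := by
        rw [abs_mul, abs_of_nonneg hL]; exact mul_le_mul_of_nonneg_left hTM hL
      have h1 : (L * T) ^ 2 - 2 * (L * M₁ * e) ≤ Z ^ 2 := by
        have h2 : |(L * T) * (Z - L * T)| ≤ L * M₁ * e := by
          rw [abs_mul]; exact mul_le_mul hYM hZY (abs_nonneg _) (by positivity)
        have h3 := neg_le_of_abs_le h2
        nlinarith [sq_nonneg (Z - L * T)]
      have hY2 : (L * T) ^ 2 ≤ L ^ 2 * M₁ ^ 2 := by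
        rw [← sq_abs, ← mul_pow]; exact pow_le_pow_left₀ (abs_nonneg _) hYM 2
      calc v * (L ^ 2 * T ^ 2) - v * (α + β * σ)
          = v * (L * T) ^ 2 - v * (2 * η + 24 * σ) * (L ^ 2 * M₁ ^ 2) -
            v * (2 * (L * M₁ * e)) := by rw [hα, hβ, he]; ring
        _ ≤ v * (L * T) ^ 2 - v * (2 * η + 24 * σ) * (L * T) ^ 2 - D * (2 * (L * M₁ * e)) := by
            have h4 := mul_le_mul_of_nonneg_left hY2 (by positivity : 0 ≤ v * (2 * η + 24 * σ))
            have h5 := mul_le_mul_of_nonneg_right hD1 (by positivity : 0 ≤ 2 * (L * M₁ * e))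
            linarith
        _ = v * (1 - 2 * η - 24 * σ) * (L * T) ^ 2 - D * (2 * (L * M₁ * e)) := by ring
        _ ≤ D * (L * T) ^ 2 - D * (2 * (L * M₁ * e)) :=
            sub_le_sub_right (mul_le_mul_of_nonneg_right hD2 (sq_nonneg _)) _
        _ = D * ((L * T) ^ 2 - 2 * (L * M₁ * e)) := by ring
        _ ≤ D * Z ^ 2 := mul_le_mul_of_nonneg_left h1 hD0
    · have hu : ¬ 0 ≤ 1 - ∑ j, relLog R (labelCoord r' j) := fun h => hs (hu.1 h)
      rw [if_neg hs, restrictCoeff_eq_zero hP hR f m r' hu, tupleEval, trunc, if_neg hu]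
      simp
  have hsum := sum_le_sum fun r' (_ : r' ∈ (univ : Finset (P → Option (Fin k)))) => key r'
  refine le_trans ?_ hsum
  have hE := tuple_sum_eq W hR (fun u q => h u q ^ 2) k 1 0 le_rfl
  rw [trunc, if_pos zero_le_one] at hE
  have hT2 : ∀ g : Fin k → ℕ, tupleEval R (fun u q => h u q ^ 2) g 1 0 =
      tupleEval R h g 1 0 ^ 2 := by
    intro g
    rw [tupleEval, tupleEval, trunc, trunc]
    split_ifs <;> simp
  simp only [hT2] at hE
  have h1 := sum_tuples_le_sum_labels (k := k) hP hW hfull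
    (fun g => tupleEval R h g 1 0 ^ 2) (fun g => sq_nonneg _) (M := M₁ ^ 2) (fun g hg => by
      rw [← sq_abs]
      refine pow_le_pow_left₀ (abs_nonneg _) (abs_tupleEval_le hR hh fun i => ?_) 2
      exact (mem_roughs.1 (Fintype.mem_piFinset.1 hg i)).1.1)
  rw [hE, hη, ← hA] at h1
  have h2 := sum_inv_labelSize_le (k := k) hP hW R
  have h3 := sum_labelInvSum_le (k := k) hP hW R
  rw [hη, ← hA] at h3
  rw [← hA] at h2
  have e : ∑ r' : P → Option (Fin k), (if (labelSize r' : ℝ) ≤ R then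
      1 / (labelSize r' : ℝ) * (α + β * labelInvSum r') else 0) =
      α * ∑ r' : P → Option (Fin k) with (labelSize r' : ℝ) ≤ R, 1 / (labelSize r' : ℝ) +
      β * ∑ r' : P → Option (Fin k) with (labelSize r' : ℝ) ≤ R,
        1 / (labelSize r' : ℝ) * labelInvSum r' := by
    rw [← sum_filter, mul_sum, mul_sum, ← sum_add_distrib]
    exact sum_congr rfl fun r' _ => by ring
  have e2 : ∑ r' : P → Option (Fin k),
      1 / (labelSize r' : ℝ) * (L ^ 2 * tupleEval R h (labelCoord r') 1 0 ^ 2) =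
      L ^ 2 * ∑ r' : P → Option (Fin k),
        1 / (labelSize r' : ℝ) * tupleEval R h (labelCoord r') 1 0 ^ 2 := by
    rw [mul_sum]; exact sum_congr rfl fun r' _ => by ring
  rw [sum_sub_distrib, e, e2]
  have h4 := mul_le_mul_of_nonneg_left h1 (sq_nonneg L)
  have h5 := mul_le_mul_of_nonneg_left h2 hα0
  have h6 := mul_le_mul_of_nonneg_left h3 hβ0
  nlinarith

end LowerBound

/-! ### The sieve polynomial -/

section SievePolynomial

open Nat

/-- `N !` times the value of a list of terms at `(1, 0)`. -/
def scaledEval (N : ℕ) (l : List (ℤ × ℕ × ℕ)) : ℤ :=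
  (l.map fun m => if m.2.2 = 0 then m.1 * ((N ! / m.2.1 ! : ℕ) : ℤ) else 0).sum

lemma polyEval_one_zero (N : ℕ) (l : List (ℤ × ℕ × ℕ)) (h : ∀ m ∈ l, m.2.1 ≤ N) :
    polyEval l 1 0 * N ! = scaledEval N l := by
  induction l with
  | nil => simp [polyEval, scaledEval]
  | cons m l ih =>
    have e : scaledEval N (m :: l) =
      (if m.2.2 = 0 then m.1 * ((N ! / m.2.1 ! : ℕ) : ℤ) else 0) + scaledEval N l := by
      simp [scaledEval]
    rw [polyEval_cons, add_mul, ih fun m hm => h m (List.mem_cons_of_mem _ hm), e]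
    rw [Int.cast_add]
    congr 1
    rw [dividedMonomial]
    split_ifs with hm
    · rw [hm, Int.cast_mul, Int.cast_natCast,
        Nat.cast_div (factorial_dvd_factorial (h m List.mem_cons_self)) (by positivity)]
      simp
      ring
    · simp [hm]

/-- The terms of the polynomial defining the sieve weights. -/
def sieveTerms : List (ℤ × ℕ × ℕ) := [(70, 1, 1), (98, 2, 0), (5, 0, 1), (-15, 1, 0)]

/-- The terms of the quadratic integral in the denominator of the variational ratio. -/
def denominatorTerms : List (ℤ × ℕ × ℕ) := polyIntegral^[5] (polyMul sieveTerms sieveTerms)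

/-- The terms of the quadratic integral in the numerator of the variational ratio. -/
def numeratorTerms : List (ℤ × ℕ × ℕ) :=
  polyIntegral^[4] (polyMul (polyIntegral sieveTerms) (polyIntegral sieveTerms))

/-- The variational ratio exceeds the threshold. -/
theorem polyEval_denominatorTerms_lt :
    10000 * polyEval denominatorTerms 1 0 < 5 * 4999 * polyEval numeratorTerms 1 0 := by
  have h := polyEval_one_zero 12 numeratorTerms (by decide +kernel)
  have h' := polyEval_one_zero 12 denominatorTerms (by decide +kernel)
  have h2 : 10000 * scaledEval 12 denominatorTerms < 5 * 4999 * scaledEval 12 numeratorTerms := by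
    decide +kernel
  have h3 : (10000 * scaledEval 12 denominatorTerms : ℝ) <
    5 * 4999 * scaledEval 12 numeratorTerms := by exact_mod_cast h2
  rw [← h, ← h', ← mul_assoc, ← mul_assoc] at h3
  exact lt_of_mul_lt_mul_right h3 (by positivity)

end SievePolynomial

/-! ### Residue classes attached to pairs of labellings -/

section Residues

open Finset

variable {P : Finset ℕ} {k : ℕ}

/-- Each prime labelled `i` divides `n + h i`. -/
def Hits (h : Fin k → ℕ) (n : ℕ) (a : P → Option (Fin k)) : Prop :=
  ∀ p : P, ∀ i, a p = some i → (p : ℕ) ∣ n + h i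

/-- No prime receives two different labels. -/
def Compatible (a b : P → Option (Fin k)) : Prop :=
  ∀ p : P, a p = none ∨ b p = none ∨ a p = b p

/-- The set of primes labelled by `a` or by `b`. -/
def pairSupport (a b : P → Option (Fin k)) : Finset P := {p | ¬ (a p = none ∧ b p = none)}

/-- The product of a set of primes. -/
def supportProd (S : Finset P) : ℕ := ∏ p ∈ S, (p : ℕ)

lemma supportProd_pos (hP : ∀ p ∈ P, p.Prime) (S : Finset P) : 0 < supportProd S :=
  prod_pos fun p _ => (hP p p.2).pos

lemma coprime_supportProd {W : ℕ} (hW : ∀ p ∈ P, p.Coprime W) (S : Finset P) :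
    W.Coprime (supportProd S) :=
  Nat.Coprime.prod_right fun p _ => (hW p p.2).symm

lemma coprime_supportProd_of_notMem (hP : ∀ p ∈ P, p.Prime) {S : Finset P} {p : P} (hp : p ∉ S) :
    (p : ℕ).Coprime (supportProd S) :=
  Nat.Coprime.prod_right fun q hq => (Nat.coprime_primes (hP p p.2) (hP q q.2)).2
    fun h => hp (Subtype.ext h ▸ hq)

lemma prod_jointWeight_of_compatible {a b : P → Option (Fin k)} (h : Compatible a b) (t : P → ℝ) :
    ∏ p, jointWeight (t p) (a p) (b p) = ∏ p ∈ pairSupport a b, t p := by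
  rw [pairSupport, prod_filter]
  refine prod_congr rfl fun p _ => ?_
  rw [jointWeight]
  have := h p
  split_ifs <;> tauto

lemma prod_jointWeight_of_not_compatible {a b : P → Option (Fin k)} (h : ¬ Compatible a b)
    (t : P → ℝ) : ∏ p, jointWeight (t p) (a p) (b p) = 0 := by
  simp only [Compatible, not_forall, not_or] at h
  obtain ⟨p, h1, h2, h3⟩ := h
  exact prod_eq_zero (mem_univ p) (by simp [jointWeight, h1, h2, h3])

lemma compatible_of_hits {h : Fin k → ℕ}
    (hd : ∀ p ∈ P, ∀ n i j, p ∣ n + h i → p ∣ n + h j → i = j) {n : ℕ}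
    {a b : P → Option (Fin k)} (ha : Hits h n a) (hb : Hits h n b) : Compatible a b := by
  intro p
  rcases h1 : a p with _ | i
  · simp
  · rcases h2 : b p with _ | j
    · simp
    · right; right
      rw [hd p p.2 n i j (ha p i h1) (hb p j h2)]

lemma exists_modEq_iff {W : ℕ} (hP : ∀ p ∈ P, p.Prime) (hW : ∀ p ∈ P, p.Coprime W) (v : ℕ)
    (e : P → ℕ) (S : Finset P) :
    ∃ c, ∀ n, (n ≡ v [MOD W] ∧ ∀ p ∈ S, n ≡ e p [MOD p]) ↔ n ≡ c [MOD W * supportProd S] := by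
  classical
  induction S using Finset.induction_on with
  | empty => exact ⟨v, fun n => by simp [supportProd]⟩
  | insert p S hp ih =>
    obtain ⟨c, hc⟩ := ih
    have hco : (p : ℕ).Coprime (W * supportProd S) :=
      Nat.Coprime.mul_right (hW p p.2) (coprime_supportProd_of_notMem hP hp)
    obtain ⟨d, hd1, hd2⟩ := Nat.chineseRemainder hco (e p) c
    refine ⟨d, fun n => ?_⟩
    have e1 : W * supportProd (insert p S) = p * (W * supportProd S) := by
      rw [supportProd, prod_insert hp, supportProd]; ring
    rw [e1, ← Nat.modEq_and_modEq_iff_modEq_mul hco]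
    simp only [mem_insert, forall_eq_or_imp]
    rw [and_left_comm, hc]
    constructor
    · rintro ⟨h1, h2⟩; exact ⟨h1.trans hd1.symm, h2.trans hd2.symm⟩
    · rintro ⟨h1, h2⟩; exact ⟨h1.trans hd1, h2.trans hd2⟩

lemma dvd_add_iff_modEq {p : ℕ} (hp : 0 < p) (n h : ℕ) :
    p ∣ n + h ↔ n ≡ (p - 1) * h [MOD p] := by
  have e : (p - 1) * h + h = p * h := by
    obtain ⟨q, rfl⟩ := Nat.exists_eq_succ_of_ne_zero hp.ne'
    simp; ring
  have h2 : p * h ≡ 0 [MOD p] := (Nat.modEq_zero_iff_dvd.2 (dvd_mul_right p h))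
  rw [← Nat.modEq_zero_iff_dvd]
  constructor
  · intro h1
    exact Nat.ModEq.add_right_cancel' h (by rw [e]; exact h1.trans h2.symm)
  · intro h1
    have := h1.add_right h
    rw [e] at this
    exact this.trans h2

lemma exists_residue {W : ℕ} (hP : ∀ p ∈ P, p.Prime) (hW : ∀ p ∈ P, p.Coprime W) (v : ℕ)
    (h : Fin k → ℕ) {a b : P → Option (Fin k)} (hab : Compatible a b) :
    ∃ c, ∀ n, (n ≡ v [MOD W] ∧ Hits h n a ∧ Hits h n b) ↔
      n ≡ c [MOD W * supportProd (pairSupport a b)] := by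
  set l : P → ℕ := fun p => ((a p).orElse fun _ => b p).elim 0 h with hl
  obtain ⟨c, hc⟩ := exists_modEq_iff hP hW v (fun p => (p - 1) * l p) (pairSupport a b)
  refine ⟨c, fun n => ?_⟩
  rw [← hc]
  refine and_congr_right fun _ => ?_
  simp only [← dvd_add_iff_modEq (hP _ (Subtype.prop _)).pos, pairSupport, mem_filter, mem_univ,
    true_and, Hits, ← forall_and]
  refine forall_congr' fun p => ?_
  have hp := hab p
  simp only [hl]
  rcases h1 : a p with _ | i <;> rcases h2 : b p with _ | j
  · simp
  · simp
  · simp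
  · have : i = j := by simpa [h1, h2] using hp
    subst this
    simp

open scoped Classical in
lemma sum_mul_sq_eq (h : Fin k → ℕ) (s : Finset ℕ) (g : ℕ → ℝ)
    (c : (P → Option (Fin k)) → ℝ) :
    ∑ n ∈ s, g n * (∑ a, c a * if Hits h n a then 1 else 0) ^ 2 =
      ∑ a, ∑ b, c a * c b * ∑ n ∈ s with Hits h n a ∧ Hits h n b, g n := by
  have e : ∀ n, g n * (∑ a, c a * if Hits h n a then 1 else 0) ^ 2 =
      ∑ a, ∑ b, c a * c b * if Hits h n a ∧ Hits h n b then g n else 0 := by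
    intro n
    rw [sq, sum_mul_sum, mul_sum]
    refine sum_congr rfl fun a _ => ?_
    rw [mul_sum]
    refine sum_congr rfl fun b _ => ?_
    by_cases h1 : Hits h n a <;> by_cases h2 : Hits h n b <;> simp [h1, h2]
    ring
  simp only [e]
  rw [sum_comm]
  refine sum_congr rfl fun a _ => ?_
  rw [sum_comm]
  refine sum_congr rfl fun b _ => ?_
  rw [← mul_sum, sum_filter]

lemma abs_card_modEq_sub_le (N Q c : ℕ) (hQ : 0 < Q) :
    |(#{n ∈ Ioc N (2 * N) | n ≡ c [MOD Q]} : ℝ) - N / Q| ≤ 1 := by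
  have h := Nat.Ioc_filter_modEq_card N (2 * N) hQ c
  have hle : ⌊((N : ℚ) - c) / Q⌋ ≤ ⌊(((2 * N : ℕ) : ℚ) - c) / Q⌋ := by
    apply Int.floor_le_floor
    have : (N : ℚ) ≤ ((2 * N : ℕ) : ℚ) := by push_cast; linarith [(Nat.cast_nonneg N : (0 : ℚ) ≤ N)]
    gcongr
  rw [max_eq_left (by linarith)] at h
  have h1 := Int.floor_le (((N : ℚ) - c) / Q)
  have h2 := Int.lt_floor_add_one (((N : ℚ) - c) / Q)
  have h3 := Int.floor_le ((((2 * N : ℕ) : ℚ) - c) / Q)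
  have h4 := Int.lt_floor_add_one ((((2 * N : ℕ) : ℚ) - c) / Q)
  have e : (((2 * N : ℕ) : ℚ) - c) / Q = ((N : ℚ) - c) / Q + N / Q := by push_cast; ring
  have h5 : (#{n ∈ Ioc N (2 * N) | n ≡ c [MOD Q]} : ℚ) =
      (⌊(((2 * N : ℕ) : ℚ) - c) / Q⌋ : ℚ) - (⌊((N : ℚ) - c) / Q⌋ : ℚ) := by exact_mod_cast h
  have h6 : |(#{n ∈ Ioc N (2 * N) | n ≡ c [MOD Q]} : ℚ) - N / Q| ≤ 1 := by
    rw [abs_le]; constructor <;> linarith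
  have h7 := (Rat.cast_le (K := ℝ)).2 h6
  push_cast at h7
  exact h7

open scoped Classical in
/-- The sieve weights are summed over all integers of a residue class. -/
theorem sum_weights_le {W : ℕ} (hW0 : 0 < W) (hP : ∀ p ∈ P, p.Prime)
    (hW : ∀ p ∈ P, p.Coprime W) (h : Fin k → ℕ)
    (hd : ∀ p ∈ P, ∀ n i j, p ∣ n + h i → p ∣ n + h j → i = j) (v N : ℕ)
    (c : (P → Option (Fin k)) → ℝ) :
    ∑ n ∈ Ioc N (2 * N) with n ≡ v [MOD W], (∑ a, c a * if Hits h n a then 1 else 0) ^ 2 ≤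
      (N : ℝ) / W * ∑ a, ∑ b, c a * c b * ∏ p : P, jointWeight (1 / (p : ℝ)) (a p) (b p) +
        (∑ a, |c a|) ^ 2 := by
  have h1 := sum_mul_sq_eq h {n ∈ Ioc N (2 * N) | n ≡ v [MOD W]} (fun _ => 1) c
  simp only [one_mul, sum_const, nsmul_eq_mul, mul_one] at h1
  rw [h1, sq, sum_mul_sum, mul_sum, ← sum_add_distrib]
  refine sum_le_sum fun a _ => ?_
  rw [mul_sum, ← sum_add_distrib]
  refine sum_le_sum fun b _ => ?_
  have h2 : |(#{n ∈ {n ∈ Ioc N (2 * N) | n ≡ v [MOD W]} | Hits h n a ∧ Hits h n b} : ℝ) -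
      N / W * ∏ p : P, jointWeight (1 / (p : ℝ)) (a p) (b p)| ≤ 1 := by
    rw [filter_filter]
    by_cases hab : Compatible a b
    · obtain ⟨r, hr⟩ := exists_residue hP hW v h hab
      rw [prod_jointWeight_of_compatible hab]
      simp only [hr]
      have := abs_card_modEq_sub_le N (W * supportProd (pairSupport a b)) r
        (Nat.mul_pos hW0 (supportProd_pos hP _))
      have e : (N : ℝ) / W * ∏ p ∈ pairSupport a b, 1 / ((p : ℕ) : ℝ) =
          N / ((W * supportProd (pairSupport a b) : ℕ) : ℝ) := by
        rw [supportProd, Nat.cast_mul, Nat.cast_prod, prod_div_distrib, prod_const_one]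
        field_simp
      rw [e]
      exact this
    · rw [prod_jointWeight_of_not_compatible hab, filter_false_of_mem]
      · simp
      · rintro n _ ⟨_, h3, h4⟩
        exact hab (compatible_of_hits hd h3 h4)
  calc _ = N / W * (c a * c b * ∏ p : P, jointWeight (1 / (p : ℝ)) (a p) (b p)) +
        c a * c b * ((#{n ∈ {n ∈ Ioc N (2 * N) | n ≡ v [MOD W]} | Hits h n a ∧ Hits h n b} : ℝ) -
      N / W * ∏ p : P, jointWeight (1 / (p : ℝ)) (a p) (b p)) := by ring
    _ ≤ _ := by
      refine add_le_add_right ((le_abs_self _).trans ?_) _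
      rw [abs_mul, abs_mul]
      exact mul_le_of_le_one_right (by positivity) h2

end Residues

/-! ### Primes in residue classes -/

section Progressions

open Finset ArithmeticFunction

/-- The maximal error in the prime number theorem for progressions modulo `q`. -/
noncomputable def progressionError (x : ℝ) (q : ℕ) : ℝ :=
  ⨆ a : {a : ℕ // a.Coprime q},
    |(∑ n ∈ Icc 1 ⌊x⌋₊, if n % q = (a : ℕ) % q then Λ n else 0) - x / (Nat.totient q)|

lemma abs_progression_sub_le {x : ℝ} (hx : 1 ≤ x) {q : ℕ} (hq : 0 < q) (a : ℕ) :
    |(∑ n ∈ Icc 1 ⌊x⌋₊, if n % q = a % q then Λ n else 0) - x / (Nat.totient q)| ≤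
      (x / q + 1) * Real.log x + x / Nat.totient q := by
  have h0 : 0 ≤ ∑ n ∈ Icc 1 ⌊x⌋₊, if n % q = a % q then Λ n else 0 :=
    sum_nonneg fun n _ => by split_ifs <;> [exact vonMangoldt_nonneg; exact le_rfl]
  have hl := Real.log_nonneg hx
  have h1 : ∑ n ∈ Icc 1 ⌊x⌋₊, (if n % q = a % q then Λ n else 0) ≤ (x / q + 1) * Real.log x := by
    rw [← sum_filter]
    calc _ ≤ ∑ n ∈ Icc 1 ⌊x⌋₊ with n % q = a % q, Real.log x := by
          refine sum_le_sum fun n hn => vonMangoldt_le_log.trans ?_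
          have hn := mem_Icc.1 (mem_filter.1 hn).1
          exact Real.log_le_log (by exact_mod_cast hn.1)
            ((Nat.le_floor_iff (by linarith)).1 hn.2)
      _ = (#{n ∈ Icc 1 ⌊x⌋₊ | n % q = a % q} : ℝ) * Real.log x := by simp
      _ ≤ _ := by
          refine mul_le_mul_of_nonneg_right ?_ hl
          have h := Nat.Ioc_filter_modEq_card 0 ⌊x⌋₊ hq a
          have h3 := Int.floor_le (((⌊x⌋₊ : ℚ) - a) / q)
          have h4 := Int.lt_floor_add_one ((((0 : ℕ) : ℚ) - a) / q)
          have e : ((⌊x⌋₊ : ℚ) - a) / q = (((0 : ℕ) : ℚ) - a) / q + ⌊x⌋₊ / q := by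
            push_cast; ring
          have h5 : ((#{n ∈ Ioc 0 ⌊x⌋₊ | n ≡ a [MOD q]} : ℤ) : ℚ) ≤ ⌊x⌋₊ / q + 1 := by
            rw [h, Int.cast_max, max_le_iff]
            constructor
            · push_cast at *; linarith
            · positivity
          have h6 : (#{n ∈ Ioc 0 ⌊x⌋₊ | n ≡ a [MOD q]} : ℝ) ≤ ⌊x⌋₊ / q + 1 := by
            have := (Rat.cast_le (K := ℝ)).2 h5
            push_cast at this
            exact this
          have h7 : (⌊x⌋₊ : ℝ) / q ≤ x / q :=
            div_le_div_of_nonneg_right (Nat.floor_le (by linarith)) (by positivity)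
          exact h6.trans (by linarith)
  have h2 : 0 ≤ x / Nat.totient q := by positivity
  rw [abs_le]
  constructor <;> linarith

lemma progressionError_bddAbove {x : ℝ} (hx : 1 ≤ x) {q : ℕ} (hq : 0 < q) :
    BddAbove (Set.range fun a : {a : ℕ // a.Coprime q} =>
      |(∑ n ∈ Icc 1 ⌊x⌋₊, if n % q = (a : ℕ) % q then Λ n else 0) - x / (Nat.totient q)|) := by
  refine ⟨(x / q + 1) * Real.log x + x / Nat.totient q, ?_⟩
  rintro _ ⟨a, rfl⟩
  exact abs_progression_sub_le hx hq a

lemma progressionError_nonneg (x : ℝ) (q : ℕ) : 0 ≤ progressionError x q :=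
  Real.iSup_nonneg fun _ => abs_nonneg _

lemma progressionError_le {x : ℝ} (hx : 1 ≤ x) {q : ℕ} (hq : 0 < q) :
    progressionError x q ≤ (x / q + 1) * Real.log x + x / Nat.totient q := by
  have : Nonempty {a : ℕ // a.Coprime q} := ⟨⟨1, Nat.coprime_one_left q⟩⟩
  exact ciSup_le fun a => abs_progression_sub_le hx hq a

lemma abs_sub_le_progressionError {x : ℝ} (hx : 1 ≤ x) {q : ℕ} (hq : 0 < q) {a : ℕ}
    (ha : a.Coprime q) :
    |(∑ n ∈ Icc 1 ⌊x⌋₊, if n % q = a % q then Λ n else 0) - x / (Nat.totient q)| ≤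
      progressionError x q :=
  le_ciSup (progressionError_bddAbove hx hq) ⟨a, ha⟩

lemma abs_sum_shifted_sub_le {N : ℕ} (hN : 0 < N) (t : ℕ) {Q : ℕ} (hQ : 0 < Q) {c : ℕ}
    (hc : (c + t).Coprime Q) :
    |∑ n ∈ Ioc N (2 * N) with n ≡ c [MOD Q], Λ (n + t) - N / Nat.totient Q| ≤
      progressionError (2 * N + t) Q + progressionError (N + t) Q := by
  have hN1 : (1 : ℝ) ≤ N := by exact_mod_cast hN
  have ht : (0 : ℝ) ≤ t := Nat.cast_nonneg t
  have h1 := abs_sub_le_progressionError (x := 2 * N + t) (by linarith) hQ hc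
  have h2 := abs_sub_le_progressionError (x := N + t) (by linarith) hQ hc
  have e1 : ⌊(2 * N + t : ℝ)⌋₊ = 2 * N + t := by
    rw [show (2 * N + t : ℝ) = ((2 * N + t : ℕ) : ℝ) by push_cast; ring, Nat.floor_natCast]
  have e2 : ⌊(N + t : ℝ)⌋₊ = N + t := by
    rw [show (N + t : ℝ) = ((N + t : ℕ) : ℝ) by push_cast; ring, Nat.floor_natCast]
  rw [e1] at h1
  rw [e2] at h2
  have e3 : ∀ m, Icc 1 m = Ioc 0 m := fun m => by ext; simp [Nat.succ_le_iff]
  rw [e3] at h1 h2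
  have h3 := sum_Ioc_consecutive (fun n => if n % Q = (c + t) % Q then Λ n else 0)
    (Nat.zero_le (N + t)) (by omega : N + t ≤ 2 * N + t)
  have e4 : ∑ n ∈ Ioc N (2 * N) with n ≡ c [MOD Q], Λ (n + t) =
      ∑ n ∈ Ioc (N + t) (2 * N + t), if n % Q = (c + t) % Q then Λ n else 0 := by
    rw [sum_filter]
    refine sum_nbij' (fun n => n + t) (fun n => n - t) ?_ ?_ ?_ ?_ ?_
    · intro n hn; simp only [mem_Ioc] at hn ⊢; omega
    · intro n hn; simp only [mem_Ioc] at hn ⊢; omega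
    · intro n _; simp
    · intro n hn; simp only [mem_Ioc] at hn ⊢; omega
    · intro n _
      have : n ≡ c [MOD Q] ↔ (n + t) % Q = (c + t) % Q :=
        ⟨fun h => h.add_right t, fun h => Nat.ModEq.add_right_cancel' t h⟩
      simp only [this]
  rw [e4]
  rw [abs_le] at *
  have e5 : (2 * N + t : ℝ) / Nat.totient Q =
    (N + t) / Nat.totient Q + N / Nat.totient Q := by ring
  constructor <;> linarith [h1.1, h1.2, h2.1, h2.2]

variable {P : Finset ℕ} {k : ℕ}

lemma totient_mul_supportProd {W : ℕ} (hP : ∀ p ∈ P, p.Prime) (hW : ∀ p ∈ P, p.Coprime W)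
    (S : Finset P) :
    (Nat.totient (W * supportProd S) : ℝ) = Nat.totient W * ∏ p ∈ S, (((p : ℕ) : ℝ) - 1) := by
  classical
  rw [Nat.totient_mul (coprime_supportProd hW S), Nat.cast_mul]
  congr 1
  induction S using Finset.induction_on with
  | empty => simp [supportProd]
  | insert p S hp ih =>
    rw [prod_insert hp, ← ih, supportProd, prod_insert hp, ← supportProd,
      Nat.totient_mul (coprime_supportProd_of_notMem hP hp), Nat.totient_prime (hP p p.2),
      Nat.cast_mul, Nat.cast_sub (hP p p.2).one_lt.le, Nat.cast_one]

open scoped Classical in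
/-- The sieve weights are summed over the primes of a residue class. -/
theorem le_sum_weights_vonMangoldt {W : ℕ} (hW0 : 0 < W) (hP : ∀ p ∈ P, p.Prime)
    (hW : ∀ p ∈ P, p.Coprime W) (h : Fin k → ℕ)
    (hd : ∀ p ∈ P, ∀ n i j, p ∣ n + h i → p ∣ n + h j → i = j) (t : ℕ)
    (ht : ∀ p ∈ P, ∀ n i, p ∣ n + h i → ¬ p ∣ n + t) (v : ℕ) (hv : (v + t).Coprime W) {N : ℕ}
    (hN : 0 < N) (c : (P → Option (Fin k)) → ℝ) :
    (N : ℝ) / Nat.totient W *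
        ∑ a, ∑ b, c a * c b * ∏ p : P, jointWeight (1 / ((p : ℝ) - 1)) (a p) (b p) -
      ∑ a, ∑ b, |c a| * |c b| *
        (progressionError (2 * N + t) (W * supportProd (pairSupport a b)) +
          progressionError (N + t) (W * supportProd (pairSupport a b))) ≤
    ∑ n ∈ Ioc N (2 * N) with n ≡ v [MOD W],
      Λ (n + t) * (∑ a, c a * if Hits h n a then 1 else 0) ^ 2 := by
  rw [sum_mul_sq_eq h, mul_sum, ← sum_sub_distrib]
  refine sum_le_sum fun a _ => ?_
  rw [mul_sum, ← sum_sub_distrib]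
  refine sum_le_sum fun b _ => ?_
  set E := progressionError (2 * N + t) (W * supportProd (pairSupport a b)) +
          progressionError (N + t) (W * supportProd (pairSupport a b)) with hE
  have hE0 : 0 ≤ E := add_nonneg (progressionError_nonneg _ _) (progressionError_nonneg _ _)
  have h2 : |∑ n ∈ {n ∈ Ioc N (2 * N) | n ≡ v [MOD W]} with Hits h n a ∧ Hits h n b, Λ (n + t) -
      N / Nat.totient W * ∏ p : P, jointWeight (1 / ((p : ℝ) - 1)) (a p) (b p)| ≤ E := by
    rw [filter_filter]
    by_cases hab : Compatible a b
    · obtain ⟨r, hr⟩ := exists_residue hP hW v h hab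
      rw [prod_jointWeight_of_compatible hab]
      have hr2 := (hr r).2 rfl
      simp only [hr]
      have hco : (r + t).Coprime (W * supportProd (pairSupport a b)) := by
        refine Nat.Coprime.mul_right ?_ (Nat.Coprime.prod_right fun p hp => ?_)
        · have := (hr2.1.add_right t).gcd_eq
          rw [Nat.Coprime, this]; exact hv
        · refine Nat.Coprime.symm ((Nat.Prime.coprime_iff_not_dvd (hP p p.2)).2 ?_)
          simp only [pairSupport, mem_filter, mem_univ, true_and] at hp
          rcases h3 : a p with _ | i
          · rcases h4 : b p with _ | i
            · exact absurd ⟨h3, h4⟩ hp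
            · exact ht p p.2 r i (hr2.2.2 p i h4)
          · exact ht p p.2 r i (hr2.2.1 p i h3)
      have := abs_sum_shifted_sub_le hN t (Nat.mul_pos hW0 (supportProd_pos hP _)) hco
      rw [← hE] at this
      rw [totient_mul_supportProd hP hW] at this
      have e : (N : ℝ) / Nat.totient W * ∏ p ∈ pairSupport a b, 1 / (((p : ℕ) : ℝ) - 1) =
          N / (Nat.totient W * ∏ p ∈ pairSupport a b, (((p : ℕ) : ℝ) - 1)) := by
        rw [prod_div_distrib, prod_const_one]
        rw [div_mul_div_comm, mul_one]
      rw [e]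
      exact this
    · rw [prod_jointWeight_of_not_compatible hab, filter_false_of_mem]
      · simpa using hE0
      · rintro n _ ⟨_, h3, h4⟩
        exact hab (compatible_of_hits hd h3 h4)
  set X := ∑ n ∈ {n ∈ Ioc N (2 * N) | n ≡ v [MOD W]} with Hits h n a ∧ Hits h n b, Λ (n + t)
  set Y := (N : ℝ) / Nat.totient W * ∏ p : P, jointWeight (1 / ((p : ℝ) - 1)) (a p) (b p) with hY
  have h3 : |c a * c b * (X - Y)| ≤ |c a| * |c b| * E := by
    rw [abs_mul, abs_mul]
    exact mul_le_mul_of_nonneg_left h2 (by positivity)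
  have h4 := neg_le_of_abs_le h3
  have e : (N : ℝ) / Nat.totient W *
      (c a * c b * ∏ p : P, jointWeight (1 / ((p : ℝ) - 1)) (a p) (b p)) = c a * c b * Y := by
    rw [hY]; ring
  rw [e]
  linarith

end Progressions

/-! ### The total error over pairs of labellings -/

section ErrorTerms

open Finset

variable {P : Finset ℕ} {k : ℕ}

/-- The set of labelled primes. -/
def labelSupport (r : P → Option (Fin k)) : Finset P := {p | r p ≠ none}

lemma supportProd_labelSupport (r : P → Option (Fin k)) :
    supportProd (labelSupport r) = labelSize r := by
  rw [supportProd, labelSupport, labelSize, prod_filter]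
  refine prod_congr rfl fun p _ => ?_
  by_cases h : r p = none <;> simp [h]

lemma card_labelSupport_eq (S : Finset P) :
    #{r : P → Option (Fin k) | labelSupport r = S} = k ^ #S := by
  have e : ({r : P → Option (Fin k) | labelSupport r = S} : Finset _) =
      Fintype.piFinset fun p => if p ∈ S then univ.erase none else {none} := by
    ext r
    simp only [mem_filter, mem_univ, true_and, Fintype.mem_piFinset, labelSupport,
      Finset.ext_iff]
    refine forall_congr' fun p => ?_
    by_cases hp : p ∈ S <;> simp [hp]
  rw [e, Fintype.card_piFinset, ← prod_const, ← prod_subset (subset_univ S)]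
  · refine prod_congr rfl fun p hp => ?_
    simp [hp]
  · intro p _ hp
    simp [hp]

lemma card_pairSupport_eq_le (S : Finset P) :
    #{x : (P → Option (Fin k)) × (P → Option (Fin k)) | pairSupport x.1 x.2 = S} ≤
      ((k + 1) ^ 2) ^ #S := by
  have e : #(Fintype.piFinset fun p : P => if p ∈ S then
      (univ : Finset (Option (Fin k) × Option (Fin k))) else {(none, none)}) =
      ((k + 1) ^ 2) ^ #S := by
    rw [Fintype.card_piFinset, ← prod_const, ← prod_subset (subset_univ S)]
    · refine prod_congr rfl fun p hp => ?_
      simp [hp, sq]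
    · intro p _ hp
      simp [hp]
  rw [← e]
  refine card_le_card_of_injOn (fun x p => (x.1 p, x.2 p)) ?_ ?_
  · intro x hx
    simp only [coe_filter, mem_univ, true_and, Set.mem_ofPred_eq] at hx
    simp only [mem_coe, Fintype.mem_piFinset]
    intro p
    split_ifs with hp
    · exact mem_univ _
    · rw [← hx] at hp
      simp only [pairSupport, mem_filter, mem_univ, true_and, not_not] at hp
      simp [hp.1, hp.2]
  · rintro ⟨a, b⟩ _ ⟨a', b'⟩ _ h
    simp only [funext_iff, Prod.mk.injEq, forall_and] at h
    exact Prod.ext (funext h.1) (funext h.2)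

lemma supportProd_pairSupport_le (hP : ∀ p ∈ P, p.Prime) (a b : P → Option (Fin k)) :
    supportProd (pairSupport a b) ≤ labelSize a * labelSize b := by
  rw [supportProd, pairSupport, prod_filter, labelSize, labelSize, ← prod_mul_distrib]
  refine prod_le_prod' fun p _ => ?_
  have := (hP p p.2).one_lt.le
  by_cases h1 : a p = none <;> by_cases h2 : b p = none <;> simp [h1, h2]
  nlinarith

lemma supportProd_injective (hP : ∀ p ∈ P, p.Prime) :
    Function.Injective (supportProd : Finset P → ℕ) := by
  have h : ∀ (S : Finset P) (p : P), p ∈ S ↔ (p : ℕ) ∣ supportProd S := by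
    intro S p
    refine ⟨fun hp => dvd_prod_of_mem (fun p : P => (p : ℕ)) hp, fun hp => ?_⟩
    by_contra hn
    exact (Nat.Prime.coprime_iff_not_dvd (hP p p.2)).1
      (coprime_supportProd_of_notMem hP hn) hp
  intro S T hST
  ext p
  rw [h S, h T, hST]

lemma sum_pow_card_div_le (hP : ∀ p ∈ P, p.Prime) {W : ℕ} (hW : ∀ p ∈ P, p.Coprime W) (K : ℕ)
    (x : ℝ) :
    ∑ S : Finset P with (supportProd S : ℝ) ≤ x, (K : ℝ) ^ #S / supportProd S ≤
      roughSum W x ^ K := by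
  refine le_trans (le_of_eq ?_) (sum_inv_labelSize_le (k := K) hP hW x)
  rw [← sum_fiberwise_of_maps_to (s := {r : P → Option (Fin K) | (labelSize r : ℝ) ≤ x})
    (t := {S : Finset P | (supportProd S : ℝ) ≤ x}) (g := labelSupport)]
  · refine sum_congr rfl fun S hS => ?_
    rw [filter_filter]
    have e : ({r : P → Option (Fin K) | (labelSize r : ℝ) ≤ x ∧ labelSupport r = S} : Finset _) =
        ({r : P → Option (Fin K) | labelSupport r = S} : Finset _) := by
      refine filter_congr fun r _ => and_iff_right_of_imp fun h => ?_
      rw [← supportProd_labelSupport, h]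
      exact (mem_filter.1 hS).2
    rw [e, sum_congr rfl (g := fun _ => 1 / (supportProd S : ℝ)), sum_const, card_labelSupport_eq,
      nsmul_eq_mul, Nat.cast_pow, mul_one_div]
    intro r hr
    rw [← supportProd_labelSupport, (mem_filter.1 hr).2]
  · intro r hr
    simpa [supportProd_labelSupport] using hr

lemma progressionError_supportProd_le (hP : ∀ p ∈ P, p.Prime) {W : ℕ} (hW0 : 0 < W)
    (hW : ∀ p ∈ P, p.Coprime W) {x : ℝ} (hx : 1 ≤ Real.log x) (hx1 : 1 ≤ x) (S : Finset P)
    (hS : ((W * supportProd S : ℕ) : ℝ) ≤ x) :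
    progressionError x (W * supportProd S) ≤ 3 * x * Real.log x * (2 ^ #S / supportProd S) := by
  have hs := supportProd_pos hP S
  refine (progressionError_le hx1 (Nat.mul_pos hW0 hs)).trans ?_
  have hs' : (0 : ℝ) < supportProd S := by exact_mod_cast hs
  have hW' : (1 : ℝ) ≤ W := by exact_mod_cast hW0
  have hQ : (supportProd S : ℝ) ≤ ((W * supportProd S : ℕ) : ℝ) := by
    push_cast; nlinarith
  set Q : ℝ := ((W * supportProd S : ℕ) : ℝ)
  have h1 : x / Q + 1 ≤ 2 * (x / supportProd S) := by
    have h2 : x / Q ≤ x / supportProd S := by gcongr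
    have h3 : 1 ≤ x / Q := by rw [le_div_iff₀ (by linarith)]; linarith
    linarith
  have h4 : 1 / (Nat.totient (W * supportProd S) : ℝ) ≤ 2 ^ #S / supportProd S := by
    rw [totient_mul_supportProd hP hW]
    have h5 : (1 : ℝ) ≤ Nat.totient W := by exact_mod_cast Nat.totient_pos.2 hW0
    have h6 : ∏ p ∈ S, 1 / (((p : ℕ) : ℝ) - 1) ≤ ∏ p ∈ S, 2 / ((p : ℕ) : ℝ) := by
      refine prod_le_prod (fun p _ => ?_) fun p _ => ?_
      · have : (2 : ℝ) ≤ (p : ℕ) := by exact_mod_cast (hP p p.2).two_le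
        exact div_nonneg zero_le_one (by linarith)
      · have : (2 : ℝ) ≤ (p : ℕ) := by exact_mod_cast (hP p p.2).two_le
        rw [div_le_div_iff₀ (by linarith) (by linarith)]
        linarith
    have h7 : 0 ≤ ∏ p ∈ S, 1 / (((p : ℕ) : ℝ) - 1) := prod_nonneg fun p _ => by
      have : (2 : ℝ) ≤ (p : ℕ) := by exact_mod_cast (hP p p.2).two_le
      exact div_nonneg zero_le_one (by linarith)
    calc _ = 1 / (Nat.totient W : ℝ) * ∏ p ∈ S, 1 / (((p : ℕ) : ℝ) - 1) := by
          rw [prod_div_distrib, prod_const_one, div_mul_div_comm, mul_one]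
      _ ≤ 1 * ∏ p ∈ S, 1 / (((p : ℕ) : ℝ) - 1) := by
          refine mul_le_mul_of_nonneg_right ?_ h7
          rw [div_le_one (by linarith)]; exact h5
      _ ≤ ∏ p ∈ S, 2 / ((p : ℕ) : ℝ) := by rw [one_mul]; exact h6
      _ = _ := by rw [prod_div_distrib, prod_const, supportProd, Nat.cast_prod]
  set y : ℝ := 2 ^ #S / supportProd S
  have h8 : 1 / (supportProd S : ℝ) ≤ y :=
    div_le_div_of_nonneg_right (one_le_pow₀ one_le_two) hs'.le
  have h9 : x / Nat.totient (W * supportProd S) ≤ x * y := by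
    rw [div_eq_mul_one_div]; exact mul_le_mul_of_nonneg_left h4 (by linarith)
  have h10 : x / supportProd S ≤ x * y := by
    rw [div_eq_mul_one_div]; exact mul_le_mul_of_nonneg_left h8 (by linarith)
  have hxy : 0 ≤ x * y := by positivity
  nlinarith [mul_le_mul_of_nonneg_right h1 (by linarith : 0 ≤ Real.log x)]

/-- The error over all pairs of labellings is controlled by the errors over all moduli. -/
theorem sum_pair_progressionError_le (hP : ∀ p ∈ P, p.Prime) {W : ℕ} (hW0 : 0 < W)
    (hW : ∀ p ∈ P, p.Coprime W) {R x y T : ℝ} (hx : 1 ≤ Real.log x) (hx1 : 1 ≤ x) (hyx : y ≤ x)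
    (hy : W * R ^ 2 ≤ y) (hT : 0 < T) :
    ∑ a : P → Option (Fin k) with (labelSize a : ℝ) ≤ R,
      ∑ b : P → Option (Fin k) with (labelSize b : ℝ) ≤ R,
        progressionError x (W * supportProd (pairSupport a b)) ≤
      3 * x * Real.log x * roughSum W (R ^ 2) ^ (((k + 1) ^ 2) ^ 2 * 2) / T +
        T * ∑ q ∈ Icc 1 ⌊y⌋₊, progressionError x q := by
  set 𝒮 : Finset (Finset P) := {S | (supportProd S : ℝ) ≤ R ^ 2} with h𝒮
  set E : Finset P → ℝ := fun S => progressionError x (W * supportProd S) with hE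
  have hE0 : ∀ S, 0 ≤ E S := fun S => progressionError_nonneg _ _
  have hWs : ∀ S ∈ 𝒮, ((W * supportProd S : ℕ) : ℝ) ≤ y := by
    intro S hS
    have h1 := (mem_filter.1 hS).2
    push_cast
    exact (mul_le_mul_of_nonneg_left h1 (Nat.cast_nonneg W)).trans hy
  set m : ℝ := (((k + 1) ^ 2 : ℕ) : ℝ) with hm
  have h1 : ∑ a : P → Option (Fin k) with (labelSize a : ℝ) ≤ R,
      ∑ b : P → Option (Fin k) with (labelSize b : ℝ) ≤ R, E (pairSupport a b) ≤
      ∑ S ∈ 𝒮, m ^ #S * E S := by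
    rw [← sum_product']
    rw [← sum_fiberwise_of_maps_to (t := 𝒮) (g := fun x => pairSupport x.1 x.2)]
    · refine sum_le_sum fun S _ => ?_
      rw [sum_congr rfl (g := fun _ => E S) fun x hx => by rw [(mem_filter.1 hx).2], sum_const,
        nsmul_eq_mul]
      refine mul_le_mul_of_nonneg_right ?_ (hE0 S)
      have := card_pairSupport_eq_le (k := k) S
      rw [hm, ← Nat.cast_pow]
      refine Nat.cast_le.2 (le_trans (card_le_card ?_) this)
      exact filter_subset_filter _ (subset_univ _)
    · rintro ⟨a, b⟩ hab
      simp only [mem_product, mem_filter, mem_univ, true_and] at hab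
      simp only [h𝒮, mem_filter, mem_univ, true_and]
      have := supportProd_pairSupport_le hP a b
      calc (supportProd (pairSupport a b) : ℝ) ≤ labelSize a * labelSize b := by
            exact_mod_cast this
        _ ≤ R * R := mul_le_mul hab.1 hab.2 (by positivity) ((Nat.cast_nonneg _).trans hab.1)
        _ = R ^ 2 := (sq R).symm
  have h2 : ∀ S ∈ 𝒮, m ^ #S * E S ≤
      3 * x * Real.log x / T * (((((k + 1) ^ 2) ^ 2 * 2 : ℕ) : ℝ) ^ #S / supportProd S) +
        T * E S := by
    intro S hS
    have h3 := progressionError_supportProd_le hP hW0 hW hx hx1 S ((hWs S hS).trans hyx)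
    have h4 : m ^ #S ≤ (m ^ #S) ^ 2 / T + T := by
      rw [div_add' _ _ _ hT.ne', le_div_iff₀ hT]
      nlinarith [sq_nonneg (m ^ #S - T), sq_nonneg (m ^ #S + T)]
    calc m ^ #S * E S ≤ ((m ^ #S) ^ 2 / T + T) * E S :=
          mul_le_mul_of_nonneg_right h4 (hE0 S)
      _ = (m ^ #S) ^ 2 / T * E S + T * E S := by ring
      _ ≤ (m ^ #S) ^ 2 / T * (3 * x * Real.log x * (2 ^ #S / supportProd S)) + T * E S := by
          gcongr
      _ = _ := by
          rw [hm]; push_cast; rw [mul_pow, ← pow_mul, ← pow_mul, ← pow_mul, ← pow_mul,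
            mul_comm (#S) 2, ← mul_assoc]
          ring
  refine h1.trans ((sum_le_sum h2).trans ?_)
  rw [sum_add_distrib, ← mul_sum, ← mul_sum]
  refine add_le_add ?_ (mul_le_mul_of_nonneg_left ?_ hT.le)
  · have hl : 0 ≤ Real.log x := by linarith
    refine (mul_le_mul_of_nonneg_left (sum_pow_card_div_le hP hW (((k + 1) ^ 2) ^ 2 * 2) (R ^ 2))
      (by positivity : 0 ≤ 3 * x * Real.log x / T)).trans (le_of_eq (by ring))
  · rw [← sum_image (f := fun q => progressionError x q) (g := fun S => W * supportProd S)]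
    · refine sum_le_sum_of_subset_of_nonneg ?_ fun q _ _ => progressionError_nonneg _ _
      intro q hq
      obtain ⟨S, hS, rfl⟩ := mem_image.1 hq
      exact mem_Icc.2 ⟨Nat.mul_pos hW0 (supportProd_pos hP S), Nat.le_floor (hWs S hS)⟩
    · intro S _ T _ h
      exact supportProd_injective hP (Nat.eq_of_mul_eq_mul_left hW0 h)

end ErrorTerms

/-! ### Prime powers -/

section PrimePowers

open Finset ArithmeticFunction

variable {P : Finset ℕ}

open scoped Classical in
lemma card_hits_le {k : ℕ} (h : Fin k → ℕ)
    (hd : ∀ p ∈ P, ∀ n i j, p ∣ n + h i → p ∣ n + h j → i = j) (n : ℕ) :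
    #{a : P → Option (Fin k) | Hits h n a} ≤ 2 ^ #{p : P | ∃ i, (p : ℕ) ∣ n + h i} := by
  rw [← card_powerset]
  refine card_le_card_of_injOn labelSupport ?_ ?_
  · intro a ha
    simp only [coe_filter, mem_univ, true_and, Set.mem_ofPred_eq] at ha
    simp only [mem_coe, mem_powerset]
    intro p hp
    simp only [labelSupport, mem_filter, mem_univ, true_and] at hp ⊢
    obtain ⟨i, hi⟩ := Option.ne_none_iff_exists'.1 hp
    exact ⟨i, ha p i hi⟩
  · intro a ha b hb hab
    simp only [coe_filter, mem_univ, true_and, Set.mem_ofPred_eq] at ha hb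
    funext p
    have h1 : a p ≠ none ↔ b p ≠ none := by
      have := Finset.ext_iff.1 hab p
      simpa [labelSupport] using this
    rcases h2 : a p with _ | i
    · rcases h3 : b p with _ | j
      · rfl
      · simp [h2, h3] at h1
    · rcases h3 : b p with _ | j
      · simp [h2, h3] at h1
      · rw [hd p p.2 n i j (ha p i h2) (hb p j h3)]

open scoped Classical in
lemma card_hits_pow_le (hP : ∀ p ∈ P, p.Prime) (hP32 : ∀ p ∈ P, 2 ^ 32 ≤ p) (h : Fin 4 → ℕ)
    (hd : ∀ p ∈ P, ∀ n i j, p ∣ n + h i → p ∣ n + h j → i = j) {n X : ℕ} (hn : 0 < n)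
    (hX : ∀ i, n + h i ≤ X) :
    #{a : P → Option (Fin 4) | Hits h n a} ^ 8 ≤ X := by
  set Q : Finset P := {p : P | ∃ i, (p : ℕ) ∣ n + h i} with hQ
  have h1 := card_hits_le h hd n
  rw [← hQ] at h1
  have h2 : ∏ p ∈ Q, (p : ℕ) ≤ ∏ i, (n + h i) := by
    refine Nat.le_of_dvd (prod_pos fun i _ => by omega) ?_
    have h3 : ∏ p ∈ Q.map (Function.Embedding.subtype _), p ∣ ∏ i, (n + h i) := by
      refine prod_primes_dvd _ ?_ ?_
      · intro p hp
        obtain ⟨p, -, rfl⟩ := mem_map.1 hp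
        exact (hP p p.2).prime
      · intro p hp
        obtain ⟨q, hq, rfl⟩ := mem_map.1 hp
        obtain ⟨i, hi⟩ := (mem_filter.1 hq).2
        exact hi.trans (dvd_prod_of_mem _ (mem_univ i))
    rwa [prod_map] at h3
  have h3 : ∏ i, (n + h i) ≤ X ^ 4 := by
    refine (prod_le_prod' fun i _ => hX i).trans ?_
    simp
  have h4 : (2 ^ 32) ^ #Q ≤ ∏ p ∈ Q, (p : ℕ) := by
    rw [← prod_const]
    exact prod_le_prod' fun p _ => hP32 p p.2
  have h5 : (#{a : P → Option (Fin 4) | Hits h n a} ^ 8) ^ 4 ≤ X ^ 4 := by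
    calc _ ≤ ((2 ^ #Q) ^ 8) ^ 4 := by gcongr
      _ = (2 ^ 32) ^ #Q := by rw [← pow_mul, ← pow_mul, ← pow_mul]; congr 1; ring
      _ ≤ _ := h4.trans (h2.trans h3)
  exact (Nat.pow_le_pow_iff_left (by norm_num)).1 h5

open scoped Classical in
/-- Passing from the von Mangoldt function to the primes. -/
theorem sum_weights_vonMangoldt_le (hP : ∀ p ∈ P, p.Prime) (hP32 : ∀ p ∈ P, 2 ^ 32 ≤ p)
    (h : Fin 4 → ℕ) (hd : ∀ p ∈ P, ∀ n i j, p ∣ n + h i → p ∣ n + h j → i = j) {N X t v W : ℕ}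
    (hX : ∀ i, 2 * N + h i ≤ X) (ht : 2 * N + t ≤ X) (hX1 : 1 ≤ X)
    {c : (P → Option (Fin 4)) → ℝ} {B : ℝ} (hc : ∀ a, |c a| ≤ B) :
    ∑ n ∈ Ioc N (2 * N) with n ≡ v [MOD W],
        Λ (n + t) * (∑ a, c a * if Hits h n a then 1 else 0) ^ 2 ≤
      ∑ n ∈ Ioc N (2 * N) with n ≡ v [MOD W],
        (if (n + t).Prime then Real.log (n + t : ℕ) else 0) *
          (∑ a, c a * if Hits h n a then 1 else 0) ^ 2 +
      B ^ 2 * (X : ℝ) ^ (1 / 4 : ℝ) * (2 * √X * Real.log X) := by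
  have hB : 0 ≤ B := (abs_nonneg _).trans (hc fun _ => none)
  have key : ∀ n ∈ Ioc N (2 * N), (∑ a, c a * if Hits h n a then 1 else 0) ^ 2 ≤
      B ^ 2 * (X : ℝ) ^ (1 / 4 : ℝ) := by
    intro n hn
    have hn := mem_Ioc.1 hn
    have h1 := card_hits_pow_le hP hP32 h hd (n := n) (X := X) (by omega)
      fun i => by have := hX i; omega
    set s : ℕ := #{a : P → Option (Fin 4) | Hits h n a}
    have h2 : |∑ a, c a * if Hits h n a then 1 else 0| ≤ B * s := by
      refine (abs_sum_le_sum_abs _ _).trans ?_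
      calc _ ≤ ∑ a, if Hits h n a then B else 0 := by
            refine sum_le_sum fun a _ => ?_
            split_ifs
            · rw [mul_one]; exact hc a
            · simp
        _ = _ := by rw [← sum_filter, sum_const, nsmul_eq_mul, mul_comm]
    have h3 : (s : ℝ) ^ 2 ≤ (X : ℝ) ^ (1 / 4 : ℝ) := by
      have h4 : (s : ℝ) ^ 8 ≤ X := by exact_mod_cast h1
      calc (s : ℝ) ^ 2 = ((s : ℝ) ^ 8) ^ (1 / 4 : ℝ) := by
            rw [← Real.rpow_natCast, ← Real.rpow_natCast, ← Real.rpow_mul (by positivity)]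
            norm_num
        _ ≤ _ := Real.rpow_le_rpow (by positivity) h4 (by norm_num)
    rw [← sq_abs]
    calc _ ≤ (B * s) ^ 2 := pow_le_pow_left₀ (abs_nonneg _) h2 2
      _ = B ^ 2 * s ^ 2 := mul_pow _ _ _
      _ ≤ _ := mul_le_mul_of_nonneg_left h3 (sq_nonneg B)
  set w : ℕ → ℝ := fun n => (∑ a, c a * if Hits h n a then 1 else 0) ^ 2
  set V : ℝ := B ^ 2 * (X : ℝ) ^ (1 / 4 : ℝ)
  have hV : 0 ≤ V := by positivity
  have h1 : ∀ n ∈ {n ∈ Ioc N (2 * N) | n ≡ v [MOD W]}, Λ (n + t) * w n ≤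
      (if (n + t).Prime then Real.log (n + t : ℕ) else 0) * w n +
        V * (if ¬ (n + t).Prime then Λ (n + t) else 0) := by
    intro n hn
    by_cases hp : (n + t).Prime
    · simp [hp, vonMangoldt_apply_prime hp]
    · simp only [hp, if_false, zero_mul, zero_add, not_false_eq_true, if_true]
      rw [mul_comm]
      exact mul_le_mul_of_nonneg_right (key n (mem_filter.1 hn).1) vonMangoldt_nonneg
  refine (sum_le_sum h1).trans ?_
  rw [sum_add_distrib, ← mul_sum]
  refine add_le_add le_rfl (mul_le_mul_of_nonneg_left ?_ hV)
  refine le_trans ?_ (Chebyshev.psi_sub_theta_le (x := X) (by exact_mod_cast hX1))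
  rw [Chebyshev.psi_sub_theta_eq_sum_not_prime, Nat.floor_natCast, ← sum_filter, filter_filter]
  rw [← sum_image (f := fun n => Λ n) (g := fun n => n + t) (by intro a _ b _ hab; simpa using hab)]
  refine sum_le_sum_of_subset_of_nonneg ?_ fun _ _ _ => vonMangoldt_nonneg
  intro q hq
  obtain ⟨n, hn, rfl⟩ := mem_image.1 hq
  simp only [mem_filter, mem_Ioc] at hn ⊢
  exact ⟨by omega, hn.2.2⟩

end PrimePowers

/-! ### Estimates for the two sieve sums -/

section SieveSums

open Finset ArithmeticFunction

variable {P : Finset ℕ} {k : ℕ}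

lemma sum_abs_sieveWeight_le (hP : ∀ p ∈ P, p.Prime) {W : ℕ} (hW : ∀ p ∈ P, p.Coprime W)
    {R : ℝ} (hR : 1 < R) {f : ℝ → ℝ → ℝ} {M : ℝ} (hf : TriangleBound f M) :
    ∑ a : P → Option (Fin k), |sieveWeight R f a| ≤
      R * roughSum W R ^ k * (M * roughSum W R ^ k) := by
  have hM := hf.nonneg
  have hA := roughSum_nonneg W R
  rw [← sum_subset (filter_subset (fun a : P → Option (Fin k) => (labelSize a : ℝ) ≤ R) univ)]
  · refine (sum_le_sum fun a _ => abs_sieveWeight_le hP hW hR hf a).trans ?_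
    rw [sum_const, nsmul_eq_mul]
    exact mul_le_mul_of_nonneg_right (card_labels_le hP hW (by linarith)) (by positivity)
  · intro a _ ha
    by_contra hn
    exact ha (mem_filter.2 ⟨mem_univ _,
      labelSize_le_of_sieveWeight_ne_zero (f := f) hP hR fun h => hn (by simp [h])⟩)

open scoped Classical in
theorem sum_sieve_weights_le {W : ℕ} (hW0 : 0 < W) (hP : ∀ p ∈ P, p.Prime)
    (hPk : ∀ p ∈ P, k ≤ p) (hW : ∀ p ∈ P, p.Coprime W) (h : Fin k → ℕ)
    (hd : ∀ p ∈ P, ∀ n i j, p ∣ n + h i → p ∣ n + h j → i = j) (v N : ℕ)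
    {R : ℝ} (hR : 1 < R) {f : ℝ → ℝ → ℝ} {M : ℝ} (hf : TriangleBound f M) :
    ∑ n ∈ Ioc N (2 * N) with n ≡ v [MOD W],
        (∑ a : P → Option (Fin k), sieveWeight R f a * if Hits h n a then 1 else 0) ^ 2 ≤
      (N : ℝ) / W * ((roughStep W R)^[k] (fun u q => f u q ^ 2)) 1 0 +
        (R * roughSum W R ^ k * (M * roughSum W R ^ k)) ^ 2 := by
  refine (sum_weights_le hW0 hP hW h hd v N _).trans (add_le_add ?_ ?_)
  · refine mul_le_mul_of_nonneg_left ?_ (by positivity)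
    refine le_trans ?_ (sum_upperDiag_sieveCoeff_le hP hW hR f)
    exact sieve_form_le P (fun p => ((p : ℕ) : ℝ)) (fun p => by exact_mod_cast hPk p p.2)
      (fun p => by exact_mod_cast (hP p p.2).pos) (sieveCoeff R f)
  · exact pow_le_pow_left₀ (sum_nonneg fun _ _ => abs_nonneg _)
      (sum_abs_sieveWeight_le hP hW hR hf) 2

lemma embedLabel_injective (m : Fin (k + 1)) :
    Function.Injective (embedLabel m : (P → Option (Fin k)) → P → Option (Fin (k + 1))) :=
  fun _ _ h => funext fun p => Option.map_injective m.succAbove_right_injective (congrFun h p)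

lemma labelSize_embedLabel (m : Fin (k + 1)) (a : P → Option (Fin k)) :
    labelSize (embedLabel m a) = labelSize a := by
  simp [labelSize, embedLabel]

lemma hits_embedLabel_iff (m : Fin (k + 1)) (h : Fin (k + 1) → ℕ) (n : ℕ)
    (a : P → Option (Fin k)) : Hits h n (embedLabel m a) ↔ Hits (h ∘ m.succAbove) n a := by
  refine forall_congr' fun p => ?_
  rcases h1 : a p with _ | i
  · simp [embedLabel, h1]
  · simp [embedLabel, h1]

open scoped Classical in
/-- If `n + h m` is a large prime then the label `m` does not occur. -/
lemma sum_hits_eq_of_prime (hP : ∀ p ∈ P, p.Prime) (m : Fin (k + 1)) (h : Fin (k + 1) → ℕ)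
    {n : ℕ} (hn : (n + h m).Prime) (hPn : ∀ p ∈ P, p < n + h m)
    (c : (P → Option (Fin (k + 1))) → ℝ) :
    ∑ a, c a * (if Hits h n a then 1 else 0) =
      ∑ a : P → Option (Fin k), c (embedLabel m a) *
        if Hits (h ∘ m.succAbove) n a then 1 else 0 := by
  simp_rw [← hits_embedLabel_iff]
  rw [← sum_image (f := fun a => c a * if Hits h n a then 1 else 0)
    (g := embedLabel m) (s := univ) (fun a _ b _ hab => embedLabel_injective m hab)]
  refine (sum_subset (subset_univ _) fun a _ ha => ?_).symm
  rw [if_neg, mul_zero]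
  intro hh
  refine ha (mem_image.2 ?_)
  have h1 : ∀ p, ∃ x : Option (Fin k), x.map m.succAbove = a p := by
    intro p
    rcases h2 : a p with _ | i
    · exact ⟨none, rfl⟩
    · have h3 : i ≠ m := by
        rintro rfl
        have h4 := (Nat.prime_dvd_prime_iff_eq (hP p p.2) hn).1 (hh p i h2)
        have := hPn p p.2
        omega
      obtain ⟨j, rfl⟩ := Fin.exists_succAbove_eq h3
      exact ⟨some j, rfl⟩
  choose b hb using h1
  exact ⟨b, mem_univ _, funext hb⟩

lemma sum_abs_mul_error_le (hP : ∀ p ∈ P, p.Prime) {W : ℕ} (hW : ∀ p ∈ P, p.Coprime W)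
    {R : ℝ} (hR : 1 < R) {f : ℝ → ℝ → ℝ} {M : ℝ} (hf : TriangleBound f M) (m : Fin (k + 1))
    {E : (P → Option (Fin k)) → (P → Option (Fin k)) → ℝ} (hE : ∀ a b, 0 ≤ E a b) :
    ∑ a : P → Option (Fin k), ∑ b : P → Option (Fin k),
        |sieveWeight R f (embedLabel m a)| * |sieveWeight R f (embedLabel m b)| * E a b ≤
      (M * roughSum W R ^ (k + 1)) ^ 2 *
        ∑ a : P → Option (Fin k) with (labelSize a : ℝ) ≤ R,
          ∑ b : P → Option (Fin k) with (labelSize b : ℝ) ≤ R, E a b := by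
  have hM := hf.nonneg
  have hA := roughSum_nonneg W R
  have h0 : ∀ a : P → Option (Fin k),
      a ∉ ({a | (labelSize a : ℝ) ≤ R} : Finset (P → Option (Fin k))) →
        |sieveWeight R f (embedLabel m a)| = 0 := by
    intro a ha
    by_contra hn
    refine ha (mem_filter.2 ⟨mem_univ _, ?_⟩)
    rw [← labelSize_embedLabel m]
    exact labelSize_le_of_sieveWeight_ne_zero (f := f) hP hR fun h => hn (by simp [h])
  rw [← sum_subset (filter_subset (fun a : P → Option (Fin k) => (labelSize a : ℝ) ≤ R) univ)
    fun a _ ha => by simp [h0 a ha], mul_sum]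
  refine sum_le_sum fun a _ => ?_
  rw [← sum_subset (filter_subset (fun a : P → Option (Fin k) => (labelSize a : ℝ) ≤ R) univ)
    fun b _ hb => by simp [h0 b hb], mul_sum]
  refine sum_le_sum fun b _ => mul_le_mul_of_nonneg_right ?_ (hE a b)
  rw [sq]
  exact mul_le_mul (abs_sieveWeight_le hP hW hR hf _) (abs_sieveWeight_le hP hW hR hf _)
    (abs_nonneg _) (by positivity)

open scoped Classical in
theorem le_sum_prime_sieve_weights {W : ℕ} (hW0 : 0 < W) (hP : ∀ p ∈ P, p.Prime)
    (hP32 : ∀ p ∈ P, 2 ^ 32 ≤ p) (hW : ∀ p ∈ P, p.Coprime W) (h : Fin 5 → ℕ)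
    (hd : ∀ p ∈ P, ∀ n i j, p ∣ n + h i → p ∣ n + h j → i = j) (m : Fin 5) {v N X : ℕ}
    (hv : (v + h m).Coprime W) (hN : 0 < N) (hPN : ∀ p ∈ P, p ≤ N)
    (hX : ∀ i, 2 * N + h i ≤ X)
    {R : ℝ} (hR : 1 < R) {f : ℝ → ℝ → ℝ} {M : ℝ} (hf : TriangleBound f M) :
    (N : ℝ) / Nat.totient W * ∑ r : P → Option (Fin 4),
        (∏ p : P, lowerDiag (p : ℝ) (r p)) * restrictCoeff m R f r ^ 2 -
      (M * roughSum W R ^ 5) ^ 2 *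
        (∑ a : P → Option (Fin 4) with (labelSize a : ℝ) ≤ R,
          ∑ b : P → Option (Fin 4) with (labelSize b : ℝ) ≤ R,
            progressionError (2 * N + h m) (W * supportProd (pairSupport a b)) +
        ∑ a : P → Option (Fin 4) with (labelSize a : ℝ) ≤ R,
          ∑ b : P → Option (Fin 4) with (labelSize b : ℝ) ≤ R,
            progressionError (N + h m) (W * supportProd (pairSupport a b))) -
      (M * roughSum W R ^ 5) ^ 2 * (X : ℝ) ^ (1 / 4 : ℝ) * (2 * √X * Real.log X) ≤
    ∑ n ∈ Ioc N (2 * N) with n ≡ v [MOD W],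
      (if (n + h m).Prime then Real.log (n + h m : ℕ) else 0) *
        (∑ a : P → Option (Fin 5), sieveWeight R f a * if Hits h n a then 1 else 0) ^ 2 := by
  set c : (P → Option (Fin 4)) → ℝ := fun a => sieveWeight R f (embedLabel m a) with hc
  set h' : Fin 4 → ℕ := h ∘ m.succAbove with hh'
  have hd' : ∀ p ∈ P, ∀ n i j, p ∣ n + h' i → p ∣ n + h' j → i = j := fun p hp n i j hi hj =>
    m.succAbove_right_injective (hd p hp n _ _ hi hj)
  have ht' : ∀ p ∈ P, ∀ n i, p ∣ n + h' i → ¬ p ∣ n + h m := fun p hp n i hi hm =>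
    m.succAbove_ne i (hd p hp n _ _ hi hm)
  have h1 : ∑ n ∈ Ioc N (2 * N) with n ≡ v [MOD W],
      (if (n + h m).Prime then Real.log (n + h m : ℕ) else 0) *
        (∑ a : P → Option (Fin 5), sieveWeight R f a * if Hits h n a then 1 else 0) ^ 2 =
      ∑ n ∈ Ioc N (2 * N) with n ≡ v [MOD W],
        (if (n + h m).Prime then Real.log (n + h m : ℕ) else 0) *
        (∑ a, c a * if Hits h' n a then 1 else 0) ^ 2 := by
    refine sum_congr rfl fun n hn => ?_
    have hn := mem_Ioc.1 (mem_filter.1 hn).1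
    by_cases hp : (n + h m).Prime
    · rw [sum_hits_eq_of_prime hP m h hp fun p hp => by have := hPN p hp; omega]
    · simp [hp]
  have h2 := sum_weights_vonMangoldt_le (W := W) (v := v) (t := h m) hP hP32 h' hd'
    (fun i => hX (m.succAbove i)) (hX m) (by have := hX m; omega) (c := c)
    (fun a => abs_sieveWeight_le hP hW hR hf (embedLabel m a))
  have h3 := le_sum_weights_vonMangoldt hW0 hP hW h' hd' (h m) ht' v hv hN c
  have h4 := le_sieve_form P (fun p => ((p : ℕ) : ℝ))
    (fun p => by exact_mod_cast le_trans (by norm_num) (hP32 p p.2)) (restrictCoeff m R f)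
  simp_rw [← sieveWeight_embedLabel] at h4
  have h5 := sum_abs_mul_error_le (k := 4) hP hW hR hf m
    (E := fun a b => progressionError (2 * N + h m) (W * supportProd (pairSupport a b)) +
      progressionError (N + h m) (W * supportProd (pairSupport a b)))
    fun a b => add_nonneg (progressionError_nonneg _ _) (progressionError_nonneg _ _)
  simp only [sum_add_distrib] at h5
  have h6 := mul_le_mul_of_nonneg_left h4 (by positivity : (0 : ℝ) ≤ (N : ℝ) / Nat.totient W)
  rw [h1]
  simp only [hc] at h2 h3 ⊢
  norm_num only at h2 h5
  linarith

end SieveSums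

/-! ### Size of the error terms -/

section ErrorSizes

open Finset ArithmeticFunction

lemma eventually_mul_log_pow_le (c : ℝ) (j : ℕ) {a : ℝ} (ha : 0 < a) :
    ∀ᶠ N : ℕ in atTop, c * Real.log N ^ j ≤ (N : ℝ) ^ a := by
  have h := (isLittleO_log_rpow_rpow_atTop (j : ℝ) ha).const_mul_left c
  have h1 := (h.bound (zero_lt_one' ℝ)).and (eventually_ge_atTop 1)
  filter_upwards [tendsto_natCast_atTop_atTop.eventually h1] with N hN
  have h2 := hN.1
  rw [one_mul, Real.rpow_natCast, Real.norm_eq_abs, Real.norm_eq_abs,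
    abs_of_nonneg (a := (N : ℝ) ^ a) (by positivity)] at h2
  exact (le_abs_self _).trans h2

lemma eventually_le_log (c : ℝ) : ∀ᶠ N : ℕ in atTop, c ≤ Real.log N :=
  (Real.tendsto_log_atTop.comp tendsto_natCast_atTop_atTop).eventually (eventually_ge_atTop c)

lemma log_three_mul_le {N : ℕ} (hN : 3 ≤ N) : Real.log (3 * N) ≤ 2 * Real.log N := by
  have h : (3 : ℝ) ≤ N := by exact_mod_cast hN
  rw [Real.log_mul (by norm_num) (by linarith)]
  linarith [Real.log_le_log (by norm_num) h]

/-- The total error in progressions is negligible. -/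
theorem eventually_pair_error_le (hEH : HasLevelOfDistribution 0.9999) {W : ℕ} (hW0 : 0 < W)
    {B : ℝ} (hB : ∀ x, 1 < x → 1 ≤ Real.log x → roughSum W x ≤ B * Real.log x) (k : ℕ) :
    ∃ c, 0 ≤ c ∧ ∀ᶠ N : ℕ in atTop, ∀ P : Finset ℕ, (∀ p ∈ P, p.Prime) →
      (∀ p ∈ P, p.Coprime W) → ∀ x : ℝ, (N : ℝ) ≤ x → x ≤ 3 * N →
      ∑ a : P → Option (Fin k) with (labelSize a : ℝ) ≤ (N : ℝ) ^ (0.4999 : ℝ),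
        ∑ b : P → Option (Fin k) with (labelSize b : ℝ) ≤ (N : ℝ) ^ (0.4999 : ℝ),
          progressionError x (W * supportProd (pairSupport a b)) ≤
        c * N / Real.log N ^ 10 := by
  generalize he : ((k + 1) ^ 2) ^ 2 * 2 = e
  obtain ⟨C, hC⟩ := hEH ((e + 21 : ℕ) : ℝ) (by positivity)
  refine ⟨18 * |B| ^ e + 3 * |C|, by positivity, ?_⟩
  filter_upwards [eventually_mul_log_pow_le W 0 (a := 0.0001) (by norm_num),
    eventually_le_log 2, eventually_ge_atTop 3] with N hWN hlog hN3 P hP hW x hNx hxN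
  have hN : (3 : ℝ) ≤ N := by exact_mod_cast hN3
  have hlx : Real.log N ≤ Real.log x := Real.log_le_log (by linarith) hNx
  have hlx2 : Real.log x ≤ 2 * Real.log N :=
    (Real.log_le_log (by linarith) hxN).trans (log_three_mul_le hN3)
  set u := Real.log N with hu
  have hu0 : 0 < u := by linarith
  have hy : W * ((N : ℝ) ^ (0.4999 : ℝ)) ^ 2 ≤ x ^ (0.9999 : ℝ) := by
    rw [pow_zero, mul_one] at hWN
    calc W * ((N : ℝ) ^ (0.4999 : ℝ)) ^ 2
        ≤ (N : ℝ) ^ (0.0001 : ℝ) * ((N : ℝ) ^ (0.4999 : ℝ)) ^ 2 := by gcongr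
      _ = (N : ℝ) ^ (0.9999 : ℝ) := by
          rw [← Real.rpow_natCast, ← Real.rpow_mul (by positivity), ← Real.rpow_add (by linarith)]
          norm_num
      _ ≤ _ := Real.rpow_le_rpow (by positivity) hNx (by norm_num)
  have hyx : x ^ (0.9999 : ℝ) ≤ x := by
    calc x ^ (0.9999 : ℝ) ≤ x ^ (1 : ℝ) :=
          Real.rpow_le_rpow_of_exponent_le (by linarith) (by norm_num)
      _ = x := Real.rpow_one x
  have key := sum_pair_progressionError_le (k := k) hP hW0 hW (R := (N : ℝ) ^ (0.4999 : ℝ))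
    (x := x) (y := x ^ (0.9999 : ℝ)) (T := u ^ (e + 11)) (by linarith) (by linarith) hyx hy
    (by positivity)
  rw [he] at key
  have h1 : roughSum W (((N : ℝ) ^ (0.4999 : ℝ)) ^ 2) ≤ |B| * u := by
    have h2 : Real.log (((N : ℝ) ^ (0.4999 : ℝ)) ^ 2) = 0.9998 * u := by
      rw [Real.log_pow, Real.log_rpow (by linarith)]
      push_cast; ring
    have h3 : 1 < ((N : ℝ) ^ (0.4999 : ℝ)) ^ 2 :=
      one_lt_pow₀ (Real.one_lt_rpow (by linarith) (by norm_num)) (by norm_num)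
    refine (hB _ h3 (by rw [h2]; linarith)).trans ?_
    rw [h2]
    calc B * (0.9998 * u) ≤ |B| * (0.9998 * u) := by gcongr; exact le_abs_self B
      _ ≤ |B| * u := by gcongr; linarith
  have h2 : roughSum W (((N : ℝ) ^ (0.4999 : ℝ)) ^ 2) ^ e ≤ |B| ^ e * u ^ e := by
    rw [← mul_pow]
    exact pow_le_pow_left₀ (roughSum_nonneg _ _) h1 e
  have h3 : 3 * x * Real.log x * roughSum W (((N : ℝ) ^ (0.4999 : ℝ)) ^ 2) ^ e / u ^ (e + 11) ≤
      18 * |B| ^ e * N / u ^ 10 := by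
    rw [div_le_div_iff₀ (by positivity) (by positivity)]
    calc _ ≤ 3 * (3 * N) * (2 * u) * (|B| ^ e * u ^ e) * u ^ 10 := by
          have := roughSum_nonneg W (((N : ℝ) ^ (0.4999 : ℝ)) ^ 2)
          have : 0 ≤ Real.log x := by linarith
          gcongr
      _ = _ := by ring
  have h4 : ∑ q ∈ Icc 1 ⌊x ^ (0.9999 : ℝ)⌋₊, progressionError x q ≤
      3 * |C| * N / u ^ (e + 21) := by
    refine (hC x (by linarith)).trans ?_
    rw [Real.rpow_neg (by linarith), Real.rpow_natCast, ← div_eq_mul_inv]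
    calc C * x / Real.log x ^ (e + 21) ≤ |C| * (3 * N) / u ^ (e + 21) := by
          gcongr
          · linarith
          · exact le_abs_self C
      _ = _ := by ring
  have h5 : u ^ (e + 11) * ∑ q ∈ Icc 1 ⌊x ^ (0.9999 : ℝ)⌋₊, progressionError x q ≤
      3 * |C| * N / u ^ 10 := by
    calc _ ≤ u ^ (e + 11) * (3 * |C| * N / u ^ (e + 21)) := by gcongr
      _ = _ := by
          rw [show e + 21 = (e + 11) + 10 by ring, pow_add u (e + 11)]
          field_simp
  calc _ ≤ _ := key
    _ ≤ 18 * |B| ^ e * N / u ^ 10 + 3 * |C| * N / u ^ 10 := add_le_add h3 h5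
    _ = _ := by ring

/-- The contribution of prime powers is negligible. -/
lemma eventually_prime_power_error_le (D : ℝ) :
    ∀ᶠ N : ℕ in atTop, ∀ S : ℝ, 0 ≤ S → S ≤ D * Real.log N ^ 10 →
      S * ((3 * N : ℕ) : ℝ) ^ (1 / 4 : ℝ) *
        (2 * √((3 * N : ℕ) : ℝ) * Real.log ((3 * N : ℕ) : ℝ)) ≤ N := by
  filter_upwards [eventually_mul_log_pow_le (12 * D) 11 (a := 1 / 4) (by norm_num),
    eventually_ge_atTop 3] with N h hN3 S hS0 hS
  have hN : (3 : ℝ) ≤ N := by exact_mod_cast hN3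
  have hl : 0 ≤ Real.log N := Real.log_nonneg (by linarith)
  have hl3 := log_three_mul_le hN3
  push_cast
  have h1 : (3 * N : ℝ) ^ (1 / 4 : ℝ) * √(3 * N : ℝ) ≤ 3 * (N : ℝ) ^ (3 / 4 : ℝ) := by
    rw [Real.sqrt_eq_rpow, ← Real.rpow_add (by linarith), Real.mul_rpow (by norm_num) (by linarith)]
    have : (3 : ℝ) ^ (1 / 4 + 1 / 2 : ℝ) ≤ 3 := by
      calc (3 : ℝ) ^ (1 / 4 + 1 / 2 : ℝ) ≤ 3 ^ (1 : ℝ) :=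
            Real.rpow_le_rpow_of_exponent_le (by norm_num) (by norm_num)
        _ = 3 := Real.rpow_one 3
    norm_num at this ⊢
    gcongr
  calc S * (3 * N : ℝ) ^ (1 / 4 : ℝ) * (2 * √(3 * N : ℝ) * Real.log (3 * N : ℝ))
      = S * 2 * ((3 * N : ℝ) ^ (1 / 4 : ℝ) * √(3 * N : ℝ)) * Real.log (3 * N : ℝ) := by ring
    _ ≤ (D * Real.log N ^ 10) * 2 * (3 * (N : ℝ) ^ (3 / 4 : ℝ)) * (2 * Real.log N) := by
        have : 0 ≤ Real.log (3 * N : ℝ) := Real.log_nonneg (by linarith)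
        have h2 : 0 ≤ D * Real.log N ^ 10 := hS0.trans hS
        gcongr
    _ = 12 * D * Real.log N ^ 11 * (N : ℝ) ^ (3 / 4 : ℝ) := by ring
    _ ≤ (N : ℝ) ^ (1 / 4 : ℝ) * (N : ℝ) ^ (3 / 4 : ℝ) := by gcongr
    _ = N := by
        rw [← Real.rpow_add (by linarith)]
        norm_num

/-- The squared norm of the sieve weights is negligible. -/
lemma eventually_sieve_error_le (D : ℝ) :
    ∀ᶠ N : ℕ in atTop, ∀ S : ℝ, 0 ≤ S → S ≤ D * Real.log N ^ 20 →
      ((N : ℝ) ^ (0.4999 : ℝ)) ^ 2 * S ≤ N := by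
  filter_upwards [eventually_mul_log_pow_le D 20 (a := 0.0002) (by norm_num),
    eventually_ge_atTop 3] with N h hN3 S hS0 hS
  have hN : (3 : ℝ) ≤ N := by exact_mod_cast hN3
  calc _ ≤ ((N : ℝ) ^ (0.4999 : ℝ)) ^ 2 * (N : ℝ) ^ (0.0002 : ℝ) := by
        gcongr
        exact hS.trans h
    _ = N := by
        rw [← Real.rpow_natCast, ← Real.rpow_mul (by positivity), ← Real.rpow_add (by linarith)]
        norm_num

end ErrorSizes

/-! ### The admissible tuple and the sieving primes -/

section Setup

open Finset

/-- The admissible tuple `(0, 2, 6, 8, 12)`. -/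
def primeTuple : Fin 5 → ℕ := ![0, 2, 6, 8, 12]

lemma primeTuple_le (i : Fin 5) : primeTuple i ≤ 12 := by
  revert i; decide

lemma primeTuple_injective : Function.Injective primeTuple := by
  decide

lemma eq_of_dvd_add_primeTuple {p : ℕ} (hp : 12 < p) (n : ℕ) (i j : Fin 5)
    (hi : p ∣ n + primeTuple i) (hj : p ∣ n + primeTuple j) : i = j := by
  have h1 := Nat.dvd_sub hi hj
  have h2 := Nat.dvd_sub hj hi
  rw [Nat.add_sub_add_left] at h1 h2
  have hi' := primeTuple_le i
  have hj' := primeTuple_le j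
  have h3 := Nat.eq_zero_of_dvd_of_lt h1 (by omega)
  have h4 := Nat.eq_zero_of_dvd_of_lt h2 (by omega)
  exact primeTuple_injective (by omega)

lemma exists_residue_prime {p : ℕ} (hp : p.Prime) :
    ∃ v, ∀ i, ¬ p ∣ v + primeTuple i := by
  by_cases h : p = 11 ∨ p = 13 ∨ p = 17 ∨ p = 19 ∨ p = 23
  · refine ⟨101, fun i hi => ?_⟩
    have hq : (101 + primeTuple i).Prime := by
      fin_cases i <;> norm_num [primeTuple]
    have := (Nat.prime_dvd_prime_iff_eq hp hq).1 hi
    omega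
  · refine ⟨11, fun i hi => h ?_⟩
    have hq : (11 + primeTuple i).Prime := by
      fin_cases i <;> norm_num [primeTuple]
    rw [(Nat.prime_dvd_prime_iff_eq hp hq).1 hi]
    fin_cases i <;> simp [primeTuple]

lemma exists_admissible_residue (T : Finset ℕ) (hT : ∀ p ∈ T, p.Prime) :
    ∃ v, ∀ i, (v + primeTuple i).Coprime (∏ p ∈ T, p) := by
  have h : ∃ v, ∀ p ∈ T, ∀ i, ¬ p ∣ v + primeTuple i := by
    choose! w hw using fun p (hp : p ∈ T) => exists_residue_prime (hT p hp)
    have hc : Set.Pairwise (T : Set ℕ) (Function.onFun Nat.Coprime id) := fun p hp q hq hpq =>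
      (Nat.coprime_primes (hT p hp) (hT q hq)).2 hpq
    obtain ⟨v, hv⟩ := Nat.chineseRemainderOfFinset w id T (fun p hp => (hT p hp).ne_zero) hc
    refine ⟨v, fun p hp i hi => hw p hp i ?_⟩
    exact ((Nat.ModEq.dvd_iff ((hv p hp).add_right _) dvd_rfl).1 hi)
  obtain ⟨v, hv⟩ := h
  exact ⟨v, fun i => Nat.Coprime.prod_right fun p hp =>
    ((Nat.Prime.coprime_iff_not_dvd (hT p hp)).2 (hv p hp i)).symm⟩

/-- The primes up to `D`. -/
def smallPrimes (D : ℕ) : Finset ℕ := {p ∈ range (D + 1) | p.Prime}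

lemma prime_of_mem_smallPrimes {D : ℕ} : ∀ p ∈ smallPrimes D, p.Prime :=
  fun _ hp => (mem_filter.1 hp).2

/-- The primes up to `R` that are coprime to `W`. -/
noncomputable def sievePrimes (W : ℕ) (R : ℝ) : Finset ℕ :=
  {p ∈ Icc 1 ⌊R⌋₊ | p.Prime ∧ p.Coprime W}

lemma mem_sievePrimes {W : ℕ} {R : ℝ} {p : ℕ} :
    p ∈ sievePrimes W R ↔ (p : ℝ) ≤ R ∧ p.Prime ∧ p.Coprime W := by
  rw [sievePrimes, mem_filter, mem_Icc]
  constructor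
  · rintro ⟨⟨h1, h2⟩, h3⟩
    exact ⟨(Nat.le_floor_iff' (by omega)).1 h2, h3⟩
  · rintro ⟨h1, h2, h3⟩
    exact ⟨⟨h2.one_lt.le, Nat.le_floor h1⟩, h2, h3⟩

lemma lt_of_mem_sievePrimes {D : ℕ} {R : ℝ} {p : ℕ}
    (hp : p ∈ sievePrimes (∏ q ∈ smallPrimes D, q) R) : D < p := by
  obtain ⟨-, h2, h3⟩ := mem_sievePrimes.1 hp
  by_contra hn
  refine (Nat.Prime.coprime_iff_not_dvd h2).1 h3 (dvd_prod_of_mem (fun q => q) ?_)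
  exact mem_filter.2 ⟨mem_range.2 (by omega), h2⟩

lemma sum_sievePrimes_inv_sq_le (D : ℕ) (R : ℝ) :
    ∑ p ∈ sievePrimes (∏ q ∈ smallPrimes D, q) R, 1 / (p : ℝ) ^ 2 ≤ 2 / ((D : ℝ) + 1) := by
  refine le_trans ?_ (sum_Ioo_inv_sq_le (α := ℝ) D (⌊R⌋₊ + 1))
  simp_rw [one_div]
  refine sum_le_sum_of_subset_of_nonneg (fun p hp => ?_) fun _ _ _ => by positivity
  have h := mem_Icc.1 (mem_filter.1 hp).1
  exact mem_Ioo.2 ⟨lt_of_mem_sievePrimes hp, by omega⟩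

end Setup

/-! ### The limiting inequality -/

section Limit

open Topology

lemma limit_inequality {δ I J η M M₁ C C₁ K K' c w : ℝ} (hδ : 0 < δ)
    (h : ∀ᶠ N : ℕ in atTop,
      5 * (((δ * (0.4999 * Real.log N)) ^ 2 *
        ((δ * (0.4999 * Real.log N)) ^ 4 * J - K' * (0.4999 * Real.log N) ^ 3) -
        (δ * (0.4999 * Real.log N) + C) ^ 4 *
          ((δ * (0.4999 * Real.log N)) ^ 2 * (M₁ ^ 2 * (20 * η)) +
          (2 * η * ((δ * (0.4999 * Real.log N)) ^ 2 * M₁ ^ 2) +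
            2 * (δ * (0.4999 * Real.log N) * M₁) *
              (C₁ + M * (δ * (0.4999 * Real.log N) + C) * η)) +
          (24 * ((δ * (0.4999 * Real.log N)) ^ 2 * M₁ ^ 2) +
            2 * (δ * (0.4999 * Real.log N) * M₁) *
              (M * (δ * (0.4999 * Real.log N) + C))) * (4 * η))) / δ - c) ≤
      (Real.log N + 2) *
        ((δ * (0.4999 * Real.log N)) ^ 5 * I + K * (0.4999 * Real.log N) ^ 4 + w)) :
    5 * 0.4999 * (J - η * (118 * M₁ ^ 2 + 10 * (M₁ * M))) ≤ I := by
  set F : ℝ → ℝ → ℝ := fun y t => 5 * (((δ * (0.4999 * y)) ^ 2 *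
        ((δ * (0.4999 * y)) ^ 4 * J - K' * t * (0.4999 * y) ^ 3) -
        (δ * (0.4999 * y) + C * t) ^ 4 *
          ((δ * (0.4999 * y)) ^ 2 * (M₁ ^ 2 * (20 * η)) +
          (2 * η * ((δ * (0.4999 * y)) ^ 2 * M₁ ^ 2) +
            2 * (δ * (0.4999 * y) * M₁) *
              (C₁ * t + M * (δ * (0.4999 * y) + C * t) * η)) +
          (24 * ((δ * (0.4999 * y)) ^ 2 * M₁ ^ 2) +
            2 * (δ * (0.4999 * y) * M₁) *
              (M * (δ * (0.4999 * y) + C * t))) * (4 * η))) / δ - c * t ^ 6) with hF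
  set G : ℝ → ℝ → ℝ := fun y t => (y + 2 * t) *
        ((δ * (0.4999 * y)) ^ 5 * I + K * t * (0.4999 * y) ^ 4 + w * t ^ 5) with hG
  have hFh : ∀ s y t, F (s * y) (s * t) = s ^ 6 * F y t := by
    intro s y t
    simp only [hF]
    ring
  have hGh : ∀ s y t, G (s * y) (s * t) = s ^ 6 * G y t := by
    intro s y t
    simp only [hG]
    ring
  have hlog : Tendsto (fun N : ℕ => Real.log N) atTop atTop :=
    Real.tendsto_log_atTop.comp tendsto_natCast_atTop_atTop
  have hz : Tendsto (fun N : ℕ => (Real.log N)⁻¹) atTop (𝓝 0) := hlog.inv_tendsto_atTop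
  have hle : ∀ᶠ N : ℕ in atTop, F 1 (Real.log N)⁻¹ ≤ G 1 (Real.log N)⁻¹ := by
    filter_upwards [h, hlog.eventually (eventually_gt_atTop 0)] with N hN hpos
    set y := Real.log N
    have h1 : F y 1 ≤ G y 1 := by
      simpa only [hF, hG, mul_one, one_pow] using hN
    have h2 := hFh y 1 y⁻¹
    have h3 := hGh y 1 y⁻¹
    rw [mul_one, mul_inv_cancel₀ hpos.ne'] at h2 h3
    rw [h2, h3] at h1
    exact le_of_mul_le_mul_left h1 (by positivity)
  have hFc : Continuous (F 1) := by simp only [hF]; fun_prop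
  have hGc : Continuous (G 1) := by simp only [hG]; fun_prop
  have key := le_of_tendsto_of_tendsto ((hFc.tendsto 0).comp hz) ((hGc.tendsto 0).comp hz) hle
  simp only [hF, hG] at key
  have e1 : (5 * (((δ * (0.4999 * 1)) ^ 2 *
        ((δ * (0.4999 * 1)) ^ 4 * J - K' * 0 * (0.4999 * 1) ^ 3) -
        (δ * (0.4999 * 1) + C * 0) ^ 4 *
          ((δ * (0.4999 * 1)) ^ 2 * (M₁ ^ 2 * (20 * η)) +
          (2 * η * ((δ * (0.4999 * 1)) ^ 2 * M₁ ^ 2) +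
            2 * (δ * (0.4999 * 1) * M₁) *
              (C₁ * 0 + M * (δ * (0.4999 * 1) + C * 0) * η)) +
          (24 * ((δ * (0.4999 * 1)) ^ 2 * M₁ ^ 2) +
            2 * (δ * (0.4999 * 1) * M₁) *
              (M * (δ * (0.4999 * 1) + C * 0))) * (4 * η))) / δ - c * 0 ^ 6) : ℝ) =
      (δ * 0.4999) ^ 5 * (5 * 0.4999 * (J - η * (118 * M₁ ^ 2 + 10 * (M₁ * M)))) := by
    field_simp
    ring
  have e2 : ((1 + 2 * 0) *
        ((δ * (0.4999 * 1)) ^ 5 * I + K * 0 * (0.4999 * 1) ^ 4 + w * 0 ^ 5) : ℝ) =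
      (δ * 0.4999) ^ 5 * I := by ring
  rw [e1, e2] at key
  exact le_of_mul_le_mul_left key (by positivity)

end Limit

/-! ### Two primes in the tuple -/

section TwoPrimes

open Finset

lemma exists_le_sum_lowerDiag {W : ℕ} (hW0 : 0 < W) {C M M₁ : ℝ} (hC : 0 ≤ C)
    (hW : ∀ x : ℝ, 1 ≤ x → |roughSum W x - density W * Real.log x| ≤ C)
    (hM : TriangleBound (polyEval sieveTerms) M)
    (hM₁ : TriangleBound (polyEval (polyIntegral sieveTerms)) M₁) :
    ∃ C₁ K : ℝ, ∀ R : ℝ, 1 < R → 1 ≤ Real.log R → (∀ p ∈ sievePrimes W R, 24 ≤ p) →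
      ∀ η : ℝ, ∑ p ∈ sievePrimes W R, 1 / (p : ℝ) ^ 2 ≤ η → ∀ m : Fin 5,
      ((density W * Real.log R) ^ 2 *
        ((density W * Real.log R) ^ 4 * polyEval numeratorTerms 1 0 - K * Real.log R ^ 3) -
        (density W * Real.log R + C) ^ 4 *
          ((density W * Real.log R) ^ 2 * (M₁ ^ 2 * (20 * η)) +
          (2 * η * ((density W * Real.log R) ^ 2 * M₁ ^ 2) +
            2 * (density W * Real.log R * M₁) *
              (C₁ + M * (density W * Real.log R + C) * η)) +
          (24 * ((density W * Real.log R) ^ 2 * M₁ ^ 2) +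
            2 * (density W * Real.log R * M₁) *
              (M * (density W * Real.log R + C))) * (4 * η))) ≤
      ∑ r : sievePrimes W R → Option (Fin 4), (∏ p : sievePrimes W R, lowerDiag (p : ℝ) (r p)) *
        restrictCoeff m R (polyEval sieveTerms) r ^ 2 := by
  obtain ⟨B, hB, hstep⟩ := roughStep_polyEval sieveTerms
  obtain ⟨K, hK, hiter⟩ := iterate_roughStep_polyEval
    (polyMul (polyIntegral sieveTerms) (polyIntegral sieveTerms)) 4 hC hW
  refine ⟨C * B, K, fun R hR hl hP24 η hη m => ?_⟩
  have hδ := density_pos hW0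
  have hM0 := hM.nonneg
  have hM₁0 := hM₁.nonneg
  refine le_trans ?_ (le_sum_lowerDiag_restrictCoeff (k := 4) (P := sievePrimes W R)
    (fun p hp => (mem_sievePrimes.1 hp).2.1) hP24 (fun p hp => (mem_sievePrimes.1 hp).2.2) hR
    (fun p h1 h2 h3 => mem_sievePrimes.2 ⟨h3, h1, h2⟩)
    (L := density W * Real.log R) (by positivity) hM hM₁ (hstep W C hC hW R hR) m rfl)
  have h1 := (abs_le.1 (hiter R hR hl 1 0 zero_le_one le_rfl (by norm_num))).1
  have e1 : Real.log R ^ 4 / Real.log R = Real.log R ^ 3 := by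
    field_simp
  have e2 : polyEval (polyMul (polyIntegral sieveTerms) (polyIntegral sieveTerms)) =
      fun u q => polyEval (polyIntegral sieveTerms) u q ^ 2 := by
    funext u q
    rw [polyEval_mul, sq]
  rw [e1, e2] at h1
  have hA := (abs_le.1 (hW R hR.le)).2
  have hA0 := roughSum_nonneg W R
  have hη0 : (0 : ℝ) ≤ ∑ p ∈ sievePrimes W R, 1 / (p : ℝ) ^ 2 :=
    sum_nonneg fun _ _ => by positivity
  have hA' : roughSum W R ≤ density W * Real.log R + C := by linarith
  set L := density W * Real.log R with hL
  have hL0 : 0 ≤ L := by positivity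
  refine sub_le_sub (mul_le_mul_of_nonneg_left ?_ (by positivity)) ?_
  · have : polyEval numeratorTerms 1 0 = polyEval (polyIntegral^[4]
      (polyMul (polyIntegral sieveTerms) (polyIntegral sieveTerms))) 1 0 := rfl
    rw [this]
    linarith
  · have e3 : ((4 : ℕ) : ℝ) + ((4 : ℕ) : ℝ) ^ 2 = 20 := by norm_num
    rw [e3, Nat.cast_ofNat]
    gcongr

lemma sum_log_primes_le {n N : ℕ} (hN : 12 ≤ N) (hn : n ≤ 2 * N)
    (h : ∀ i j, (n + primeTuple i).Prime → (n + primeTuple j).Prime → i = j) :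
    ∑ m : Fin 5, (if (n + primeTuple m).Prime then Real.log (n + primeTuple m : ℕ) else 0) ≤
      Real.log N + 2 := by
  have hN' : (12 : ℝ) ≤ N := by exact_mod_cast hN
  have hpos : 0 ≤ Real.log N := Real.log_nonneg (by linarith)
  by_cases hp : ∃ i, (n + primeTuple i).Prime
  · obtain ⟨i, hi⟩ := hp
    rw [sum_eq_single i (fun j _ hj => if_neg fun hj' => hj (h j i hj' hi)) (by simp), if_pos hi]
    have h1 : ((n + primeTuple i : ℕ) : ℝ) ≤ 3 * N := by
      have := primeTuple_le i
      exact_mod_cast (by omega : n + primeTuple i ≤ 3 * N)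
    refine (Real.log_le_log (by exact_mod_cast hi.pos) h1).trans ?_
    rw [Real.log_mul (by norm_num) (by linarith)]
    have := Real.log_le_sub_one_of_pos (by norm_num : (0 : ℝ) < 3)
    linarith
  · push Not at hp
    rw [sum_eq_zero fun j _ => if_neg (hp j)]
    linarith

open scoped Classical in
theorem exists_two_primes (hEH : HasLevelOfDistribution 0.9999) (N₀ : ℕ) :
    ∃ n, N₀ ≤ n ∧ ∃ i j, i ≠ j ∧ (n + primeTuple i).Prime ∧ (n + primeTuple j).Prime := by
  by_contra! hcon
  obtain ⟨M, -, hM⟩ := polyEval_bound sieveTerms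
  obtain ⟨M₁, -, hM₁⟩ := polyEval_bound (polyIntegral sieveTerms)
  change TriangleBound _ _ at hM hM₁
  have hM0 := hM.nonneg
  have hM₁0 := hM₁.nonneg
  have hJ := polyEval_denominatorTerms_lt
  set J := polyEval numeratorTerms 1 0 with hJdef
  set I := polyEval denominatorTerms 1 0 with hIdef
  set g := 24995 * J - 10000 * I with hg
  have hg0 : 0 < g := by linarith
  set c₀ := 118 * M₁ ^ 2 + 10 * (M₁ * M) with hc₀
  have hc₀0 : 0 ≤ c₀ := by positivity
  set η := g / (24995 * (c₀ + 1)) with hη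
  have hη0 : 0 < η := by positivity
  have hηc : 24995 * (η * c₀) < g := by
    have : 24995 * (η * (c₀ + 1)) = g := by rw [hη]; field_simp
    linarith
  obtain ⟨D, hD⟩ : ∃ D : ℕ, 2 ^ 32 ≤ D ∧ 2 / ((D : ℝ) + 1) ≤ η := by
    refine ⟨max (2 ^ 32) ⌈2 / η⌉₊, le_max_left _ _, ?_⟩
    rw [div_le_comm₀ (by positivity) hη0]
    have h1 : ((⌈2 / η⌉₊ : ℕ) : ℝ) ≤ ((max (2 ^ 32) ⌈2 / η⌉₊ : ℕ) : ℝ) :=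
      Nat.cast_le.2 (le_max_right _ _)
    have h2 := Nat.le_ceil (2 / η)
    linarith
  obtain ⟨hD32, hDη⟩ := hD
  obtain ⟨C, hC, hCW⟩ := roughSum_asymp (smallPrimes D) prime_of_mem_smallPrimes
  obtain ⟨v, hv⟩ := exists_admissible_residue (smallPrimes D) prime_of_mem_smallPrimes
  have hPD : ∀ R, ∀ p ∈ sievePrimes (∏ p ∈ smallPrimes D, p) R, D < p :=
    fun R p hp => lt_of_mem_sievePrimes hp
  have hPη : ∀ R, ∑ p ∈ sievePrimes (∏ p ∈ smallPrimes D, p) R, 1 / (p : ℝ) ^ 2 ≤ η :=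
    fun R => (sum_sievePrimes_inv_sq_le D R).trans hDη
  have hW0 : 0 < ∏ p ∈ smallPrimes D, p :=
    prod_pos fun p hp => (prime_of_mem_smallPrimes p hp).pos
  generalize (∏ p ∈ smallPrimes D, p) = W at *
  have hδ := density_pos hW0
  obtain ⟨C₁, K', hlow⟩ := exists_le_sum_lowerDiag hW0 hC hCW hM hM₁
  obtain ⟨K, hK, hiter⟩ := iterate_roughStep_polyEval (polyMul sieveTerms sieveTerms) 5 hC hCW
  have hB : ∀ x, 1 < x → 1 ≤ Real.log x → roughSum W x ≤ (1 + C) * Real.log x :=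
    fun x hx hl => roughSum_le_mul_log hCW hx hl hC
  obtain ⟨c, hc, hpair⟩ := eventually_pair_error_le hEH hW0 hB 4
  have key := limit_inequality (I := I) (J := J) (η := η) (M := M) (M₁ := M₁) (C := C) (C₁ := C₁)
    (K := K) (K' := K') (c := W * (2 * c * (M ^ 2 * (1 + C) ^ 10) + 1)) (w := W) hδ ?_
  · rw [← hc₀] at key
    have : 24995 * (J - η * c₀) ≤ 10000 * I := by
      have := mul_le_mul_of_nonneg_left key (by norm_num : (0 : ℝ) ≤ 10000)
      linarith
    linarith
  filter_upwards [hpair, eventually_prime_power_error_le (M ^ 2 * (1 + C) ^ 10),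
    eventually_sieve_error_le (M ^ 2 * (1 + C) ^ 20), eventually_le_log (1 / 0.4999),
    eventually_ge_atTop 12, eventually_ge_atTop N₀] with N hpair hpp hse hlogN hN12 hNN₀
  have hN : (12 : ℝ) ≤ N := by exact_mod_cast hN12
  set R : ℝ := (N : ℝ) ^ (0.4999 : ℝ) with hR
  have hlogR : Real.log R = 0.4999 * Real.log N := by
    rw [hR, Real.log_rpow (by linarith)]
  have hl1 : 1 ≤ Real.log R := by
    rw [hlogR]
    have := mul_le_mul_of_nonneg_left hlogN (by norm_num : (0 : ℝ) ≤ 0.4999)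
    rwa [mul_one_div_cancel (by norm_num)] at this
  have hR1 : 1 < R := Real.one_lt_rpow (by linarith) (by norm_num)
  have hRN : R ≤ N := by
    calc R ≤ (N : ℝ) ^ (1 : ℝ) :=
          Real.rpow_le_rpow_of_exponent_le (by linarith) (by norm_num)
      _ = N := Real.rpow_one _
  have hlN0 : 0 ≤ Real.log N := Real.log_nonneg (by linarith)
  rw [← hlogR]
  specialize hlow R hR1 hl1 (fun p hp => by have := hPD R p hp; omega) η (hPη R)
  set P := sievePrimes W R with hPdef
  have hPp : ∀ p ∈ P, p.Prime := fun p hp => (mem_sievePrimes.1 hp).2.1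
  have hPW : ∀ p ∈ P, p.Coprime W := fun p hp => (mem_sievePrimes.1 hp).2.2
  have hPN : ∀ p ∈ P, p ≤ N := fun p hp => by
    exact_mod_cast (mem_sievePrimes.1 hp).1.trans hRN
  have hPd : ∀ p ∈ P, ∀ n i j, p ∣ n + primeTuple i → p ∣ n + primeTuple j → i = j :=
    fun p hp n i j => eq_of_dvd_add_primeTuple (by have := hPD R p hp; omega) n i j
  have hA0 := roughSum_nonneg W R
  have hAN : roughSum W R ≤ (1 + C) * Real.log N := by
    refine (hB R hR1 hl1).trans (mul_le_mul_of_nonneg_left ?_ (by positivity))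
    rw [hlogR]
    linarith
  set A := roughSum W R with hA
  have hS1 : (M * A ^ 5) ^ 2 ≤ M ^ 2 * (1 + C) ^ 10 * Real.log N ^ 10 := by
    calc _ ≤ (M * ((1 + C) * Real.log N) ^ 5) ^ 2 := by gcongr
      _ = _ := by ring
  have hS2 : (A ^ 5 * (M * A ^ 5)) ^ 2 ≤ M ^ 2 * (1 + C) ^ 20 * Real.log N ^ 20 := by
    calc _ ≤ (((1 + C) * Real.log N) ^ 5 * (M * ((1 + C) * Real.log N) ^ 5)) ^ 2 := by gcongr
      _ = _ := by ring
  have hmain := fun m => le_sum_prime_sieve_weights hW0 hPp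
    (fun p hp => hD32.trans (hPD R p hp).le) hPW primeTuple hPd m (X := 3 * N) (hv m)
    (by omega : 0 < N) hPN (fun i => by have := primeTuple_le i; omega) hR1 hM
  have hup := sum_sieve_weights_le hW0 hPp (fun p hp => by have := hPD R p hp; omega) hPW
    primeTuple hPd v N hR1 hM
  rw [← hA] at hup
  simp only [← hA] at hmain
  have hiter1 := (abs_le.1 (hiter R hR1 hl1 1 0 zero_le_one le_rfl (by norm_num))).2
  have e1 : Real.log R ^ 5 / Real.log R = Real.log R ^ 4 := by
    field_simp
  have e2 : polyEval (polyMul sieveTerms sieveTerms) =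
      fun u q => polyEval sieveTerms u q ^ 2 := by
    funext u q
    rw [polyEval_mul, sq]
  rw [e1, e2] at hiter1
  set w : ℕ → ℝ := fun n =>
    (∑ a : P → Option (Fin 5), sieveWeight R (polyEval sieveTerms) a *
      if Hits primeTuple n a then 1 else 0) ^ 2 with hw
  set L := density W * Real.log R with hL
  set low := L ^ 2 * (L ^ 4 * J - K' * Real.log R ^ 3) -
        (L + C) ^ 4 * (L ^ 2 * (M₁ ^ 2 * (20 * η)) +
          (2 * η * (L ^ 2 * M₁ ^ 2) + 2 * (L * M₁) * (C₁ + M * (L + C) * η)) +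
          (24 * (L ^ 2 * M₁ ^ 2) + 2 * (L * M₁) * (M * (L + C))) * (4 * η)) with hlowdef
  have hm : ∀ m, (N : ℝ) / Nat.totient W * low - (2 * c * (M ^ 2 * (1 + C) ^ 10) + 1) * N ≤
      ∑ n ∈ Ioc N (2 * N) with n ≡ v [MOD W],
        (if (n + primeTuple m).Prime then Real.log (n + primeTuple m : ℕ) else 0) * w n := by
    intro m
    refine le_trans ?_ (hmain m)
    have hh : ((primeTuple m : ℕ) : ℝ) ≤ 12 := by exact_mod_cast primeTuple_le m
    have hh0 : (0 : ℝ) ≤ (primeTuple m : ℕ) := Nat.cast_nonneg _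
    have p1 := hpair P hPp hPW (2 * N + primeTuple m) (by linarith) (by linarith)
    have p2 := hpair P hPp hPW (N + primeTuple m) (by linarith) (by linarith)
    have p3 := hpp ((M * A ^ 5) ^ 2) (by positivity) hS1
    have hlN : 0 < Real.log N := lt_of_lt_of_le (by norm_num) hlogN
    have p4 : (M * A ^ 5) ^ 2 * (c * N / Real.log N ^ 10 + c * N / Real.log N ^ 10) ≤
        2 * c * (M ^ 2 * (1 + C) ^ 10) * N := by
      calc _ ≤ M ^ 2 * (1 + C) ^ 10 * Real.log N ^ 10 *
            (c * N / Real.log N ^ 10 + c * N / Real.log N ^ 10) := by gcongr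
        _ = _ := by field_simp; ring
    have p5 := mul_le_mul_of_nonneg_left (add_le_add p1 p2) (sq_nonneg (M * A ^ 5))
    have p6 := mul_le_mul_of_nonneg_left (hlow m)
      (by positivity : (0 : ℝ) ≤ (N : ℝ) / Nat.totient W)
    linarith
  have hone : ∀ n, N < n → n ≤ 2 * N →
      ∑ m : Fin 5, (if (n + primeTuple m).Prime then Real.log (n + primeTuple m : ℕ) else 0) ≤
        Real.log N + 2 := fun n h1 h2 => sum_log_primes_le hN12 h2 fun i j hi hj => by
    by_contra hij
    exact hcon n (by omega) i j hij hi hj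
  have htot : 5 * ((N : ℝ) / Nat.totient W * low -
      (2 * c * (M ^ 2 * (1 + C) ^ 10) + 1) * N) ≤
      (Real.log N + 2) * ∑ n ∈ Ioc N (2 * N) with n ≡ v [MOD W], w n := by
    calc _ = ∑ _m : Fin 5, ((N : ℝ) / Nat.totient W * low -
          (2 * c * (M ^ 2 * (1 + C) ^ 10) + 1) * N) := by
            rw [sum_const, card_univ, Fintype.card_fin, nsmul_eq_mul, Nat.cast_ofNat]
      _ ≤ _ := sum_le_sum fun m _ => hm m
      _ = ∑ n ∈ Ioc N (2 * N) with n ≡ v [MOD W], (∑ m : Fin 5,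
          (if (n + primeTuple m).Prime then Real.log (n + primeTuple m : ℕ) else 0)) * w n := by
        rw [sum_comm]
        simp_rw [sum_mul]
      _ ≤ ∑ n ∈ Ioc N (2 * N) with n ≡ v [MOD W], (Real.log N + 2) * w n := by
        refine sum_le_sum fun n hn => mul_le_mul_of_nonneg_right ?_ (sq_nonneg _)
        have h := mem_Ioc.1 (mem_filter.1 hn).1
        exact hone n h.1 h.2
      _ = _ := by rw [mul_sum]
  have hWr : (0 : ℝ) < W := by exact_mod_cast hW0
  have hφ : (0 : ℝ) < Nat.totient W := by exact_mod_cast Nat.totient_pos.2 hW0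
  have hNpos : (0 : ℝ) < N := by linarith
  have hup2 : ∑ n ∈ Ioc N (2 * N) with n ≡ v [MOD W], w n ≤
      (N : ℝ) / W * (L ^ 5 * I + K * Real.log R ^ 4) + N := by
    refine hup.trans (add_le_add (mul_le_mul_of_nonneg_left ?_ (by positivity)) ?_)
    · have : I = polyEval (polyIntegral^[5] (polyMul sieveTerms sieveTerms)) 1 0 := rfl
      rw [this]
      linarith
    · have := hse ((A ^ 5 * (M * A ^ 5)) ^ 2) (by positivity) hS2
      refine le_trans (le_of_eq ?_) this
      ring
  have hfin := htot.trans (mul_le_mul_of_nonneg_left hup2 (by linarith))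
  have hscale := mul_le_mul_of_nonneg_left hfin (by positivity : 0 ≤ (W : ℝ) / N)
  refine le_trans (le_of_eq ?_) (hscale.trans (le_of_eq ?_))
  · rw [density]
    field_simp
  · field_simp

end TwoPrimes

/-! ### Gaps between consecutive primes -/

lemma frequently_gap_le
    (h : ∀ N₀, ∃ n, N₀ ≤ n ∧ ∃ i j, i ≠ j ∧ (n + primeTuple i).Prime ∧ (n + primeTuple j).Prime) :
    ∃ᶠ n : ℕ in atTop,
      (Nat.nth Nat.Prime (n + 1) : ℝ) - (Nat.nth Nat.Prime n : ℝ) ≤ 12 := by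
  rw [frequently_atTop]
  intro a
  obtain ⟨n, hn, i, j, hij, hi, hj⟩ := h (Nat.nth Nat.Prime a)
  wlog hlt : primeTuple i < primeTuple j generalizing i j
  · exact this j i hij.symm hj hi
      (lt_of_le_of_ne (not_lt.1 hlt) fun h => hij (primeTuple_injective h.symm))
  have hinf := Nat.infinite_setOfPred_prime
  refine ⟨Nat.count Nat.Prime (n + primeTuple i), ?_, ?_⟩
  · rw [← Nat.count_nth_of_infinite hinf a]
    exact Nat.count_monotone _ (hn.trans (Nat.le_add_right _ _))
  · have h1 : Nat.nth Nat.Prime (Nat.count Nat.Prime (n + primeTuple i)) = n + primeTuple i :=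
      Nat.nth_count hi
    have h2 : Nat.nth Nat.Prime (Nat.count Nat.Prime (n + primeTuple i) + 1) ≤
        n + primeTuple j := by
      have h3 : Nat.count Nat.Prime (n + primeTuple i) + 1 ≤
          Nat.count Nat.Prime (n + primeTuple j) :=
        Nat.count_strict_mono hi (by omega)
      calc _ ≤ Nat.nth Nat.Prime (Nat.count Nat.Prime (n + primeTuple j)) :=
            (Nat.nth_strictMono hinf).monotone h3
        _ = _ := Nat.nth_count hj
    have h4 := primeTuple_le j
    have h5 : Nat.nth Nat.Prime (Nat.count Nat.Prime (n + primeTuple i) + 1) ≤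
        Nat.nth Nat.Prime (Nat.count Nat.Prime (n + primeTuple i)) + 12 := by omega
    have h6 : (Nat.nth Nat.Prime (Nat.count Nat.Prime (n + primeTuple i) + 1) : ℝ) ≤
        Nat.nth Nat.Prime (Nat.count Nat.Prime (n + primeTuple i)) + 12 := by exact_mod_cast h5
    linarith

/-- Under the Elliott–Halberstam conjecture, `liminf (p_{n+1} - p_n) ≤ 12`. -/
theorem elliott_halberstam_imp_liminf_gap_le_twelve
    (hEH : ∀ θ : ℝ, 0 < θ → θ < 1 → HasLevelOfDistribution θ) :
    Filter.liminf
        (fun n : ℕ => (Nat.nth Nat.Prime (n + 1) : ℝ) - (Nat.nth Nat.Prime n : ℝ)) atTop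
      ≤ 12 := by
  refine Filter.liminf_le_of_frequently_le
    (frequently_gap_le (exists_two_primes (hEH 0.9999 (by norm_num) (by norm_num)))) ?_
  refine Filter.isBoundedUnder_of ⟨0, fun n => sub_nonneg.2 ?_⟩
  exact_mod_cast (Nat.nth_strictMono Nat.infinite_setOfPred_prime).monotone n.le_succ
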